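/- Let Q satisfy Assumption (A). There exists a constant C₀ > 0 such that for every R > 0 there exists δ₀(R) > 0 with the following property: every f ∈ E_rad ∩ Eq(Q) satisfying |f − Q|_E ≤ R and |∇φ_f − ∇φ_Q|_{L²(ℝ³)} ≤ δ₀(R) satisfies H(f) − H(Q) ≥ C₀ |∇φ_f − ∇φ_Q|²_{L²(ℝ³)}. If in addition H(f) = H(Q), then f = Q. -/

import Mathlib

noncomputable section

open MeasureTheory Real Filter Set Topology
open scoped ENNReal NNReal

abbrev E3 : Type := EuclideanSpace ℝ (Fin 3)
abbrev Phase : Type := E3 × E3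

/-- Spherical symmetry: invariance under all rotations of `ℝ³` acting jointly on `x` and `v`. -/
def SphSym (f : Phase → ℝ) : Prop :=
  ∀ R : E3 ≃ₗᵢ[ℝ] E3, LinearMap.det (R.toLinearEquiv : E3 →ₗ[ℝ] E3) = 1 →
    ∀ z : Phase, f (R z.1, R z.2) = f z

/-- `|x × v|²`, via the Lagrange identity. -/
def ellOf (z : Phase) : ℝ := ‖z.1‖ ^ 2 * ‖z.2‖ ^ 2 - (inner ℝ z.1 z.2 : ℝ) ^ 2

/-- Spatial density. -/
def rhoF (f : Phase → ℝ) (x : E3) : ℝ := ∫ v : E3, f (x, v)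

/-- Poisson field. -/
def phiF (f : Phase → ℝ) (x : E3) : ℝ := - ∫ y : E3, rhoF f y / (4 * π * ‖x - y‖)

/-- Radial representation of the Poisson field. -/
def phiRad (f : Phase → ℝ) (r : ℝ) : ℝ :=
  phiF f (r • (EuclideanSpace.single (0 : Fin 3) (1:ℝ)))

def mass (f : Phase → ℝ) : ℝ := ∫ z : Phase, f z

def kineticE (f : Phase → ℝ) : ℝ := ∫ z : Phase, ‖z.2‖ ^ 2 * f z

def gradPhi (f : Phase → ℝ) (x : E3) : E3 := gradient (phiF f) x

def fieldSq (f : Phase → ℝ) : ℝ := ∫ x : E3, ‖gradPhi f x‖ ^ 2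

/-- `L²` distance between the force fields of `f` and `g`. -/
def fieldDist (f g : Phase → ℝ) : ℝ :=
  Real.sqrt (∫ x : E3, ‖gradPhi f x - gradPhi g x‖ ^ 2)

/-- The Hamiltonian. -/
def Ham (f : Phase → ℝ) : ℝ := kineticE f / 2 - fieldSq f / 2

/-- The norm of the energy space. -/
def eNormE (f : Phase → ℝ) : ℝ≥0∞ :=
  eLpNorm f 1 volume + eLpNorm f ⊤ volume +
    ∫⁻ z : Phase, (‖z.2‖₊ : ℝ≥0∞) ^ 2 * (‖f z‖₊ : ℝ≥0∞)

def memE (f : Phase → ℝ) : Prop := Measurable f ∧ (∀ z, 0 ≤ f z) ∧ eNormE f < ⊤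

def memErad (f : Phase → ℝ) : Prop := memE f ∧ SphSym f

/-- Density of the measure `ν_ℓ`. -/
def nuDens (ℓ : ℝ) (p : ℝ × ℝ) : ℝ≥0∞ :=
  if 0 < p.1 ∧ ℓ < p.1 ^ 2 * p.2 ^ 2 then
    ENNReal.ofReal (4 * π ^ 2 * p.1 * |p.2| / Real.sqrt (p.1 ^ 2 * p.2 ^ 2 - ℓ))
  else 0

def nuMeas (ℓ : ℝ) : Measure (ℝ × ℝ) := volume.withDensity (nuDens ℓ)

/-- Representative phase point with `|x| = r`, `|v| = |u|`, `|x×v|² = ℓ` and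
`x·v = sign u · √(r²u²-ℓ)`. -/
def radPoint (r u ℓ : ℝ) : Phase :=
  (r • (EuclideanSpace.single (0 : Fin 3) (1:ℝ)),
   (Real.sign u * Real.sqrt (r ^ 2 * u ^ 2 - ℓ) / r) • (EuclideanSpace.single (0 : Fin 3) (1:ℝ))
     + (Real.sqrt ℓ / r) • (EuclideanSpace.single (1 : Fin 3) (1:ℝ)))

/-- Distribution function of `f` at kinetic momentum `ℓ`. -/
def muDist (f : Phase → ℝ) (s ℓ : ℝ) : ℝ≥0∞ :=
  nuMeas ℓ {p : ℝ × ℝ | s < f (radPoint p.1 p.2 ℓ)}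

/-- `g ∈ Eq(f)` : `g` is nonnegative, spherically symmetric and equimeasurable to `f`
at (almost) every kinetic momentum `ℓ`. -/
def EqMeas (f g : Phase → ℝ) : Prop :=
  (∀ z, 0 ≤ g z) ∧ SphSym g ∧
    ∀ s : ℝ, 0 < s →
      ∀ᵐ ℓ ∂(volume.restrict (Ioi (0:ℝ))), muDist g s ℓ = muDist f s ℓ

/-- Schwarz symmetrization of `f` at fixed `ℓ`. -/
def schwarz (f : Phase → ℝ) (t ℓ : ℝ) : ℝ :=
  if ENNReal.ofReal t < muDist f 0 ℓ then
    sSup {s : ℝ | 0 ≤ s ∧ ENNReal.ofReal t < muDist f s ℓ}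
  else 0

/-- Effective potential. -/
def psiPot (φ : ℝ → ℝ) (ℓ r : ℝ) : ℝ := φ r + ℓ / (2 * r ^ 2)

def eMinPot (φ : ℝ → ℝ) (ℓ : ℝ) : ℝ := sInf (psiPot φ ℓ '' Ioi 0)

def r1Pot (φ : ℝ → ℝ) (e ℓ : ℝ) : ℝ := sInf {r : ℝ | 0 < r ∧ psiPot φ ℓ r < e}

def r2Pot (φ : ℝ → ℝ) (e ℓ : ℝ) : ℝ := sSup {r : ℝ | 0 < r ∧ psiPot φ ℓ r < e}

/-- The Jacobian `a_φ(e, ℓ)` (meaningful for `e < 0`). -/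
def aPot (φ : ℝ → ℝ) (e ℓ : ℝ) : ℝ :=
  8 * π ^ 2 * Real.sqrt 2 * ∫ r in Ioi (0:ℝ), Real.sqrt (max (e - psiPot φ ℓ r) 0)

/-- Inverse of the bijection `e ↦ a_φ(e,ℓ)` from `(e_{φ,ℓ},0)` onto `(0,∞)`. -/
def aPotInv (φ : ℝ → ℝ) (s ℓ : ℝ) : ℝ :=
  sSup {e : ℝ | eMinPot φ ℓ < e ∧ e < 0 ∧ aPot φ e ℓ < s}

/-- Microscopic energy w.r.t. the Poisson field of `g`. -/
def microE (g : Phase → ℝ) (z : Phase) : ℝ := ‖z.2‖ ^ 2 / 2 + phiF g z.1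

/-- Rearrangement of `f` with respect to the microscopic energy of the field of `g`. -/
def rearr (f g : Phase → ℝ) (z : Phase) : ℝ :=
  if microE g z < 0 then
    schwarz f (aPot (phiRad g) (microE g z) (ellOf z)) (ellOf z)
  else 0

/-- Assumption (A). -/
structure AssumptionA (Q : Phase → ℝ) (F : ℝ → ℝ → ℝ) (e₀ : ℝ) : Prop where
  contQ : Continuous Q
  nonneg : ∀ z, 0 ≤ Q z
  nonzero : Q ≠ 0
  cpt : HasCompactSupport Q
  sph : SphSym Q
  eqF : ∀ z : Phase, Q z = F (microE Q z) (ellOf z)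
  Fnonneg : ∀ e ℓ, 0 ≤ ℓ → 0 ≤ F e ℓ
  Fcont : ContinuousOn (fun p : ℝ × ℝ => F p.1 p.2) {p : ℝ × ℝ | 0 ≤ p.2}
  e₀neg : e₀ < 0
  Fsupp : ∀ e ℓ, 0 ≤ ℓ → 0 < F e ℓ → e < e₀
  FC1 : ContDiffOn ℝ 1 (fun p : ℝ × ℝ => F p.1 p.2) {p : ℝ × ℝ | 0 ≤ p.2 ∧ 0 < F p.1 p.2}
  FeNeg : ∀ e ℓ, 0 ≤ ℓ → 0 < F e ℓ → deriv (fun e' => F e' ℓ) e < 0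

/-- The reduced functional `J_{f^*}(φ_g) = H(f^{*φ_g}) + ½|∇φ_g − ∇φ_{f^{*φ_g}}|²`. -/
def Jred (f g : Phase → ℝ) : ℝ :=
  Ham (rearr f g) + (∫ x : E3, ‖gradPhi g x - gradPhi (rearr f g) x‖ ^ 2) / 2

def distL1 (f g : Phase → ℝ) : ℝ := ∫ z : Phase, |f z - g z|

def distL1v (f g : Phase → ℝ) : ℝ := ∫ z : Phase, ‖z.2‖ ^ 2 * |f z - g z|




lemma lint_rpow (a t : ℝ) (ha : a < -1) (ht : 0 < t) :
    ∫⁻ σ in Ioi t, ENNReal.ofReal (σ ^ a) = ENNReal.ofReal (-t ^ (a + 1) / (a + 1)) := by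
  rw [← integral_Ioi_rpow_of_lt ha ht, ofReal_integral_eq_lintegral_ofReal]
  · exact integrableOn_Ioi_rpow_of_lt ha ht
  · filter_upwards [self_mem_ae_restrict measurableSet_Ioi] with x hx
    exact Real.rpow_nonneg (ht.le.trans (le_of_lt hx)) _

/-- Tonelli lemma on triangles. -/
lemma tri_tonelli (w V : ℝ → ℝ) (hw : Measurable w)
    (hV : ∀ t, 0 < t → ∫⁻ σ in Ioi t, ENNReal.ofReal (w σ) = ENNReal.ofReal (V t))
    (h : ℝ → ℝ≥0∞) (hh : Measurable h) :
    ∫⁻ t in Ioi (0:ℝ), ENNReal.ofReal (V t) * h t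
      = ∫⁻ σ in Ioi (0:ℝ), ENNReal.ofReal (w σ) * ∫⁻ t in Ioc 0 σ, h t := by
  have h1 : ∀ t ∈ Ioi (0:ℝ), ENNReal.ofReal (V t) * h t
      = ∫⁻ σ in Ioi (0:ℝ), (if t ≤ σ then ENNReal.ofReal (w σ) * h t else 0) := by
    intro t ht
    rw [← hV t ht, ← lintegral_mul_const _ hw.ennreal_ofReal, ← setLIntegral_congr Ioi_ae_eq_Ici.symm,
      ← lintegral_indicator measurableSet_Ici, ← lintegral_indicator measurableSet_Ioi]
    congr 1; ext σ
    have ht' : 0 < t := ht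
    simp only [indicator, mem_Ici, mem_Ioi]
    by_cases h1 : t ≤ σ
    · simp [h1, ht'.trans_le h1]
    · simp [h1]
  have h2 : ∀ σ ∈ Ioi (0:ℝ), ENNReal.ofReal (w σ) * ∫⁻ t in Ioc 0 σ, h t
      = ∫⁻ t in Ioi (0:ℝ), (if t ≤ σ then ENNReal.ofReal (w σ) * h t else 0) := by
    intro σ hσ
    rw [← lintegral_const_mul _ hh, ← lintegral_indicator measurableSet_Ioc, ← lintegral_indicator measurableSet_Ioi]
    congr 1; ext t
    simp only [indicator, mem_Ioc, mem_Ioi]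
    by_cases h1 : t ≤ σ <;> by_cases h2 : 0 < t <;> simp [h1, h2]
  rw [setLIntegral_congr_fun measurableSet_Ioi h1, setLIntegral_congr_fun measurableSet_Ioi h2,
    lintegral_lintegral_swap]
  apply Measurable.aemeasurable
  apply Measurable.ite (measurableSet_le measurable_fst measurable_snd) _ measurable_const
  fun_prop

lemma cb_pow (y : ℝ) (hy : 0 ≤ y) : (y ^ (1/3:ℝ)) ^ 3 = y := by
  rw [← Real.rpow_natCast, ← Real.rpow_mul hy]; norm_num

lemma rpow73 (y : ℝ) (hy : 0 < y) : y ^ (-7/3:ℝ) = 1 / (y ^ 2 * y ^ (1/3:ℝ)) := by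
  rw [show (-7/3:ℝ) = -(((2:ℕ):ℝ) + 1/3) by norm_num, Real.rpow_neg hy.le, Real.rpow_add hy, Real.rpow_natCast]
  simp
lemma rpow43 (y : ℝ) (hy : 0 < y) : y ^ (-4/3:ℝ) = 1 / (y * y ^ (1/3:ℝ)) := by
  rw [show (-4/3:ℝ) = -(((1:ℕ):ℝ) + 1/3) by norm_num, Real.rpow_neg hy.le, Real.rpow_add hy, Real.rpow_natCast]
  simp

lemma V1 (t : ℝ) (ht : 0 < t) : ∫⁻ σ in Ioi t, ENNReal.ofReal (4/3 * (1/(σ^2 * σ^(1/3:ℝ)))) =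
    ENNReal.ofReal (1 / (t * t^(1/3:ℝ))) := by
  have : ∀ σ ∈ Ioi t, ENNReal.ofReal (4/3 * (1/(σ^2 * σ^(1/3:ℝ)))) = ENNReal.ofReal (4/3) * ENNReal.ofReal (σ ^ (-7/3:ℝ)) := by
    intro σ hσ
    rw [rpow73 σ (ht.trans hσ), ENNReal.ofReal_mul (by norm_num)]
  rw [setLIntegral_congr_fun measurableSet_Ioi this, lintegral_const_mul _ (by fun_prop), lint_rpow _ _ (by norm_num) ht,
    ← ENNReal.ofReal_mul (by norm_num), ← rpow43 t ht]
  congr 1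
  norm_num; ring

lemma V2 (t : ℝ) (ht : 0 < t) : ∫⁻ σ in Ioi t, ENNReal.ofReal (2 * (1/σ^3)) =
    ENNReal.ofReal (1 / t^2) := by
  have : ∀ σ ∈ Ioi t, ENNReal.ofReal (2 * (1/σ^3)) = ENNReal.ofReal 2 * ENNReal.ofReal (σ ^ (-3:ℝ)) := by
    intro σ hσ
    rw [ENNReal.ofReal_mul (by norm_num), Real.rpow_neg (ht.trans hσ).le]; norm_num
  rw [setLIntegral_congr_fun measurableSet_Ioi this, lintegral_const_mul _ (by fun_prop), lint_rpow _ _ (by norm_num) ht,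
    ← ENNReal.ofReal_mul (by norm_num), show (-3+1:ℝ) = -2 by norm_num, Real.rpow_neg ht.le]
  congr 1
  norm_num; ring

lemma V3 (t : ℝ) (ht : 0 < t) : ∫⁻ σ in Ioi t, ENNReal.ofReal (1/σ^2) =
    ENNReal.ofReal (1 / t) := by
  have : ∀ σ ∈ Ioi t, ENNReal.ofReal (1/σ^2) = ENNReal.ofReal (σ ^ (-2:ℝ)) := by
    intro σ hσ
    rw [Real.rpow_neg (ht.trans hσ).le]; norm_num
  rw [setLIntegral_congr_fun measurableSet_Ioi this, lint_rpow _ _ (by norm_num) ht,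
    show (-2+1:ℝ) = -1 by norm_num, Real.rpow_neg ht.le]
  congr 1
  norm_num



structure OM (P m : ℝ → ℝ) (l a0 b0 : ℝ) (pB kB : ℝ → ℝ≥0∞) : Prop where
  Pc : Continuous P
  P0 : ∀ r, 0 ≤ P r
  ha0 : 0 < a0
  hb0 : a0 ≤ b0
  Ps : ∀ r, r ∉ Icc a0 b0 → P r = 0
  hl : 0 < l
  mmono : Monotone m
  mc : Continuous m
  m0 : ∀ r, 0 ≤ m r
  hN : ∀ r, 0 < r → HasDerivAt (fun r => r^2 * P r^3)
    (P r * (2 * r * P r^2 - 3 * (m r / (4*π) - l / r))) r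
  pBm : Measurable pB
  hmass : ∫⁻ r in Ioi (0:ℝ), pB r = ∫⁻ r in Ioi (0:ℝ), ENNReal.ofReal (P r)
  pB2 : ∫⁻ r in Ioi (0:ℝ), ENNReal.ofReal (1/r^2) * pB r < ⊤
  hk : ∀ r, 0 < r → ∀ q : ℝ, 0 ≤ q → ENNReal.ofReal (q^2) * pB r ≤ kB r + ENNReal.ofReal (2/3 * q^3)

def AS (P : ℝ → ℝ) (x : ℝ) : ℝ := ∫ y in (0:ℝ)..x, P y
def AB (pB : ℝ → ℝ≥0∞) (r : ℝ) : ℝ := (∫⁻ t in Ioc 0 r, pB t).toReal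
def UU (P : ℝ → ℝ) (pB : ℝ → ℝ≥0∞) (t : ℝ) : ℝ := sInf {x | 0 ≤ x ∧ AB pB t ≤ AS P x}

namespace OM
variable {P m : ℝ → ℝ} {l a0 b0 : ℝ} {pB kB : ℝ → ℝ≥0∞}

lemma ii (h : OM P m l a0 b0 pB kB) (a b : ℝ) : IntervalIntegrable P volume a b :=
  h.Pc.intervalIntegrable a b

lemma AS_sub (h : OM P m l a0 b0 pB kB) (a b : ℝ) : AS P b - AS P a = ∫ y in a..b, P y :=
  intervalIntegral.integral_interval_sub_left (h.ii _ _) (h.ii _ _)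

lemma AS_mono (h : OM P m l a0 b0 pB kB) : Monotone (AS P) := by
  intro a b hab
  have := h.AS_sub a b
  have h2 : 0 ≤ ∫ y in a..b, P y := intervalIntegral.integral_nonneg hab (fun y _ => h.P0 y)
  linarith

lemma AS_cont (h : OM P m l a0 b0 pB kB) : Continuous (AS P) :=
  intervalIntegral.continuous_primitive (fun a b => h.ii a b) 0

lemma AS_zero : AS P 0 = 0 := by simp [AS]

lemma AS_eq_l (h : OM P m l a0 b0 pB kB) (x : ℝ) (hx : 0 ≤ x) :
    ENNReal.ofReal (AS P x) = ∫⁻ y in Ioc 0 x, ENNReal.ofReal (P y) := by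
  rw [AS, intervalIntegral.integral_of_le hx, ofReal_integral_eq_lintegral_ofReal]
  · exact (h.ii 0 x).1
  · exact ae_of_all _ h.P0

lemma tot (h : OM P m l a0 b0 pB kB) : ∫⁻ r in Ioi (0:ℝ), ENNReal.ofReal (P r) = ENNReal.ofReal (AS P b0) := by
  rw [h.AS_eq_l _ (h.ha0.le.trans h.hb0), ← lintegral_indicator measurableSet_Ioi, ← lintegral_indicator measurableSet_Ioc]
  congr 1; ext y
  simp only [indicator, mem_Ioi, mem_Ioc]
  by_cases h1 : 0 < y
  · by_cases h2 : y ≤ b0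
    · simp [h1, h2]
    · simp [h1, h2, h.Ps y (fun hh => h2 hh.2)]
  · simp [h1]

lemma pBfin (h : OM P m l a0 b0 pB kB) : ∫⁻ r in Ioi (0:ℝ), pB r < ⊤ := by
  rw [h.hmass, h.tot]; exact ENNReal.ofReal_lt_top

lemma pBfin' (h : OM P m l a0 b0 pB kB) (r : ℝ) : ∫⁻ t in Ioc 0 r, pB t < ⊤ :=
  (lintegral_mono_set Ioc_subset_Ioi_self).trans_lt h.pBfin

lemma AB_l (h : OM P m l a0 b0 pB kB) (r : ℝ) : ENNReal.ofReal (AB pB r) = ∫⁻ t in Ioc 0 r, pB t :=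
  ENNReal.ofReal_toReal (h.pBfin' r).ne

lemma AB_nonneg (r : ℝ) : 0 ≤ AB pB r := ENNReal.toReal_nonneg

lemma AS_nonneg (h : OM P m l a0 b0 pB kB) (x : ℝ) (hx : 0 ≤ x) : 0 ≤ AS P x := by
  have := h.AS_mono hx; rwa [AS_zero] at this

lemma AB_le (h : OM P m l a0 b0 pB kB) (r : ℝ) : AB pB r ≤ AS P b0 := by
  apply ENNReal.toReal_le_of_le_ofReal (h.AS_nonneg _ (h.ha0.le.trans h.hb0))
  rw [← h.tot, ← h.hmass]
  exact lintegral_mono_set Ioc_subset_Ioi_self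

lemma AB_mono (h : OM P m l a0 b0 pB kB) : Monotone (AB pB) := by
  intro a b hab
  apply ENNReal.toReal_mono (h.pBfin' b).ne
  exact lintegral_mono_set (Ioc_subset_Ioc_right hab)

lemma pB_ii (h : OM P m l a0 b0 pB kB) : IntegrableOn (fun t => (pB t).toReal) (Ioi 0) :=
  integrable_toReal_of_lintegral_ne_top h.pBm.aemeasurable h.pBfin.ne

lemma AB_eq (h : OM P m l a0 b0 pB kB) (r : ℝ) : AB pB r = ∫ t in Ioc 0 r, (pB t).toReal := by
  rw [integral_toReal h.pBm.aemeasurable]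
  · rfl
  · exact ae_lt_top h.pBm (h.pBfin' r).ne

lemma AB_cont (h : OM P m l a0 b0 pB kB) : ContinuousOn (AB pB) (Ici 0) := by
  have h1 : ∀ b, ContinuousOn (fun x => ∫ t in Ioc 0 x, (pB t).toReal) (Icc 0 b) := by
    intro b
    apply intervalIntegral.continuousOn_primitive
    rw [integrableOn_Icc_iff_integrableOn_Ioc]
    exact h.pB_ii.mono_set Ioc_subset_Ioi_self
  have h2 : AB pB = (fun x => ∫ t in Ioc 0 x, (pB t).toReal) := funext h.AB_eq
  rw [h2]
  intro x hx
  have := h1 (x+1) x ⟨hx, by linarith⟩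
  apply this.mono_of_mem_nhdsWithin
  have : Ici (0:ℝ) ∩ Iio (x+1) ⊆ Icc 0 (x+1) := fun y hy => ⟨hy.1, hy.2.le⟩
  exact mem_of_superset (inter_mem_nhdsWithin _ (Iio_mem_nhds (by linarith))) this

lemma U_mem (h : OM P m l a0 b0 pB kB) (t : ℝ) : 0 ≤ UU P pB t ∧ AB pB t ≤ AS P (UU P pB t) := by
  have hc : IsClosed {x | 0 ≤ x ∧ AB pB t ≤ AS P x} :=
    (isClosed_le continuous_const continuous_id).inter (isClosed_le continuous_const h.AS_cont)
  exact hc.csInf_mem ⟨b0, h.ha0.le.trans h.hb0, h.AB_le t⟩ ⟨0, fun x hx => hx.1⟩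

lemma U_le (h : OM P m l a0 b0 pB kB) (t x : ℝ) (hx : 0 ≤ x) : UU P pB t ≤ x ↔ AB pB t ≤ AS P x := by
  constructor
  · intro hh; exact (h.U_mem t).2.trans (h.AS_mono hh)
  · intro hh; exact csInf_le ⟨0, fun x hx => hx.1⟩ ⟨hx, hh⟩

lemma AS_U (h : OM P m l a0 b0 pB kB) (t : ℝ) : AS P (UU P pB t) = AB pB t := by
  apply le_antisymm _ (h.U_mem t).2
  by_contra! hlt
  have hU : 0 < UU P pB t := by
    rcases (h.U_mem t).1.lt_or_eq with h1 | h1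
    · exact h1
    · rw [← h1, AS_zero] at hlt
      exact absurd hlt (not_lt.mpr (AB_nonneg t))
  have : ∀ᶠ x in 𝓝 (UU P pB t), AB pB t < AS P x ∧ 0 < x :=
    (h.AS_cont.continuousAt.eventually (lt_mem_nhds hlt)).and (lt_mem_nhds hU)
  obtain ⟨x, hx1, hx2⟩ := ((this.filter_mono nhdsWithin_le_nhds).and (self_mem_nhdsWithin (s := Iio (UU P pB t)))).exists
  have := (h.U_le t x hx1.2.le).2 hx1.1.le
  exact absurd hx2 (not_lt.mpr this)

lemma U_mono (h : OM P m l a0 b0 pB kB) : Monotone (UU P pB) := by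
  intro a b hab
  rw [h.U_le _ _ (h.U_mem b).1, h.AS_U]
  exact h.AB_mono hab

lemma sub_meas (h : OM P m l a0 b0 pB kB) (r α : ℝ) (hr : 0 ≤ r) (hα : 0 ≤ α) :
    ∫⁻ t in {t | AB pB t ≤ α} ∩ Ioc 0 r, pB t = ENNReal.ofReal (min α (AB pB r)) := by
  rcases le_total (AB pB r) α with h1 | h1
  · have : {t | AB pB t ≤ α} ∩ Ioc 0 r = Ioc 0 r :=
      inter_eq_right.2 (fun t ht => (h.AB_mono ht.2).trans h1)
    rw [this, min_eq_right h1, h.AB_l]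
  · have h0 : AB pB 0 = 0 := by simp [AB]
    obtain ⟨τ, hτ, hτ2⟩ : α ∈ AB pB '' Icc 0 r :=
      intermediate_value_Icc hr (h.AB_cont.mono Icc_subset_Ici_self) ⟨by rw [h0]; exact hα, h1⟩
    rw [min_eq_left h1]
    have hle : Ioc 0 τ ⊆ {t | AB pB t ≤ α} ∩ Ioc 0 r :=
      fun t ht => ⟨(h.AB_mono ht.2).trans hτ2.le, ht.1, ht.2.trans hτ.2⟩
    apply le_antisymm
    · -- sup
      set S := {t | AB pB t ≤ α} ∩ Ioc 0 r
      by_cases hS : S.Nonempty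
      · have hbd : BddAbove S := ⟨r, fun t ht => ht.2.2⟩
        set ς := sSup S
        have hς0 : 0 ≤ ς := by
          obtain ⟨t, ht⟩ := hS
          exact ht.2.1.le.trans (le_csSup hbd ht)
        have hcl : ς ∈ closure S := csSup_mem_closure hS hbd
        have hςα : AB pB ς ≤ α := by
          have hcw : ContinuousWithinAt (AB pB) S ς := (h.AB_cont ς hς0).mono (fun t ht => ht.2.1.le)
          have := mem_closure_iff_nhdsWithin_neBot.1 hcl
          exact le_of_tendsto hcw (eventually_mem_nhdsWithin.mono (fun t ht => ht.1))
        calc ∫⁻ t in S, pB t ≤ ∫⁻ t in Ioc 0 ς, pB t :=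
              lintegral_mono_set (fun t ht => ⟨ht.2.1, le_csSup hbd ht⟩)
          _ = ENNReal.ofReal (AB pB ς) := (h.AB_l _).symm
          _ ≤ _ := ENNReal.ofReal_le_ofReal hςα
      · rw [not_nonempty_iff_eq_empty.1 hS]; simp
    · rw [← hτ2, h.AB_l]
      rw [hτ2]
      exact lintegral_mono_set hle

lemma push (h : OM P m l a0 b0 pB kB) (r : ℝ) (hr : 0 ≤ r) (g : ℝ → ℝ≥0∞) (hg : Measurable g) :
    ∫⁻ t in Ioc 0 r, g (UU P pB t) * pB t = ∫⁻ y in Ioc 0 (UU P pB r), g y * ENNReal.ofReal (P y) := by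
  have hUm : Measurable (UU P pB) := h.U_mono.measurable
  have hPm : Measurable (fun y => ENNReal.ofReal (P y)) := h.Pc.measurable.ennreal_ofReal
  have key : Measure.map (UU P pB) ((volume.restrict (Ioc 0 r)).withDensity pB)
      = (volume.restrict (Ioc 0 (UU P pB r))).withDensity (fun y => ENNReal.ofReal (P y)) := by
    have : IsFiniteMeasure ((volume.restrict (Ioc 0 r)).withDensity pB) :=
      isFiniteMeasure_withDensity (h.pBfin' r).ne
    apply Measure.ext_of_Iic
    intro x
    rw [Measure.map_apply hUm measurableSet_Iic, withDensity_apply _ (hUm measurableSet_Iic),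
      withDensity_apply _ measurableSet_Iic, Measure.restrict_restrict (hUm measurableSet_Iic),
      Measure.restrict_restrict measurableSet_Iic]
    rcases lt_or_ge x 0 with hx | hx
    · have e1 : UU P pB ⁻¹' Iic x ∩ Ioc 0 r = ∅ := by
        ext t; simp only [mem_inter_iff, mem_preimage, mem_Iic, mem_empty_iff_false, iff_false]
        intro hh; linarith [(h.U_mem t).1, hh.1]
      have e2 : Iic x ∩ Ioc 0 (UU P pB r) = ∅ := by
        ext t; simp only [mem_inter_iff, mem_Ioc, mem_Iic, mem_empty_iff_false, iff_false]
        intro hh; linarith [hh.2.1, hh.1]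
      rw [e1, e2]; simp
    · have e1 : UU P pB ⁻¹' Iic x = {t | AB pB t ≤ AS P x} := by
        ext t; exact h.U_le t x hx
      have e2 : Iic x ∩ Ioc 0 (UU P pB r) = Ioc 0 (min x (UU P pB r)) := by
        ext t; simp only [mem_inter_iff, mem_Ioc, mem_Iic, le_min_iff]; tauto
      rw [e1, e2, h.sub_meas _ _ hr (h.AS_nonneg x hx), ← h.AS_eq_l _ (le_min hx (h.U_mem r).1),
        h.AS_mono.map_min, h.AS_U]
  have := congrArg (fun μ => ∫⁻ y, g y ∂μ) key
  rw [lintegral_map hg hUm, lintegral_withDensity_eq_lintegral_mul _ h.pBm (g := fun a => g (UU P pB a)) (hg.comp hUm),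
    lintegral_withDensity_eq_lintegral_mul _ hPm hg] at this
  simpa [mul_comm] using this

end OM



def KK (P m : ℝ → ℝ) (l : ℝ) (y r : ℝ) : ℝ :=
  4/3 * P y^2 * y * (y^(1/3:ℝ) / r^(1/3:ℝ) - 1) + 2 * l * (1/r - 1/y) + (m y - m r) / (2*π)

def II (P : ℝ → ℝ) (pB : ℝ → ℝ≥0∞) (r : ℝ) : Set ℝ :=
  {y | 0 ≤ y ∧ ((r < y ∧ AS P y < AB pB r) ∨ (y < r ∧ AB pB r ≤ AS P y))}

def cc (P m : ℝ → ℝ) (l : ℝ) (pB : ℝ → ℝ≥0∞) (r : ℝ) : ℝ≥0∞ :=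
  ∫⁻ y in II P pB r, ENNReal.ofReal (|KK P m l y r| * P y)

lemma cb_mono {a b : ℝ} (ha : 0 ≤ a) (hab : a ≤ b) : a^(1/3:ℝ) ≤ b^(1/3:ℝ) :=
  Real.rpow_le_rpow ha hab (by norm_num)

namespace OM
variable {P m : ℝ → ℝ} {l a0 b0 : ℝ} {pB kB : ℝ → ℝ≥0∞}

lemma KK_pos (h : OM P m l a0 b0 pB kB) {y r : ℝ} (hr : 0 < r) (hy : r < y) : 0 ≤ KK P m l y r := by
  have hy0 := hr.trans hy
  have h1 : 0 < r^(1/3:ℝ) := Real.rpow_pos_of_pos hr _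
  have h2 : 1 ≤ y^(1/3:ℝ) / r^(1/3:ℝ) := by
    rw [le_div_iff₀ h1, one_mul]; exact cb_mono hr.le hy.le
  have h3 : 1/y ≤ 1/r := one_div_le_one_div_of_le hr hy.le
  have h4 := h.mmono hy.le
  have h5 : 0 ≤ 4/3 * P y^2 * y := by positivity
  have h6 := h.hl
  unfold KK
  have := mul_nonneg h5 (sub_nonneg.2 h2)
  have := mul_nonneg (mul_nonneg zero_le_two h6.le) (sub_nonneg.2 h3)
  have : 0 ≤ (m y - m r)/(2*π) := div_nonneg (sub_nonneg.2 h4) (by positivity)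
  linarith

lemma KK_neg (h : OM P m l a0 b0 pB kB) {y r : ℝ} (hy0 : 0 < y) (hy : y < r) : KK P m l y r ≤ 0 := by
  have hr := hy0.trans hy
  have h1 : 0 < r^(1/3:ℝ) := Real.rpow_pos_of_pos hr _
  have h2 : y^(1/3:ℝ) / r^(1/3:ℝ) ≤ 1 := by
    rw [div_le_iff₀ h1, one_mul]; exact cb_mono hy0.le hy.le
  have h3 : 1/r ≤ 1/y := one_div_le_one_div_of_le hy0 hy.le
  have h4 := h.mmono hy.le
  have h5 : 0 ≤ 4/3 * P y^2 * y := by positivity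
  have h6 := h.hl
  unfold KK
  have := mul_nonneg h5 (sub_nonneg.2 h2)
  have := mul_nonneg (mul_nonneg zero_le_two h6.le) (sub_nonneg.2 h3)
  have : 0 ≤ (m r - m y)/(2*π) := div_nonneg (sub_nonneg.2 h4) (by positivity)
  have e : (m y - m r)/(2*π) = - ((m r - m y)/(2*π)) := by ring
  rw [e]
  linarith

lemma Pdiv_cont (h : OM P m l a0 b0 pB kB) : Continuous (fun y => P y / y) := by
  rw [continuous_iff_continuousAt]
  intro y
  rcases eq_or_ne y 0 with rfl | hy
  · have : (fun y => P y / y) =ᶠ[𝓝 0] fun _ => 0 := by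
      filter_upwards [gt_mem_nhds h.ha0] with y hy
      rw [h.Ps y (fun hh => absurd hh.1 (not_le.2 hy)), zero_div]
    exact (continuousAt_const.congr this.symm)
  · exact h.Pc.continuousAt.div continuousAt_id hy

def dN (P m : ℝ → ℝ) (l : ℝ) (r : ℝ) : ℝ := P r * (2 * r * P r^2 - 3 * (m r / (4*π) - l / r))

lemma dN_cont (h : OM P m l a0 b0 pB kB) : Continuous (dN P m l) := by
  have : dN P m l = fun r => P r * (2 * r * P r^2 - 3 * (m r / (4*π))) + 3 * l * (P r / r) := by
    ext r; unfold dN; ring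
  rw [this]
  have h1 := h.Pdiv_cont
  have h2 := h.Pc
  have h3 := h.mc
  fun_prop

lemma N_deriv (h : OM P m l a0 b0 pB kB) (r : ℝ) : HasDerivAt (fun r => r^2 * P r^3) (dN P m l r) r := by
  rcases lt_or_ge 0 r with hr | hr
  · exact h.hN r hr
  · have hz : P r = 0 := h.Ps r (fun hh => absurd (hh.1.trans hr) (not_le.2 h.ha0))
    have : (fun y => y^2 * P y^3) =ᶠ[𝓝 r] fun _ => 0 := by
      filter_upwards [gt_mem_nhds (hr.trans_lt h.ha0)] with y hy
      rw [h.Ps y (fun hh => absurd hh.1 (not_le.2 hy))]; ring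
    rw [dN, hz, zero_mul]
    exact (hasDerivAt_const r (0:ℝ)).congr_of_eventuallyEq this

lemma N_sub (h : OM P m l a0 b0 pB kB) (a b : ℝ) : b^2 * P b^3 - a^2 * P a^3 = ∫ y in a..b, dN P m l y :=
  (intervalIntegral.integral_eq_sub_of_hasDerivAt (fun x _ => h.N_deriv x)
    (h.dN_cont.intervalIntegrable a b)).symm

lemma N_le (h : OM P m l a0 b0 pB kB) : ∃ C, 0 ≤ C ∧ ∀ x, 0 ≤ x → x^2 * P x^3 ≤ C * AS P x := by
  have hc : ContinuousOn (fun r => 2 * r * P r^2 - 3 * (m r / (4*π) - l / r)) (Icc a0 b0) := by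
    have h2 := h.Pc
    have h3 := h.mc
    have h4 : ContinuousOn (fun r : ℝ => l / r) (Icc a0 b0) :=
      continuousOn_const.div continuousOn_id (fun x hx => (h.ha0.trans_le hx.1).ne')
    apply ContinuousOn.sub (by fun_prop)
    apply ContinuousOn.mul continuousOn_const
    exact ContinuousOn.sub (by fun_prop) h4
  obtain ⟨C, hC⟩ := isCompact_Icc.exists_bound_of_continuousOn hc
  refine ⟨max C 0, le_max_right _ _, fun x hx => ?_⟩
  have h1 := h.N_sub 0 x
  have h2 : ∫ y in (0:ℝ)..x, dN P m l y ≤ ∫ y in (0:ℝ)..x, max C 0 * P y := by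
    apply intervalIntegral.integral_mono_on hx (h.dN_cont.intervalIntegrable _ _)
      ((h.ii _ _).const_mul _)
    intro y hy
    by_cases hy2 : y ∈ Icc a0 b0
    · rw [dN, mul_comm]
      apply mul_le_mul_of_nonneg_right _ (h.P0 y)
      exact (le_abs_self _).trans ((hC y hy2).trans (le_max_left _ _))
    · simp [dN, h.Ps y hy2]
  rw [intervalIntegral.integral_const_mul] at h2
  have h3 : (0:ℝ)^2 * P 0^3 = 0 := by ring
  rw [← h1, h3, sub_zero] at h2
  exact h2

def Th (P : ℝ → ℝ) (x : ℝ) : ℝ := ∫ y in (0:ℝ)..x, y * y^(1/3:ℝ) * P y^2 * P y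

lemma th_cont (h : OM P m l a0 b0 pB kB) : Continuous (fun y : ℝ => y * y^(1/3:ℝ) * P y^2 * P y) := by
  have h2 := h.Pc
  have h3 : Continuous (fun y : ℝ => y^(1/3:ℝ)) := Real.continuous_rpow_const (by norm_num)
  fun_prop

lemma th_nonneg (h : OM P m l a0 b0 pB kB) (y : ℝ) (hy : 0 ≤ y) : 0 ≤ y * y^(1/3:ℝ) * P y^2 * P y := by
  have := h.P0 y
  positivity

lemma Th_sub (h : OM P m l a0 b0 pB kB) (a b : ℝ) :
    Th P b - Th P a = ∫ y in a..b, y * y^(1/3:ℝ) * P y^2 * P y :=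
  intervalIntegral.integral_interval_sub_left (h.th_cont.intervalIntegrable _ _) (h.th_cont.intervalIntegrable _ _)

lemma Th_l (h : OM P m l a0 b0 pB kB) (x : ℝ) (hx : 0 ≤ x) :
    ENNReal.ofReal (Th P x) = ∫⁻ y in Ioc 0 x, ENNReal.ofReal (y * y^(1/3:ℝ) * P y^2) * ENNReal.ofReal (P y) := by
  rw [Th, intervalIntegral.integral_of_le hx, ofReal_integral_eq_lintegral_ofReal]
  · apply setLIntegral_congr_fun measurableSet_Ioc
    intro y hy
    have := hy.1
    exact ENNReal.ofReal_mul (by positivity)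
  · exact (h.th_cont.intervalIntegrable _ _).1
  · filter_upwards [self_mem_ae_restrict measurableSet_Ioc] with y hy
    exact h.th_nonneg y hy.1.le

lemma Th_nonneg (h : OM P m l a0 b0 pB kB) (x : ℝ) (hx : 0 ≤ x) : 0 ≤ Th P x :=
  intervalIntegral.integral_nonneg hx (fun y hy => h.th_nonneg y hy.1)

/-- the pointwise algebraic identity -/
lemma pw (h : OM P m l a0 b0 pB kB) (σ x : ℝ) (hσ : 0 < σ) (hx : 0 ≤ x) :
    4/3 * (1/(σ^2*σ^(1/3:ℝ))) * (Th P x - Th P σ) + l * (2 * (1/σ^3)) * (AS P x - AS P σ)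
      - 2/3 * (1/σ^2) * (x^2 * P x^3 - σ^2 * P σ^3) - m σ / (2*π) * (1/σ^2) * (AS P x - AS P σ)
      = 1/σ^2 * ∫ y in σ..x, KK P m l y σ * P y := by
  rw [h.Th_sub, h.AS_sub, h.N_sub]
  simp only [← intervalIntegral.integral_const_mul]
  rw [← intervalIntegral.integral_add, ← intervalIntegral.integral_sub, ← intervalIntegral.integral_sub]
  · apply intervalIntegral.integral_congr
    intro y hy
    have h1 : σ^(1/3:ℝ) ≠ 0 := (Real.rpow_pos_of_pos hσ _).ne'
    simp only [KK, dN]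
    generalize σ^(1/3:ℝ) = cσ at *
    generalize y^(1/3:ℝ) = cy at *
    have hπ := Real.pi_pos.ne'
    rcases eq_or_ne y 0 with rfl | hy0
    · have : P 0 = 0 := h.Ps 0 (fun hh => absurd hh.1 (not_le.2 h.ha0))
      simp [this]
    · field_simp
      ring
  all_goals
    have h1 := h.Pc
    have h2 := h.th_cont
    have h3 := h.dN_cont
    apply Continuous.intervalIntegrable
    fun_prop

lemma KP_cont (h : OM P m l a0 b0 pB kB) (r : ℝ) : Continuous (fun y => KK P m l y r * P y) := by
  have : (fun y => KK P m l y r * P y) = fun y => (4/3 * P y^2 * y * (y^(1/3:ℝ) / r^(1/3:ℝ) - 1) + 2*l*(1/r)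
     + (m y - m r)/(2*π)) * P y - 2 * l * (P y / y) := by
    ext y; unfold KK; ring
  rw [this]
  have h1 := h.Pc
  have h2 := h.Pdiv_cont
  have h4 := h.mc
  have h3 : Continuous (fun y : ℝ => y^(1/3:ℝ)) := Real.continuous_rpow_const (by norm_num)
  fun_prop

lemma cc_eq (h : OM P m l a0 b0 pB kB) (r : ℝ) (hr : 0 < r) :
    0 ≤ (∫ y in r..(UU P pB r), KK P m l y r * P y) ∧
    cc P m l pB r = ENNReal.ofReal (∫ y in r..(UU P pB r), KK P m l y r * P y) := by
  have hU0 := (h.U_mem r).1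
  have hkey : ∀ y, 0 ≤ y → (AB pB r ≤ AS P y ↔ UU P pB r ≤ y) := fun y hy => (h.U_le r y hy).symm
  rcases lt_or_ge r (UU P pB r) with hlt | hge
  · have e : II P pB r = Ioo r (UU P pB r) := by
      ext y
      simp only [II, mem_ofPred_eq, mem_Ioo]
      constructor
      · rintro ⟨h0, ⟨h1, h2⟩ | ⟨h1, h2⟩⟩
        · exact ⟨h1, by by_contra! h3; exact absurd ((hkey y h0).2 h3) (not_le.2 h2)⟩
        · exact absurd ((hkey y h0).1 h2) (not_le.2 (h1.trans hlt))
      · rintro ⟨h1, h2⟩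
        exact ⟨(hr.trans h1).le, Or.inl ⟨h1, by
          by_contra! h3; exact absurd ((hkey y (hr.trans h1).le).1 h3) (not_le.2 h2)⟩⟩
    have hnn : ∀ y ∈ Ioc r (UU P pB r), 0 ≤ KK P m l y r * P y :=
      fun y hy => mul_nonneg (h.KK_pos hr hy.1) (h.P0 y)
    rw [intervalIntegral.integral_of_le hlt.le]
    refine ⟨setIntegral_nonneg measurableSet_Ioc hnn, ?_⟩
    rw [cc, e, ofReal_integral_eq_lintegral_ofReal ((h.KP_cont r).integrableOn_Ioc)
      (by filter_upwards [self_mem_ae_restrict measurableSet_Ioc] with y hy using hnn y hy), 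
      setLIntegral_congr Ioo_ae_eq_Ioc]
    apply setLIntegral_congr_fun measurableSet_Ioc
    intro y hy
    simp only [abs_of_nonneg (h.KK_pos hr hy.1)]
  · have e : II P pB r = Ico (UU P pB r) r := by
      ext y
      simp only [II, mem_ofPred_eq, mem_Ico]
      constructor
      · rintro ⟨h0, ⟨h1, h2⟩ | ⟨h1, h2⟩⟩
        · exact absurd ((hkey y h0).2 (hge.trans h1.le)) (not_le.2 h2)
        · exact ⟨(hkey y h0).1 h2, h1⟩
      · rintro ⟨h1, h2⟩
        exact ⟨hU0.trans h1, Or.inr ⟨h2, (hkey y (hU0.trans h1)).2 h1⟩⟩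
    have hnn : ∀ y ∈ Ioo (UU P pB r) r, 0 ≤ -(KK P m l y r * P y) := by
      intro y hy
      rw [← neg_mul]
      exact mul_nonneg (neg_nonneg.2 (h.KK_neg (hU0.trans_lt hy.1) hy.2)) (h.P0 y)
    rw [intervalIntegral.integral_of_ge hge, ← integral_neg, integral_Ioc_eq_integral_Ioo]
    refine ⟨setIntegral_nonneg measurableSet_Ioo hnn, ?_⟩
    rw [cc, e, ofReal_integral_eq_lintegral_ofReal (f := fun y => -(KK P m l y r * P y)) (((h.KP_cont r).integrableOn_Ioc.mono_set Ioo_subset_Ioc_self).neg)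
      (by filter_upwards [self_mem_ae_restrict measurableSet_Ioo] with y hy using hnn y hy), 
      ← setLIntegral_congr Ioo_ae_eq_Ico]
    apply setLIntegral_congr_fun measurableSet_Ioo
    intro y hy
    simp only [abs_of_nonpos (h.KK_neg (hU0.trans_lt hy.1) hy.2), neg_mul]

end OM



lemma enn_cancel {x a p s q b n t c k : ℝ≥0∞} (h : x + a + p + s = (q + p) + b + n + t + c)
    (hx : x ≤ k + n) (hn : n ≠ ⊤) (hp : p ≠ ⊤) : q + b + t + c ≤ k + a + s := by
  apply (ENNReal.add_le_add_iff_left (a := n + p) (ENNReal.add_ne_top.2 ⟨hn, hp⟩)).1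
  calc n + p + (q + b + t + c) = (q + p) + b + n + t + c := by ring
    _ = x + a + p + s := h.symm
    _ ≤ (k + n) + a + p + s := by gcongr
    _ = n + p + (k + a + s) := by ring

namespace OM
variable {P m : ℝ → ℝ} {l a0 b0 : ℝ} {pB kB : ℝ → ℝ≥0∞}

lemma pwE (h : OM P m l a0 b0 pB kB) (σ : ℝ) (hσ : 0 < σ) :
    ENNReal.ofReal (4/3 * (1/(σ^2*σ^(1/3:ℝ)))) * ENNReal.ofReal (Th P (UU P pB σ))
     + ENNReal.ofReal l * (ENNReal.ofReal (2 * (1/σ^3)) * ENNReal.ofReal (AB pB σ))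
     + ENNReal.ofReal (2/3 * P σ^3) + ENNReal.ofReal (m σ/(2*π) * (1/σ^2)) * ENNReal.ofReal (AS P σ)
    = ENNReal.ofReal (4/3 * (1/(σ^2*σ^(1/3:ℝ)))) * ENNReal.ofReal (Th P σ)
     + ENNReal.ofReal l * (ENNReal.ofReal (2 * (1/σ^3)) * ENNReal.ofReal (AS P σ))
     + ENNReal.ofReal (2/3 * (1/σ^2 * ((UU P pB σ)^2 * P (UU P pB σ)^3)))
     + ENNReal.ofReal (m σ/(2*π) * (1/σ^2)) * ENNReal.ofReal (AB pB σ)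
     + ENNReal.ofReal (1/σ^2) * cc P m l pB σ := by
  have hU := (h.U_mem σ).1
  obtain ⟨h1, h2⟩ := h.cc_eq σ hσ
  have e := h.pw σ _ hσ hU
  rw [h.AS_U] at e
  rw [h2]
  have a1 : 0 ≤ 4/3 * (1/(σ^2*σ^(1/3:ℝ))) := by positivity
  have a2 : 0 ≤ 2 * (1/σ^3) := by positivity
  have a3 : 0 ≤ m σ/(2*π) * (1/σ^2) := by have := h.m0 σ; positivity
  have a4 : 0 ≤ 1/σ^2 := by positivity
  have a5 := h.P0 σ
  have a6 := h.P0 (UU P pB σ)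
  have a7 := h.hl
  have b1 := h.Th_nonneg _ hσ.le
  have b2 := h.Th_nonneg _ hU
  have b3 := h.AS_nonneg _ hσ.le
  have b4 := AB_nonneg (pB := pB) σ
  have c1 := mul_nonneg a1 b1
  have c2 := mul_nonneg a1 b2
  have c3 := mul_nonneg a7.le (mul_nonneg a2 b3)
  have c4 := mul_nonneg a7.le (mul_nonneg a2 b4)
  have c5 := mul_nonneg a3 b3
  have c6 := mul_nonneg a3 b4
  have c7 := mul_nonneg a4 h1
  have c8 : 0 ≤ 2/3 * P σ^3 := by positivity
  have c9 : 0 ≤ 2/3 * (1/σ^2 * ((UU P pB σ)^2 * P (UU P pB σ)^3)) := by positivity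
  rw [← ENNReal.ofReal_mul a1, ← ENNReal.ofReal_mul a1, ← ENNReal.ofReal_mul a2, ← ENNReal.ofReal_mul a2,
    ← ENNReal.ofReal_mul a7.le, ← ENNReal.ofReal_mul a7.le, ← ENNReal.ofReal_mul a3,← ENNReal.ofReal_mul a3,
    ← ENNReal.ofReal_mul a4, ← ENNReal.ofReal_add c2 c4, ← ENNReal.ofReal_add (by linarith) c8,
    ← ENNReal.ofReal_add (by linarith) c5, ← ENNReal.ofReal_add c1 c3, ← ENNReal.ofReal_add (by linarith) c9,
    ← ENNReal.ofReal_add (by linarith) c6, ← ENNReal.ofReal_add (by linarith) c7]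
  congr 1
  have e2 : 2/3 * (1/σ^2) * (σ^2 * P σ^3) = 2/3 * P σ^3 := by field_simp
  linear_combination e - e2

lemma kB_ge (h : OM P m l a0 b0 pB kB) (r : ℝ) (hr : 0 < r) :
    ENNReal.ofReal (1/(r * r^(1/3:ℝ))) *
      (ENNReal.ofReal ((UU P pB r) * (UU P pB r)^(1/3:ℝ) * P (UU P pB r)^2) * pB r)
    ≤ kB r + ENNReal.ofReal (2/3 * (1/r^2 * ((UU P pB r)^2 * P (UU P pB r)^3))) := by
  have hU := (h.U_mem r).1
  have hP := h.P0 (UU P pB r)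
  have := h.hk r hr (((UU P pB r)^(1/3:ℝ) / r^(1/3:ℝ))^2 * P (UU P pB r)) (by positivity)
  have e1 := cb_pow _ hU
  have e2 := cb_pow _ hr.le
  have p1 : 0 < r^(1/3:ℝ) := Real.rpow_pos_of_pos hr _
  rw [← mul_assoc, ← ENNReal.ofReal_mul (by positivity)]
  generalize (UU P pB r) = U at *
  generalize hc : r^(1/3:ℝ) = c at *
  generalize hd : U^(1/3:ℝ) = d at *
  have f1 : 1 / (r * c) * (U * d * P U^2) = ((d/c)^2 * P U)^2 := by
    rw [← e2, ← e1]; field_simp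
  have f2 : 1/r^2 * (U^2 * P U^3) = ((d/c)^2 * P U)^3 := by
    rw [← e2, ← e1]; field_simp
  rw [f1, f2]
  exact this

theorem T1 (h : OM P m l a0 b0 pB kB) :
    (∫⁻ r in Ioi (0:ℝ), ENNReal.ofReal (P r^3/3)) +
    ENNReal.ofReal l * (∫⁻ r in Ioi (0:ℝ), ENNReal.ofReal (1/r^2) * ENNReal.ofReal (P r)) +
    (∫⁻ r in Ioi (0:ℝ), ENNReal.ofReal (m r/(2*π) * (1/r^2)) * ENNReal.ofReal (AB pB r)) +
    (∫⁻ r in Ioi (0:ℝ), ENNReal.ofReal (1/r^2) * cc P m l pB r) ≤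
    (∫⁻ r in Ioi (0:ℝ), kB r) +
    ENNReal.ofReal l * (∫⁻ r in Ioi (0:ℝ), ENNReal.ofReal (1/r^2) * pB r) +
    (∫⁻ r in Ioi (0:ℝ), ENNReal.ofReal (m r/(2*π) * (1/r^2)) * ENNReal.ofReal (AS P r)) := by
  have hUm : Measurable (UU P pB) := h.U_mono.measurable
  have hPm := h.Pc.measurable
  have hmm := h.mc.measurable
  have hABm : Measurable (AB pB) := h.AB_mono.measurable
  have hASm : Measurable (AS P) := h.AS_mono.measurable
  have hThm : ∀ (a b : ℝ), IntervalIntegrable (fun y : ℝ => y * y^(1/3:ℝ) * P y^2 * P y) volume a b :=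
    fun a b => h.th_cont.intervalIntegrable a b
  have hThm2 : Measurable (Th P) := (intervalIntegral.continuous_primitive hThm 0).measurable
  -- Tonelli identities
  have t1 := tri_tonelli (fun σ => 4/3 * (1/(σ^2*σ^(1/3:ℝ)))) (fun t => 1/(t * t^(1/3:ℝ))) (by fun_prop) V1
    (fun t => ENNReal.ofReal ((UU P pB t) * (UU P pB t)^(1/3:ℝ) * P (UU P pB t)^2) * pB t)
    (by have := h.pBm; fun_prop)
  have t1S := tri_tonelli (fun σ => 4/3 * (1/(σ^2*σ^(1/3:ℝ)))) (fun t => 1/(t * t^(1/3:ℝ))) (by fun_prop) V1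
    (fun t => ENNReal.ofReal (t * t^(1/3:ℝ) * P t^2) * ENNReal.ofReal (P t)) (by fun_prop)
  have t2 := tri_tonelli (fun σ => 2 * (1/σ^3)) (fun t => 1/t^2) (by fun_prop) V2 pB h.pBm
  have t2S := tri_tonelli (fun σ => 2 * (1/σ^3)) (fun t => 1/t^2) (by fun_prop) V2
    (fun t => ENNReal.ofReal (P t)) (by fun_prop)
  have t3 := tri_tonelli (fun σ => 1/σ^2) (fun t => 1/t) (by fun_prop) V3 pB h.pBm
  replace t1 := t1.trans (setLIntegral_congr_fun (g := fun σ => ENNReal.ofReal (4/3 * (1/(σ^2*σ^(1/3:ℝ)))) * ENNReal.ofReal (Th P (UU P pB σ)))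
    measurableSet_Ioi (fun σ hσ => by
      have hσ' : (0:ℝ) < σ := hσ
      simp only
      rw [h.push σ hσ'.le (fun y => ENNReal.ofReal (y * y^(1/3:ℝ) * P y^2)) (by fun_prop), ← h.Th_l _ (h.U_mem σ).1]))
  replace t1S := t1S.trans (setLIntegral_congr_fun (g := fun σ => ENNReal.ofReal (4/3 * (1/(σ^2*σ^(1/3:ℝ)))) * ENNReal.ofReal (Th P σ))
    measurableSet_Ioi (fun σ hσ => by simp only; rw [← h.Th_l _ (le_of_lt hσ)]))
  rw [setLIntegral_congr_fun (g := fun σ => ENNReal.ofReal (P σ^3)) measurableSet_Ioi (fun σ hσ => by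
      have hσ' : (0:ℝ) < σ := hσ
      have := Real.rpow_pos_of_pos hσ' (1/3:ℝ)
      have := h.P0 σ
      simp only
      rw [← ENNReal.ofReal_mul (by positivity), ← ENNReal.ofReal_mul (by positivity)]
      congr 1; field_simp)] at t1S
  simp only [← h.AB_l] at t2 t3
  replace t2S := t2S.trans (setLIntegral_congr_fun (g := fun σ => ENNReal.ofReal (2 * (1/σ^3)) * ENNReal.ofReal (AS P σ))
    measurableSet_Ioi (fun σ hσ => by simp only; rw [← h.AS_eq_l _ (le_of_lt hσ)]))
  -- finiteness of the N-term
  set NU := ∫⁻ σ in Ioi (0:ℝ), ENNReal.ofReal (2/3 * (1/σ^2 * ((UU P pB σ)^2 * P (UU P pB σ)^3))) with hNU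
  have hNUfin : NU ≠ ⊤ := by
    obtain ⟨C, hC0, hC⟩ := h.N_le
    have b1 : NU ≤ ∫⁻ σ in Ioi (0:ℝ), ENNReal.ofReal C * (ENNReal.ofReal (1/σ^2) * ENNReal.ofReal (AB pB σ)) := by
      apply setLIntegral_mono' measurableSet_Ioi
      intro σ hσ
      rw [← ENNReal.ofReal_mul (by positivity), ← ENNReal.ofReal_mul hC0]
      apply ENNReal.ofReal_le_ofReal
      have := hC _ (h.U_mem σ).1
      rw [h.AS_U] at this
      have h0 : 0 ≤ (UU P pB σ)^2 * P (UU P pB σ)^3 := by have := h.P0 (UU P pB σ); positivity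
      have h3 : (0:ℝ) ≤ 1/σ^2 := by positivity
      have := mul_le_mul_of_nonneg_left this h3
      have := mul_nonneg h3 h0
      nlinarith
    rw [lintegral_const_mul _ (by fun_prop), ← t3] at b1
    have b2 : ∫⁻ t in Ioi (0:ℝ), ENNReal.ofReal (1/t) * pB t ≤
        ∫⁻ t in Ioi (0:ℝ), (pB t + ENNReal.ofReal (1/t^2) * pB t) := by
      apply setLIntegral_mono' measurableSet_Ioi
      intro t ht
      have ht' : (0:ℝ) < t := ht
      have : ENNReal.ofReal (1/t) ≤ 1 + ENNReal.ofReal (1/t^2) := by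
        rw [← ENNReal.ofReal_one, ← ENNReal.ofReal_add zero_le_one (by positivity)]
        apply ENNReal.ofReal_le_ofReal
        have : (1/t)^2 = 1/t^2 := by field_simp
        nlinarith [sq_nonneg (1/t - 1/2)]
      calc _ ≤ (1 + ENNReal.ofReal (1/t^2)) * pB t := by gcongr
        _ = _ := by rw [add_mul, one_mul]
    rw [lintegral_add_left h.pBm] at b2
    have b3 : ∫⁻ t in Ioi (0:ℝ), ENNReal.ofReal (1/t) * pB t < ⊤ :=
      b2.trans_lt (ENNReal.add_lt_top.2 ⟨h.pBfin, h.pB2⟩)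
    exact (b1.trans_lt (ENNReal.mul_lt_top ENNReal.ofReal_lt_top b3)).ne
  have hP3 : ∫⁻ r in Ioi (0:ℝ), ENNReal.ofReal (2/3 * P r^3) ≠ ⊤ := by
    have hcs : HasCompactSupport (fun r => 2/3 * P r^3) := by
      apply HasCompactSupport.intro (isCompact_Icc (a := a0) (b := b0))
      intro x hx; rw [h.Ps x hx]; ring
    have hi : Integrable (fun r => 2/3 * P r^3) :=
      Continuous.integrable_of_hasCompactSupport (by have := h.Pc; fun_prop) hcs
    exact ((hi.integrableOn (s := Ioi 0)).lintegral_lt_top).ne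
  -- integrate pwE
  have hmain := setLIntegral_congr_fun (μ := volume) measurableSet_Ioi (fun σ hσ => h.pwE σ hσ)
  rw [lintegral_add_left (by fun_prop), lintegral_add_left (by fun_prop), lintegral_add_left (by fun_prop),
    lintegral_add_left (by fun_prop), lintegral_add_left (by fun_prop), lintegral_add_left (by fun_prop),
    lintegral_add_left (by fun_prop), lintegral_const_mul _ (by fun_prop), lintegral_const_mul _ (by fun_prop),
    ← t1, ← t1S, ← t2, ← t2S, ← hNU] at hmain
  have hkk : ∫⁻ t in Ioi (0:ℝ), ENNReal.ofReal (1/(t * t^(1/3:ℝ))) *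
      (ENNReal.ofReal ((UU P pB t) * (UU P pB t)^(1/3:ℝ) * P (UU P pB t)^2) * pB t) ≤
      (∫⁻ r in Ioi (0:ℝ), kB r) + NU := by
    rw [hNU, ← lintegral_add_right _ (by fun_prop)]
    exact setLIntegral_mono' measurableSet_Ioi (fun r hr => h.kB_ge r hr)
  have hsplit : ∫⁻ r in Ioi (0:ℝ), ENNReal.ofReal (P r^3) =
     (∫⁻ r in Ioi (0:ℝ), ENNReal.ofReal (P r^3/3)) + ∫⁻ r in Ioi (0:ℝ), ENNReal.ofReal (2/3 * P r^3) := by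
    rw [← lintegral_add_left (by fun_prop)]
    apply lintegral_congr
    intro r
    have := h.P0 r
    rw [← ENNReal.ofReal_add (by positivity) (by positivity)]
    congr 1; ring
  rw [hsplit] at hmain
  exact enn_cancel hmain hkk hNUfin hP3

/-- comparison at a fixed radius, outward -/
lemma cmp_out (h : OM P m l a0 b0 pB kB) (r : ℝ) (hr : 0 < r) (κ : ℝ → ℝ) (hκ : Measurable κ) (k : ℝ) :
    ENNReal.ofReal k * ENNReal.ofReal (AB pB r) ≤ ENNReal.ofReal k * ENNReal.ofReal (AS P r)
     + ((∫⁻ y in II P pB r ∩ Ioi r, ENNReal.ofReal (κ y) * ENNReal.ofReal (P y))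
     + ∫⁻ y in Ioi r, ENNReal.ofReal (k - κ y) * ENNReal.ofReal (P y)) := by
  have hPm := h.Pc.measurable
  rcases le_or_gt (AB pB r) (AS P r) with h1 | h1
  · exact (mul_le_mul_right (ENNReal.ofReal_le_ofReal h1) _).trans le_self_add
  have hU : r < UU P pB r := by
    by_contra! h3
    exact absurd ((h.U_le r r hr.le).1 h3) (not_le.2 h1)
  have e : Ioo r (UU P pB r) ⊆ II P pB r ∩ Ioi r := by
    intro y hy
    refine ⟨⟨(hr.trans hy.1).le, Or.inl ⟨hy.1, ?_⟩⟩, hy.1⟩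
    by_contra! h3
    exact absurd ((h.U_le r y (hr.trans hy.1).le).2 h3) (not_le.2 hy.2)
  have hb : ENNReal.ofReal (AB pB r) = ENNReal.ofReal (AS P r) + ∫⁻ y in Ioo r (UU P pB r), ENNReal.ofReal (P y) := by
    have := h.AS_sub r (UU P pB r)
    rw [h.AS_U, intervalIntegral.integral_of_le hU.le] at this
    rw [setLIntegral_congr Ioo_ae_eq_Ioc, ← ofReal_integral_eq_lintegral_ofReal h.Pc.integrableOn_Ioc (ae_of_all _ h.P0), ← this,
      ← ENNReal.ofReal_add (h.AS_nonneg r hr.le) (by linarith)]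
    congr 1; ring
  rw [hb, mul_add]
  gcongr
  calc ENNReal.ofReal k * ∫⁻ y in Ioo r (UU P pB r), ENNReal.ofReal (P y)
      = ∫⁻ y in Ioo r (UU P pB r), ENNReal.ofReal k * ENNReal.ofReal (P y) := (lintegral_const_mul _ (by fun_prop)).symm
    _ ≤ ∫⁻ y in Ioo r (UU P pB r), (ENNReal.ofReal (κ y) * ENNReal.ofReal (P y) + ENNReal.ofReal (k - κ y) * ENNReal.ofReal (P y)) := by
        apply lintegral_mono
        intro y
        simp only
        rw [← add_mul]
        gcongr
        calc ENNReal.ofReal k = ENNReal.ofReal (κ y + (k - κ y)) := by congr 1; ring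
          _ ≤ _ := ENNReal.ofReal_add_le
    _ = _ := lintegral_add_left (by fun_prop) _
    _ ≤ _ := add_le_add (lintegral_mono_set e) (lintegral_mono_set Ioo_subset_Ioi_self)

/-- comparison at a fixed radius, inward -/
lemma cmp_in (h : OM P m l a0 b0 pB kB) (r : ℝ) (hr : 0 < r) (κ : ℝ → ℝ) (hκ : Measurable κ) (k : ℝ) :
    ENNReal.ofReal k * ENNReal.ofReal (AS P r) ≤ ENNReal.ofReal k * ENNReal.ofReal (AB pB r)
     + ((∫⁻ y in II P pB r ∩ Ioo 0 r, ENNReal.ofReal (κ y) * ENNReal.ofReal (P y))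
     + ∫⁻ y in Ioo 0 r, ENNReal.ofReal (k - κ y) * ENNReal.ofReal (P y)) := by
  have hPm := h.Pc.measurable
  rcases le_or_gt (AS P r) (AB pB r) with h1 | h1
  · exact (mul_le_mul_right (ENNReal.ofReal_le_ofReal h1) _).trans le_self_add
  have hU0 := (h.U_mem r).1
  have hU : UU P pB r ≤ r := (h.U_le r r hr.le).2 h1.le
  have e : Ioo (UU P pB r) r ⊆ II P pB r ∩ Ioo 0 r := by
    intro y hy
    refine ⟨⟨hU0.trans hy.1.le, Or.inr ⟨hy.2, ?_⟩⟩, hU0.trans_lt hy.1, hy.2⟩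
    exact (h.U_le r y (hU0.trans hy.1.le)).1 hy.1.le
  have hb : ENNReal.ofReal (AS P r) = ENNReal.ofReal (AB pB r) + ∫⁻ y in Ioo (UU P pB r) r, ENNReal.ofReal (P y) := by
    have := h.AS_sub (UU P pB r) r
    rw [h.AS_U, intervalIntegral.integral_of_le hU] at this
    rw [setLIntegral_congr Ioo_ae_eq_Ioc, ← ofReal_integral_eq_lintegral_ofReal h.Pc.integrableOn_Ioc (ae_of_all _ h.P0), ← this,
      ← ENNReal.ofReal_add (AB_nonneg r) (by linarith)]
    congr 1; ring
  rw [hb, mul_add]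
  gcongr
  calc ENNReal.ofReal k * ∫⁻ y in Ioo (UU P pB r) r, ENNReal.ofReal (P y)
      = ∫⁻ y in Ioo (UU P pB r) r, ENNReal.ofReal k * ENNReal.ofReal (P y) := (lintegral_const_mul _ (by fun_prop)).symm
    _ ≤ ∫⁻ y in Ioo (UU P pB r) r, (ENNReal.ofReal (κ y) * ENNReal.ofReal (P y) + ENNReal.ofReal (k - κ y) * ENNReal.ofReal (P y)) := by
        apply lintegral_mono
        intro y
        simp only
        rw [← add_mul]
        gcongr
        calc ENNReal.ofReal k = ENNReal.ofReal (κ y + (k - κ y)) := by congr 1; ring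
          _ ≤ _ := ENNReal.ofReal_add_le
    _ = _ := lintegral_add_left (by fun_prop) _
    _ ≤ _ := add_le_add (lintegral_mono_set e) (lintegral_mono_set (Ioo_subset_Ioo_left hU0))

end OM



def ez : E3 := EuclideanSpace.single (0 : Fin 3) (1:ℝ)
def eo : E3 := EuclideanSpace.single (1 : Fin 3) (1:ℝ)
def pt (r p l : ℝ) : Phase := (r • ez, p • ez + (Real.sqrt l / r) • eo)

abbrev SS (n : E3) : E3 ≃ₗᵢ[ℝ] E3 := (Submodule.span ℝ {n})ᗮ.reflection

lemma SS_fix (n x : E3) (h : inner ℝ n x = 0) : SS n x = x := by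
  rw [Submodule.reflection_eq_self_iff]
  rwa [Submodule.mem_orthogonal_singleton_iff_inner_right]

lemma SS_det (n : E3) (hn : n ≠ 0) : LinearMap.det ((SS n).toLinearEquiv : E3 →ₗ[ℝ] E3) = -1 := by
  have := Submodule.det_reflection ((Submodule.span ℝ {n})ᗮ)
  rw [Submodule.orthogonal_orthogonal, finrank_span_singleton hn] at this
  simpa using this

lemma exists_perp (x v : E3) : ∃ m : E3, m ≠ 0 ∧ inner ℝ m x = 0 ∧ inner ℝ m v = 0 := by
  have h1 : (Submodule.span ℝ {x, v})ᗮ ≠ ⊥ := by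
    intro h
    have h2 := Submodule.finrank_add_finrank_orthogonal (Submodule.span ℝ {x, v})
    rw [h] at h2
    have h3 : Module.finrank ℝ (Submodule.span ℝ (({x, v} : Finset E3) : Set E3)) ≤ 2 :=
      (finrank_span_finset_le_card _).trans (Finset.card_le_two)
    rw [Finset.coe_pair] at h3
    rw [finrank_bot, finrank_euclideanSpace] at h2
    rw [Fintype.card_fin] at h2
    omega
  obtain ⟨m, hm, hm0⟩ := (Submodule.ne_bot_iff _).1 h1
  refine ⟨m, hm0, ?_, ?_⟩
  · exact Submodule.inner_left_of_mem_orthogonal (Submodule.subset_span (by simp)) hm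
  · exact Submodule.inner_left_of_mem_orthogonal (Submodule.subset_span (by simp)) hm

lemma sph_refl {f : Phase → ℝ} (hf : SphSym f) (n : E3) (x v : E3) : f (SS n x, SS n v) = f (x, v) := by
  by_cases hn : n = 0
  · subst hn
    rw [SS_fix _ _ (by simp), SS_fix _ _ (by simp)]
  obtain ⟨m, hm, h1, h2⟩ := exists_perp (SS n x) (SS n v)
  have := hf ((SS n).trans (SS m)) (by
    have e : (((SS n).trans (SS m)).toLinearEquiv : E3 →ₗ[ℝ] E3) =
      ((SS m).toLinearEquiv : E3 →ₗ[ℝ] E3) ∘ₗ ((SS n).toLinearEquiv : E3 →ₗ[ℝ] E3) := rfl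
    rw [e, LinearMap.det_comp, SS_det _ hm, SS_det _ hn]; norm_num) (x, v)
  simp only [LinearIsometryEquiv.trans_apply] at this
  rwa [SS_fix _ _ h1, SS_fix _ _ h2] at this

lemma sph_inv {f : Phase → ℝ} (hf : SphSym f) {x v x' v' : E3} (h1 : ‖x‖ = ‖x'‖) (h2 : ‖v‖ = ‖v'‖)
    (h3 : inner ℝ x v = inner ℝ x' v') : f (x, v) = f (x', v') := by
  rw [← sph_refl hf (x - x') x v]
  have e1 : SS (x - x') x = x' := Submodule.reflection_sub h1
  set w := SS (x - x') v with hw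
  have e2 : ‖w‖ = ‖v'‖ := by rw [hw, LinearIsometryEquiv.norm_map, h2]
  have e3 : inner ℝ x' w = inner ℝ x' v' := by
    rw [← h3, hw]; nth_rw 1 [← e1]; exact LinearIsometryEquiv.inner_map_map _ _ _
  rw [e1, ← sph_refl hf (w - v') x' w, SS_fix _ x', Submodule.reflection_sub e2]
  rw [real_inner_comm, inner_sub_right, e3, sub_self]

lemma ez_norm : ‖ez‖ = 1 := by simp [ez]
lemma eo_norm : ‖eo‖ = 1 := by simp [eo]
lemma ez_eo : inner ℝ ez eo = 0 := by simp [ez, eo, EuclideanSpace.inner_single_left]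
lemma inner_ez_ez : inner ℝ ez ez = 1 := by rw [real_inner_self_eq_norm_sq, ez_norm]; norm_num
lemma norm_comb (a b : ℝ) : ‖a • ez + b • eo‖^2 = a^2 + b^2 := by
  rw [norm_add_sq_real, norm_smul, norm_smul, ez_norm, eo_norm, inner_smul_left, inner_smul_right, ez_eo]
  simp

lemma ellOf_nonneg (z : Phase) : 0 ≤ ellOf z := by
  have := abs_real_inner_le_norm z.1 z.2
  have h2 := sq_le_sq' (by linarith [neg_abs_le (inner ℝ z.1 z.2)]) ((le_abs_self _).trans this)
  unfold ellOf; nlinarith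

lemma sph_pt {f : Phase → ℝ} (hf : SphSym f) (x v : E3) (hx : x ≠ 0) :
    f (x, v) = f (pt ‖x‖ (inner ℝ x v / ‖x‖) (ellOf (x, v))) := by
  have hx' : ‖x‖ ≠ 0 := norm_ne_zero_iff.2 hx
  refine sph_inv hf ?_ ?_ ?_
  · simp [norm_smul, ez_norm]
  · have h := norm_comb (inner ℝ x v / ‖x‖) (Real.sqrt (ellOf (x, v)) / ‖x‖)
    rw [div_pow, div_pow, Real.sq_sqrt (ellOf_nonneg _), ← add_div] at h
    have e : (inner ℝ x v ^ 2 + ellOf (x, v)) / ‖x‖^2 = ‖v‖^2 := by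
      simp only [ellOf]; field_simp; ring
    rw [e] at h
    exact ((pow_left_inj₀ (norm_nonneg _) (norm_nonneg _) two_ne_zero).1 h).symm
  · simp only [inner_add_right, inner_smul_left, inner_smul_right, ez_eo, inner_ez_ez]
    simp; field_simp



lemma subs_sq (a : ℝ) (ha : 0 ≤ a) (h : ℝ → ℝ≥0∞) :
    ∫⁻ w in Ioi (0:ℝ), h w = ∫⁻ t in Ioi a, ENNReal.ofReal (2*t) * h (t^2 - a^2) := by
  have := lintegral_image_eq_lintegral_abs_deriv_mul (s := Ioi a) (f := fun t => t^2 - a^2) (f' := fun t => 2*t)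
    measurableSet_Ioi (fun x _ => by
      have := ((hasDerivAt_pow 2 x).sub_const (a^2)).hasDerivWithinAt (s := Ioi a)
      simpa using this) (by
      intro x hx y hy hxy
      simp only [mem_Ioi] at hx hy
      have : x^2 = y^2 := by simpa using hxy
      exact (pow_left_inj₀ (by linarith) (by linarith) two_ne_zero).1 this) h
  have e : (fun t => t^2 - a^2) '' Ioi a = Ioi 0 := by
    ext w; simp only [mem_image, mem_Ioi]; constructor
    · rintro ⟨t, ht, rfl⟩; nlinarith
    · intro hw
      refine ⟨√(w + a^2), ?_, ?_⟩
      · exact Real.lt_sqrt_of_sq_lt (by linarith)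
      · rw [Real.sq_sqrt (by positivity)]; ring
  rw [e] at this
  rw [this]
  refine setLIntegral_congr_fun measurableSet_Ioi ?_
  intro t ht
  simp only [mem_Ioi] at ht
  simp only [abs_of_pos (by linarith : 0 < 2*t)]

lemma plane_int (h : ℝ → ℝ≥0∞) (hh : Measurable h) :
    ∫⁻ q : ℝ × ℝ, h (q.1^2 + q.2^2) = ENNReal.ofReal π * ∫⁻ w in Ioi (0:ℝ), h w := by
  rw [← lintegral_comp_polarCoord_symm, polarCoord_target]
  simp only [polarCoord_symm_apply]
  have e : ∀ p : ℝ × ℝ, (p.1 * cos p.2)^2 + (p.1 * sin p.2)^2 = p.1^2 := by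
    intro p; have := Real.cos_sq_add_sin_sq p.2; linear_combination p.1^2 * this
  simp only [e, smul_eq_mul]
  rw [Measure.volume_eq_prod, ← Measure.prod_restrict, lintegral_prod _ (by fun_prop)]
  simp only [lintegral_const, Measure.restrict_apply_univ, Real.volume_Ioo]
  rw [lintegral_mul_const _ (by fun_prop), subs_sq 0 le_rfl h, mul_comm]
  have : ∀ t ∈ Ioi (0:ℝ), ENNReal.ofReal (2*t) * h (t^2 - 0^2) = 2 * (ENNReal.ofReal t * h (t^2)) := by
    intro t ht
    rw [ENNReal.ofReal_mul (by norm_num)]; simp [mul_assoc]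
  rw [setLIntegral_congr_fun measurableSet_Ioi this, lintegral_const_mul _ (by fun_prop), ← mul_assoc]
  congr 1
  rw [show (2:ℝ≥0∞) = ENNReal.ofReal 2 by simp, ← ENNReal.ofReal_mul Real.pi_pos.le]
  congr 1; ring

lemma axial (H : ℝ → ℝ → ℝ≥0∞) (hH : Measurable (Function.uncurry H)) :
    ∫⁻ v : E3, H (v 0) ((v 1)^2 + (v 2)^2) = ENNReal.ofReal π * ∫⁻ p : ℝ, ∫⁻ w in Ioi (0:ℝ), H p w := by
  have h1 := (PiLp.volume_preserving_ofLp (Fin 3)).lintegral_comp (f := fun g : Fin 3 → ℝ => H (g 0) ((g 1)^2 + (g 2)^2))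
    (by
      have : Measurable (fun g : Fin 3 → ℝ => (g 0, (g 1)^2 + (g 2)^2)) := by fun_prop
      exact hH.comp this)
  rw [h1]
  have h2 := (volume_preserving_piFinSuccAbove (fun _ : Fin 3 => ℝ) 0).lintegral_comp
    (f := fun q : ℝ × (Fin 2 → ℝ) => H q.1 ((q.2 0)^2 + (q.2 1)^2)) (by
      exact hH.comp (measurable_fst.prodMk (by fun_prop)))
  have h3 : ∀ g : Fin 3 → ℝ, (fun q : ℝ × (Fin 2 → ℝ) => H q.1 ((q.2 0)^2 + (q.2 1)^2)) (MeasurableEquiv.piFinSuccAbove (fun _ : Fin 3 => ℝ) 0 g) = H (g 0) ((g 1)^2 + (g 2)^2) := by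
    intro g
    rfl
  simp only [h3] at h2
  rw [h2, Measure.volume_eq_prod, lintegral_prod _ (by exact (hH.comp (measurable_fst.prodMk (by fun_prop))).aemeasurable)]
  have hHp : ∀ p, Measurable (H p) := fun p => hH.comp (measurable_const.prodMk measurable_id)
  rw [← lintegral_const_mul _ (by
    exact Measurable.lintegral_prod_right' (f := Function.uncurry H) (ν := volume.restrict (Ioi 0)) hH)]
  congr 1; ext p
  have h4 := (volume_preserving_finTwoArrow ℝ).lintegral_comp (f := fun q : ℝ × ℝ => H p (q.1^2 + q.2^2)) (by
    exact (hHp p).comp (by fun_prop))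
  rw [← plane_int _ (hHp p), ← h4]
  rfl

lemma norm_sq3 (v : E3) : ‖v‖^2 = (v 0)^2 + ((v 1)^2 + (v 2)^2) := by
  rw [EuclideanSpace.norm_sq_eq, Fin.sum_univ_three]; simp [add_assoc]

lemma axial_t (H : ℝ → ℝ → ℝ≥0∞) (hH : Measurable (Function.uncurry H)) :
    ∫⁻ v : E3, H (v 0) ‖v‖ = ENNReal.ofReal (2*π) * ∫⁻ t in Ioi (0:ℝ), ENNReal.ofReal t * ∫⁻ p in Ioo (-t) t, H p t := by
  have h1 : ∀ v : E3, H (v 0) ‖v‖ = H (v 0) (√((v 0)^2 + ((v 1)^2 + (v 2)^2))) := by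
    intro v; rw [← norm_sq3, Real.sqrt_sq (norm_nonneg _)]
  simp only [h1]
  have hm : Measurable (Function.uncurry (fun p w => H p (√(p^2 + w)))) := by
    have : Measurable (fun q : ℝ × ℝ => (q.1, √(q.1^2 + q.2))) := by fun_prop
    exact hH.comp this
  have := axial (fun p w => H p (√(p^2 + w))) hm
  rw [this]
  have e : ∀ p : ℝ, ∫⁻ w in Ioi (0:ℝ), H p (√(p^2 + w)) = ∫⁻ t in Ioi (0:ℝ), (if p ∈ Ioo (-t) t then ENNReal.ofReal (2*t) * H p t else 0) := by
    intro p
    rw [subs_sq |p| (abs_nonneg p), ← lintegral_indicator measurableSet_Ioi, ← lintegral_indicator measurableSet_Ioi]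
    congr 1; ext t
    simp only [indicator, mem_Ioi, mem_Ioo]
    by_cases h : |p| < t
    · have h0 := (abs_nonneg p).trans_lt h
      rw [if_pos h, if_pos h0, if_pos (abs_lt.1 h)]
      simp [Real.sqrt_sq h0.le]
    · rw [if_neg h, if_neg (fun hh => h (abs_lt.2 hh))]; simp
  simp only [e]
  rw [lintegral_lintegral_swap]
  · rw [ENNReal.ofReal_mul (by norm_num), mul_comm (ENNReal.ofReal 2), mul_assoc]
    congr 1
    rw [← lintegral_const_mul _ ?_]
    · refine setLIntegral_congr_fun measurableSet_Ioi ?_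
      intro t ht
      simp only [mem_Ioi] at ht
      have : ∀ p, (if p ∈ Ioo (-t) t then ENNReal.ofReal (2*t) * H p t else 0) = ENNReal.ofReal (2*t) * (Ioo (-t) t).indicator (fun p => H p t) p := by
        intro p; simp only [indicator]; split_ifs <;> simp
      simp only [this]
      have hHt : Measurable (fun p => H p t) := hH.comp (measurable_id.prodMk measurable_const)
      rw [lintegral_const_mul _ (hHt.indicator measurableSet_Ioo), lintegral_indicator measurableSet_Ioo,
        ENNReal.ofReal_mul (by norm_num), mul_assoc]
    · have e2 : ∀ t, ∫⁻ p in Ioo (-t) t, H p t = ∫⁻ p, (if p ∈ Ioo (-t) t then H p t else 0) := by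
        intro t; rw [← lintegral_indicator measurableSet_Ioo]; simp only [indicator]
      simp only [e2]
      refine Measurable.mul (by fun_prop) ?_
      refine Measurable.lintegral_prod_right' (f := fun q : ℝ × ℝ => if q.2 ∈ Ioo (-q.1) q.1 then H q.2 q.1 else 0) ?_
      refine Measurable.ite ?_ (hH.comp measurable_swap) measurable_const
      exact (measurableSet_lt (f := fun q : ℝ × ℝ => -q.1) (g := fun q => q.2) (by fun_prop) (by fun_prop)).inter (measurableSet_lt (f := fun q : ℝ × ℝ => q.2) (g := fun q => q.1) (by fun_prop) (by fun_prop))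
  · refine Measurable.aemeasurable ?_
    refine Measurable.ite (p := fun q : ℝ × ℝ => q.1 ∈ Ioo (-q.2) q.2) ?_ (Measurable.mul (by fun_prop) hH) measurable_const
    exact (measurableSet_lt (f := fun q : ℝ × ℝ => -q.2) (g := fun q => q.1) (by fun_prop) (by fun_prop)).inter (measurableSet_lt (f := fun q : ℝ × ℝ => q.1) (g := fun q => q.2) (by fun_prop) (by fun_prop))

lemma radial (g : ℝ → ℝ≥0∞) (hg : Measurable g) :
    ∫⁻ x : E3, g ‖x‖ = ENNReal.ofReal (4*π) * ∫⁻ t in Ioi (0:ℝ), ENNReal.ofReal (t^2) * g t := by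
  rw [axial_t (fun _ t => g t) (hg.comp measurable_snd), show (4*π) = 2*π*2 by ring, ENNReal.ofReal_mul (p := 2*π) (by positivity), mul_assoc]
  congr 1
  rw [← lintegral_const_mul _ (by fun_prop)]
  refine setLIntegral_congr_fun measurableSet_Ioi ?_
  intro t ht
  simp only [mem_Ioi] at ht
  simp only [lintegral_const, Measure.restrict_apply_univ, Real.volume_Ioo]
  rw [mul_comm (g t), ← mul_assoc, ← mul_assoc, ← ENNReal.ofReal_mul ht.le, ← ENNReal.ofReal_mul (by norm_num)]
  congr 2; ring



def InvP {α : Type*} (G : Phase → α) : Prop := ∀ x v x' v' : E3, ‖x‖ = ‖x'‖ → ‖v‖ = ‖v'‖ →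
  (inner ℝ x v : ℝ) = inner ℝ x' v' → G (x, v) = G (x', v')

lemma sph_InvP {f : Phase → ℝ} (hf : SphSym f) : InvP f := fun _ _ _ _ h1 h2 h3 => sph_inv hf h1 h2 h3

abbrev LP : Measure ℝ := volume.restrict (Ioi (0:ℝ))
abbrev M2 : Measure (ℝ × ℝ) := LP.prod volume
abbrev M3 : Measure (ℝ × ℝ × ℝ) := LP.prod M2
abbrev WW : Measure (ℝ × ℝ) := LP.prod LP
abbrev ptq (q : ℝ × ℝ × ℝ) : Phase := pt q.2.1 q.2.2 q.1

lemma ptq_meas : Measurable ptq := by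
  have h1 : Measurable (fun a : ℝ => a • ez) := by fun_prop
  have h2 : Measurable (fun a : ℝ => a • eo) := by fun_prop
  unfold ptq pt
  refine Measurable.prodMk (h1.comp (by fun_prop)) ((h1.comp (by fun_prop)).add (h2.comp (by fun_prop)))

lemma pt_norm1 {r : ℝ} (hr : 0 < r) (p l : ℝ) : ‖(pt r p l).1‖ = r := by
  simp [pt, norm_smul, ez_norm, abs_of_pos hr]

lemma pt_norm2 (r p : ℝ) {l : ℝ} (hl : 0 ≤ l) : ‖(pt r p l).2‖^2 = p^2 + l / r^2 := by
  simp only [pt]; rw [norm_comb, div_pow, Real.sq_sqrt hl]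

lemma pt_inner (r p l : ℝ) : inner ℝ (pt r p l).1 (pt r p l).2 = r * p := by
  simp only [pt, inner_add_right, inner_smul_left, inner_smul_right, ez_eo, inner_ez_ez]; simp [mul_comm]

lemma pt_ell {r : ℝ} (hr : 0 < r) (p : ℝ) {l : ℝ} (hl : 0 ≤ l) : ellOf (pt r p l) = l := by
  rw [ellOf, pt_norm1 hr, pt_norm2 _ _ hl, pt_inner]; field_simp; ring

lemma inner_ez (v : E3) : inner ℝ ez v = v 0 := by simp [ez, EuclideanSpace.inner_single_left]

lemma scale_l {r : ℝ} (hr : 0 < r) (h : ℝ → ℝ≥0∞) :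
    ∫⁻ w in Ioi (0:ℝ), h w = ENNReal.ofReal (1/r^2) * ∫⁻ l in Ioi (0:ℝ), h (l / r^2) := by
  have hc : 0 < 1/r^2 := by positivity
  have := lintegral_image_eq_lintegral_abs_deriv_mul (s := Ioi 0) (f := fun l => l / r^2) (f' := fun _ => 1 / r^2)
    measurableSet_Ioi (fun x _ => ((hasDerivAt_id x).div_const (r^2)).hasDerivWithinAt) (by
      intro x hx y hy hxy
      have hr2 : r^2 ≠ 0 := by positivity
      simpa [div_left_inj' hr2] using hxy) h
  have e : (fun l => l / r^2) '' Ioi 0 = Ioi 0 := by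
    ext w; simp only [mem_image, mem_Ioi]; constructor
    · rintro ⟨t, ht, rfl⟩; positivity
    · intro hw
      exact ⟨w * r^2, by positivity, by field_simp⟩
  rw [e] at this
  rw [this, lintegral_const_mul' _ _ ENNReal.ofReal_ne_top, abs_of_pos hc]

lemma vint {G : Phase → ℝ≥0∞} (hG : Measurable G) (hI : InvP G) {r : ℝ} (hr : 0 < r) :
    ∫⁻ v, G (r • ez, v) = ENNReal.ofReal (π / r^2) * ∫⁻ p, ∫⁻ l in Ioi (0:ℝ), G (pt r p l) := by
  have e1 : ∀ v : E3, G (r • ez, v) = (fun p w => G (pt r p (w * r^2))) (v 0) ((v 1)^2 + (v 2)^2) := by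
    intro v
    have hw : 0 ≤ ((v 1)^2 + (v 2)^2) * r^2 := by positivity
    refine hI _ _ _ _ rfl ?_ ?_
    · rw [← pow_left_inj₀ (norm_nonneg _) (norm_nonneg _) two_ne_zero]
      have := pt_norm2 r (v 0) hw
      simp only [pt] at this
      rw [this, norm_sq3]; field_simp
    · have := pt_inner r (v 0) (((v 1)^2 + (v 2)^2) * r^2)
      simp only [pt] at this
      rw [this, inner_smul_left, inner_ez]; simp
  simp only [e1]
  have hm : Measurable (Function.uncurry (fun p w => G (pt r p (w * r^2)))) := by
    have h1 : Measurable (fun q : ℝ × ℝ => ((q.2 * r^2, r, q.1) : ℝ × ℝ × ℝ)) := by fun_prop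
    exact hG.comp (ptq_meas.comp h1)
  have := axial (fun p w => G (pt r p (w * r^2))) hm
  rw [this]
  have e2 : ∀ p, ∫⁻ w in Ioi (0:ℝ), G (pt r p (w * r^2)) = ENNReal.ofReal (1/r^2) * ∫⁻ l in Ioi (0:ℝ), G (pt r p l) := by
    intro p
    rw [scale_l hr]
    have : ∀ l : ℝ, l / r^2 * r^2 = l := fun l => by field_simp
    simp only [this]
  simp only [e2]
  rw [lintegral_const_mul' _ _ ENNReal.ofReal_ne_top, ← mul_assoc, ← ENNReal.ofReal_mul Real.pi_pos.le]
  congr 2; ring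

lemma rot_v {G : Phase → ℝ≥0∞} (hG : Measurable G) (hI : InvP G) (x : E3) :
    ∫⁻ v, G (x, v) = ∫⁻ v, G (‖x‖ • ez, v) := by
  have h1 : ‖x‖ = ‖‖x‖ • ez‖ := by simp [norm_smul, ez_norm]
  have h2 : SS (x - ‖x‖ • ez) x = ‖x‖ • ez := Submodule.reflection_sub h1
  have h3 := (SS (x - ‖x‖ • ez)).measurePreserving.lintegral_comp (f := fun v => G (‖x‖ • ez, v)) (by fun_prop)
  rw [← h3]
  congr 1; ext v
  refine hI _ _ _ _ h1 (by simp) ?_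
  have h4 := (SS (x - ‖x‖ • ez)).inner_map_map x v
  rw [h2] at h4; exact h4.symm

lemma M3_iter {G : ℝ × ℝ × ℝ → ℝ≥0∞} (hG : Measurable G) :
    ∫⁻ q, G q ∂M3 = ∫⁻ r in Ioi (0:ℝ), ∫⁻ p, ∫⁻ l in Ioi (0:ℝ), G (l, r, p) := by
  rw [lintegral_prod_symm _ hG.aemeasurable, lintegral_prod]
  exact (Measurable.lintegral_prod_left' (μ := LP) hG).aemeasurable

lemma phase_int {G : Phase → ℝ≥0∞} (hG : Measurable G) (hI : InvP G) :
    ∫⁻ z, G z = ENNReal.ofReal (4*π^2) * ∫⁻ q, G (ptq q) ∂M3 := by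
  rw [M3_iter (G := fun q => G (ptq q)) (hG.comp ptq_meas), Measure.volume_eq_prod, lintegral_prod _ hG.aemeasurable]
  rw [lintegral_congr (fun x => rot_v hG hI x)]
  have hm : Measurable (fun r : ℝ => ∫⁻ v, G (r • ez, v)) := by
    refine Measurable.lintegral_prod_right' (f := fun q : ℝ × E3 => G (q.1 • ez, q.2)) ?_
    have : Measurable (fun a : ℝ => a • ez) := by fun_prop
    exact hG.comp ((this.comp measurable_fst).prodMk measurable_snd)
  rw [radial _ hm, show 4*π^2 = 4*π*π by ring, ENNReal.ofReal_mul (p := 4*π) (by positivity), mul_assoc]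
  congr 1
  rw [← lintegral_const_mul' _ _ ENNReal.ofReal_ne_top]
  refine setLIntegral_congr_fun measurableSet_Ioi ?_
  intro r hr
  simp only [mem_Ioi] at hr
  simp only
  rw [vint hG hI hr, ← mul_assoc, ← ENNReal.ofReal_mul (by positivity)]
  congr 2; field_simp

lemma lcake (a : ℝ) : ∫⁻ s in Ioi (0:ℝ), (if s < a then (1:ℝ≥0∞) else 0) = ENNReal.ofReal a := by
  have : ∀ s, (if s < a then (1:ℝ≥0∞) else 0) = (Iio a).indicator 1 s := by
    intro s; simp [indicator]
  simp only [this]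
  rw [lintegral_indicator_one measurableSet_Iio, Measure.restrict_apply measurableSet_Iio, inter_comm, Ioi_inter_Iio]
  simp

def Zi (f : Phase → ℝ) (w y : ℝ × ℝ) : ℝ≥0∞ := if w.1 < f (pt y.1 y.2 w.2) then 1 else 0

lemma Zi_meas {f : Phase → ℝ} (hf : Measurable f) : Measurable (fun q : (ℝ × ℝ) × (ℝ × ℝ) => Zi f q.1 q.2) := by
  unfold Zi
  refine Measurable.ite (measurableSet_lt (by fun_prop) ?_) measurable_const measurable_const
  have h1 : Measurable (fun q : (ℝ × ℝ) × (ℝ × ℝ) => ((q.1.2, q.2.1, q.2.2) : ℝ × ℝ × ℝ)) := by fun_prop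
  exact hf.comp (ptq_meas.comp h1)

lemma layer {f : Phase → ℝ} (hf : Measurable f) {c : ℝ × ℝ × ℝ → ℝ≥0∞} (hc : Measurable c) :
    ∫⁻ q, c q * ENNReal.ofReal (f (ptq q)) ∂M3 = ∫⁻ w, ∫⁻ y, c (w.2, y) * Zi f w y ∂M2 ∂WW := by
  have hm : Measurable (fun q : (ℝ × ℝ) × (ℝ × ℝ) => c (q.1.2, q.2) * Zi f q.1 q.2) :=
    (hc.comp (by fun_prop)).mul (Zi_meas hf)
  rw [lintegral_prod _ (Measurable.lintegral_prod_right' hm).aemeasurable]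
  have hm2 : ∀ s, Measurable (fun q : ℝ × ℝ × ℝ => c q * (if s < f (ptq q) then 1 else 0)) := by
    intro s
    exact hc.mul (Measurable.ite (measurableSet_lt measurable_const (hf.comp ptq_meas)) measurable_const measurable_const)
  have e : ∀ s, ∫⁻ l, ∫⁻ y, c (l, y) * Zi f (s, l) y ∂M2 ∂LP = ∫⁻ q, c q * (if s < f (ptq q) then 1 else 0) ∂M3 := by
    intro s
    rw [lintegral_prod _ (hm2 s).aemeasurable]
    rfl
  simp only [e]
  rw [lintegral_lintegral_swap]
  · congr 1; ext q
    rw [lintegral_const_mul _ (by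
      exact Measurable.ite (measurableSet_lt measurable_id measurable_const) measurable_const measurable_const), lcake]
  · refine Measurable.aemeasurable ?_
    refine (hc.comp measurable_snd).mul (Measurable.ite (measurableSet_lt measurable_fst ?_) measurable_const measurable_const)
    exact hf.comp (ptq_meas.comp measurable_snd)



lemma sub_u {c : ℝ} (hc : 0 < c) (h : ℝ → ℝ≥0∞) :
    ∫⁻ u in {u : ℝ | c < u^2}, h u = ∫⁻ p in {p : ℝ | p ≠ 0}, ENNReal.ofReal (|p| / √(p^2 + c)) * h (Real.sign p * √(p^2 + c)) := by
  have hs : MeasurableSet {p : ℝ | p ≠ 0} := (measurableSet_singleton (0:ℝ)).compl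
  have hpos : ∀ p : ℝ, 0 < p^2 + c := fun p => by positivity
  have hsq : ∀ p : ℝ, 0 < √(p^2 + c) := fun p => Real.sqrt_pos.2 (hpos p)
  have hder : ∀ p : ℝ, HasDerivAt (fun p => √(p^2 + c)) (p / √(p^2 + c)) p := by
    intro p
    have := (((hasDerivAt_pow 2 p).add_const c).sqrt (hpos p).ne')
    convert this using 1
    have := (hsq p).ne'
    field_simp; simp [mul_comm]
  have key := lintegral_image_eq_lintegral_abs_deriv_mul (s := {p : ℝ | p ≠ 0})
    (f := fun p => Real.sign p * √(p^2 + c)) (f' := fun p => |p| / √(p^2 + c)) hs (by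
      intro p hp
      refine HasDerivAt.hasDerivWithinAt ?_
      rcases lt_or_gt_of_ne (show p ≠ 0 from hp) with h0 | h0
      · have : (fun p => Real.sign p * √(p^2 + c)) =ᶠ[𝓝 p] fun p => - √(p^2 + c) := by
          filter_upwards [Iio_mem_nhds h0] with q hq
          rw [Real.sign_of_neg hq]; ring
        refine HasDerivAt.congr_of_eventuallyEq ?_ this
        have h5 := (hder p).neg
        rw [abs_of_neg h0, neg_div]; exact h5
      · have : (fun p => Real.sign p * √(p^2 + c)) =ᶠ[𝓝 p] fun p => √(p^2 + c) := by
          filter_upwards [Ioi_mem_nhds h0] with q hq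
          rw [Real.sign_of_pos hq]; ring
        refine HasDerivAt.congr_of_eventuallyEq ?_ this
        rw [abs_of_pos h0]; exact hder p) (by
      intro p hp q hq hpq
      simp only at hpq
      have h1 := hsq p
      have h2 := hsq q
      rcases lt_or_gt_of_ne (show p ≠ 0 from hp) with h0 | h0 <;>
      rcases lt_or_gt_of_ne (show q ≠ 0 from hq) with h3 | h3
      · rw [Real.sign_of_neg h0, Real.sign_of_neg h3] at hpq
        have : √(p^2 + c) = √(q^2 + c) := by linarith
        rw [Real.sqrt_inj (hpos p).le (hpos q).le] at this
        nlinarith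
      · rw [Real.sign_of_neg h0, Real.sign_of_pos h3] at hpq; linarith
      · rw [Real.sign_of_pos h0, Real.sign_of_neg h3] at hpq; linarith
      · rw [Real.sign_of_pos h0, Real.sign_of_pos h3] at hpq
        have : √(p^2 + c) = √(q^2 + c) := by linarith
        rw [Real.sqrt_inj (hpos p).le (hpos q).le] at this
        nlinarith) h
  have e : (fun p => Real.sign p * √(p^2 + c)) '' {p : ℝ | p ≠ 0} = {u : ℝ | c < u^2} := by
    ext u; simp only [mem_image, mem_ofPred_eq]; constructor
    · rintro ⟨p, hp, rfl⟩
      have hsg : Real.sign p ^2 = 1 := by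
        rcases lt_or_gt_of_ne hp with h0 | h0
        · rw [Real.sign_of_neg h0]; norm_num
        · rw [Real.sign_of_pos h0]; norm_num
      rw [mul_pow, Real.sq_sqrt (hpos p).le, hsg]
      have : 0 < p^2 := by positivity
      linarith
    · intro hu
      have hu0 : u ≠ 0 := by rintro rfl; norm_num at hu; linarith
      have h1 : 0 < √(u^2 - c) := Real.sqrt_pos.2 (by linarith)
      rcases lt_or_gt_of_ne hu0 with h0 | h0
      · refine ⟨- √(u^2 - c), by linarith, ?_⟩
        rw [Real.sign_of_neg (by linarith), neg_sq, Real.sq_sqrt (by linarith), sub_add_cancel, Real.sqrt_sq_eq_abs, abs_of_neg h0]; ring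
      · refine ⟨√(u^2 - c), by linarith, ?_⟩
        rw [Real.sign_of_pos (by linarith), Real.sq_sqrt (by linarith), sub_add_cancel, Real.sqrt_sq_eq_abs, abs_of_pos h0]; ring
  rw [e] at key
  rw [key]
  congr 1; ext p
  rw [abs_of_nonneg (div_nonneg (abs_nonneg _) (hsq p).le)]

lemma mu_eq {f : Phase → ℝ} (hf : Measurable f) (s : ℝ) {l : ℝ} (hl : 0 < l) :
    muDist f s l = ENNReal.ofReal (4*π^2) * ∫⁻ y, Zi f (s, l) y ∂M2 := by
  have hmr : Measurable (fun p : ℝ × ℝ => f (radPoint p.1 p.2 l)) := by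
    have h1 : Measurable (fun q : ℝ × ℝ => ((l, q.1, Real.sign q.2 * Real.sqrt (q.1 ^ 2 * q.2 ^ 2 - l) / q.1) : ℝ × ℝ × ℝ)) := by
      have : Measurable Real.sign := by
        unfold Real.sign
        exact Measurable.ite measurableSet_Iio measurable_const (Measurable.ite measurableSet_Ioi measurable_const measurable_const)
      fun_prop
    exact hf.comp (ptq_meas.comp h1)
  have hS : MeasurableSet {p : ℝ × ℝ | s < f (radPoint p.1 p.2 l)} := measurableSet_lt measurable_const hmr
  have hD : Measurable (nuDens l) := by
    unfold nuDens
    refine Measurable.ite ?_ (by fun_prop) measurable_const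
    exact (measurableSet_lt measurable_const measurable_fst).inter (measurableSet_lt (g := fun p : ℝ × ℝ => p.1^2 * p.2^2) measurable_const (by fun_prop))
  rw [muDist, nuMeas, withDensity_apply _ hS, ← lintegral_indicator hS, Measure.volume_eq_prod,
    lintegral_prod _ (hD.indicator hS).aemeasurable,
    lintegral_prod (fun y => Zi f (s, l) y) ((Zi_meas hf).comp (measurable_const.prodMk measurable_id)).aemeasurable,
    ← lintegral_const_mul' _ _ ENNReal.ofReal_ne_top, ← lintegral_indicator measurableSet_Ioi]
  congr 1; ext r
  simp only [indicator, mem_Ioi]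
  by_cases hr : 0 < r
  swap
  · simp [nuDens, hr]
  rw [if_pos hr, ← lintegral_const_mul' _ _ ENNReal.ofReal_ne_top]
  have hc : 0 < l / r^2 := by positivity
  have e1 : ∀ u : ℝ, (if (r, u) ∈ {p : ℝ × ℝ | s < f (radPoint p.1 p.2 l)} then nuDens l (r, u) else 0)
      = {u : ℝ | l / r^2 < u^2}.indicator (fun u => (if s < f (radPoint r u l) then ENNReal.ofReal (4 * π ^ 2 * r * |u| / Real.sqrt (r ^ 2 * u ^ 2 - l)) else 0)) u := by
    intro u
    have : (l / r^2 < u^2) ↔ (l < r^2 * u^2) := by rw [div_lt_iff₀ (by positivity), mul_comm]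
    simp only [nuDens, indicator, mem_ofPred_eq, hr, true_and, this]
    split_ifs <;> rfl
  simp only [e1]
  rw [lintegral_indicator (measurableSet_lt measurable_const (by fun_prop)), sub_u hc,
    ← lintegral_indicator (s := {p : ℝ | p ≠ 0}) (measurableSet_singleton (0:ℝ)).compl]
  refine lintegral_congr_ae ?_
  have h0 : ∀ᵐ p : ℝ, p ≠ 0 := by
    simp [ae_iff]
  filter_upwards [h0] with p hp
  simp only [indicator, mem_ofPred_eq, hp, ne_eq, not_false_eq_true, if_true]
  have hsg : Real.sign p ^2 = 1 := by
    rcases lt_or_gt_of_ne hp with h0 | h0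
    · rw [Real.sign_of_neg h0]; norm_num
    · rw [Real.sign_of_pos h0]; norm_num
  have hq : 0 < p^2 + l / r^2 := by positivity
  have hq' := Real.sqrt_pos.2 hq
  have e2 : (Real.sign p * √(p^2 + l / r^2))^2 = p^2 + l/r^2 := by
    rw [mul_pow, Real.sq_sqrt hq.le, hsg, one_mul]
  have e3 : √(r^2 * (Real.sign p * √(p^2 + l / r^2))^2 - l) = r * |p| := by
    rw [e2, show r^2 * (p^2 + l / r^2) - l = (r * |p|)^2 by rw [mul_pow, sq_abs]; field_simp; ring]
    exact Real.sqrt_sq (by positivity)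
  have e4 : Real.sign (Real.sign p * √(p^2 + l / r^2)) = Real.sign p := by
    rcases lt_or_gt_of_ne hp with h0 | h0
    · rw [Real.sign_of_neg h0, Real.sign_of_neg (by linarith)]
    · rw [Real.sign_of_pos h0, Real.sign_of_pos (by linarith)]
  have e5 : Real.sign p * |p| = p := by
    rcases lt_or_gt_of_ne hp with h0 | h0
    · rw [Real.sign_of_neg h0, abs_of_neg h0]; ring
    · rw [Real.sign_of_pos h0, abs_of_pos h0]; ring
  have e6 : radPoint r (Real.sign p * √(p^2 + l / r^2)) l = pt r p l := by
    simp only [radPoint, pt, e3, e4, ez, eo]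
    rw [show Real.sign p * (r * |p|) / r = Real.sign p * |p| by field_simp, e5]
  rw [e6, e3]
  simp only [Zi]
  split_ifs
  · rw [← ENNReal.ofReal_mul (by positivity), mul_one]
    congr 1
    have e7 : |Real.sign p * √(p^2 + l / r^2)| = √(p^2 + l / r^2) := by
      rw [← Real.sqrt_sq_eq_abs, e2]
    rw [e7]
    have : |p| ≠ 0 := abs_ne_zero.2 hp
    field_simp
  · simp



structure NF (f : Phase → ℝ) : Prop where
  meas : Measurable f
  nn : ∀ z, 0 ≤ f z
  sym : SphSym f
  l1 : ∫⁻ z, ENNReal.ofReal (f z) < ⊤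
  li : ∃ S : ℝ, 0 < S ∧ ∀ᵐ z, f z ≤ S
  kin : ∫⁻ z : Phase, ENNReal.ofReal (‖z.2‖^2) * ENNReal.ofReal (f z) < ⊤

lemma memErad_NF {f : Phase → ℝ} (h : memErad f) : NF f := by
  obtain ⟨⟨h1, h2, h3⟩, h4⟩ := h
  unfold eNormE at h3
  rw [ENNReal.add_lt_top, ENNReal.add_lt_top] at h3
  obtain ⟨⟨ha, hb⟩, hc⟩ := h3
  refine ⟨h1, h2, h4, ?_, ?_, ?_⟩
  · rw [eLpNorm_one_eq_lintegral_enorm] at ha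
    convert ha using 3 with z
    rw [← ofReal_norm, Real.norm_of_nonneg (h2 z)]
  · rw [eLpNorm_exponent_top] at hb
    refine ⟨(eLpNormEssSup f volume).toReal + 1, by positivity, ?_⟩
    filter_upwards [enorm_ae_le_eLpNormEssSup f volume] with z hz
    have := ENNReal.toReal_mono hb.ne hz
    rw [toReal_enorm, Real.norm_of_nonneg (h2 z)] at this
    linarith
  · convert hc using 3 with z
    congr 1
    · rw [ENNReal.ofReal_pow (norm_nonneg _), ofReal_norm]; rfl
    · rw [← Real.norm_of_nonneg (h2 z), ofReal_norm, Real.norm_of_nonneg (h2 z)]; rfl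

lemma NF_cpt {Q : Phase → ℝ} (hc : Continuous Q) (hn : ∀ z, 0 ≤ Q z) (hcpt : HasCompactSupport Q) (hs : SphSym Q) : NF Q := by
  have key : ∀ g : Phase → ℝ, Continuous g → (∀ z, 0 ≤ g z) → HasCompactSupport g → ∫⁻ z, ENNReal.ofReal (g z) < ⊤ := by
    intro g h1 h2 h3
    have := (h1.integrable_of_hasCompactSupport (μ := volume) h3).lintegral_lt_top
    exact this
  refine ⟨hc.measurable, hn, hs, key Q hc hn hcpt, ?_, ?_⟩
  · obtain ⟨C, hC⟩ := hcpt.exists_bound_of_continuous hc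
    refine ⟨max C 1, by positivity, ae_of_all _ fun z => ?_⟩
    exact (le_abs_self _).trans ((hC z).trans (le_max_left _ _))
  · have := key (fun z => ‖z.2‖^2 * Q z) (by fun_prop) (fun z => mul_nonneg (by positivity) (hn z)) hcpt.mul_left
    convert this using 3 with z
    rw [ENNReal.ofReal_mul (by positivity)]

def nL (f : Phase → ℝ) (t : ℝ) : ℝ≥0∞ :=
  ENNReal.ofReal (4*π^2) * ∫⁻ p, ∫⁻ l in Ioi (0:ℝ), ENNReal.ofReal (f (pt t p l))
def mL (f : Phase → ℝ) (r : ℝ) : ℝ≥0∞ := ∫⁻ t in Ioc 0 r, nL f t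
def mm (f : Phase → ℝ) (r : ℝ) : ℝ := (mL f r).toReal

lemma n_int {f : Phase → ℝ} (hf : Measurable f) {c : ℝ → ℝ≥0∞} (hc : Measurable c) :
    ENNReal.ofReal (4*π^2) * ∫⁻ q, c q.2.1 * ENNReal.ofReal (f (ptq q)) ∂M3 = ∫⁻ t in Ioi (0:ℝ), c t * nL f t := by
  have hm : Measurable (fun q => ENNReal.ofReal (f (ptq q))) := (hf.comp ptq_meas).ennreal_ofReal
  have hm2 : Measurable (fun q : ℝ × ℝ × ℝ => c q.2.1 * ENNReal.ofReal (f (ptq q))) := (hc.comp (by fun_prop)).mul hm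
  have e : Measurable (fun a : (ℝ × ℝ) × ℝ => ENNReal.ofReal (f (pt a.1.1 a.1.2 a.2))) := by
    have h1 : Measurable (fun a : (ℝ × ℝ) × ℝ => ((a.2, a.1.1, a.1.2) : ℝ × ℝ × ℝ)) := by fun_prop
    exact hm.comp h1
  have e2 : Measurable (fun a : ℝ × ℝ => ∫⁻ l in Ioi (0:ℝ), ENNReal.ofReal (f (pt a.1 a.2 l))) :=
    Measurable.lintegral_prod_right' (ν := LP) e
  rw [M3_iter hm2, ← lintegral_const_mul' _ _ ENNReal.ofReal_ne_top]
  congr 1; ext t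
  simp only [nL, ptq]
  have : ∀ p, ∫⁻ l in Ioi (0:ℝ), c t * ENNReal.ofReal (f (pt t p l)) = c t * ∫⁻ l in Ioi (0:ℝ), ENNReal.ofReal (f (pt t p l)) := by
    intro p
    exact lintegral_const_mul _ (e.comp (measurable_prodMk_left (x := (t, p))))
  simp only [this]
  have h3 : Measurable (fun p => ∫⁻ l in Ioi (0:ℝ), ENNReal.ofReal (f (pt t p l))) := e2.comp (measurable_prodMk_left (x := t))
  rw [lintegral_const_mul _ h3]
  ring

lemma nL_meas {f : Phase → ℝ} (hf : Measurable f) : Measurable (nL f) := by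
  have hm : Measurable (fun q => ENNReal.ofReal (f (ptq q))) := (hf.comp ptq_meas).ennreal_ofReal
  have e : Measurable (fun a : (ℝ × ℝ) × ℝ => ENNReal.ofReal (f (pt a.1.1 a.1.2 a.2))) := by
    have h1 : Measurable (fun a : (ℝ × ℝ) × ℝ => ((a.2, a.1.1, a.1.2) : ℝ × ℝ × ℝ)) := by fun_prop
    exact hm.comp h1
  have e2 : Measurable (fun a : ℝ × ℝ => ∫⁻ l in Ioi (0:ℝ), ENNReal.ofReal (f (pt a.1 a.2 l))) :=
    Measurable.lintegral_prod_right' (ν := LP) e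
  exact (Measurable.lintegral_prod_right' (ν := volume) e2).const_mul _

lemma phase_rad {f : Phase → ℝ} (hf : Measurable f) (hs : SphSym f) {c : ℝ → ℝ≥0∞} (hc : Measurable c) :
    ∫⁻ z : Phase, c ‖z.1‖ * ENNReal.ofReal (f z) = ∫⁻ t in Ioi (0:ℝ), c t * nL f t := by
  rw [← n_int hf hc, phase_int (G := fun z => c ‖z.1‖ * ENNReal.ofReal (f z)) ((hc.comp (by fun_prop)).mul hf.ennreal_ofReal)]
  · congr 1
    have hM : ∀ᵐ q ∂M3, 0 < q.2.1 := by
      have h1 : ∀ᵐ y ∂M2, 0 < y.1 := (Measure.quasiMeasurePreserving_fst (μ := LP) (ν := volume)).ae (ae_restrict_mem measurableSet_Ioi)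
      exact (Measure.quasiMeasurePreserving_snd (μ := LP) (ν := M2)).ae h1
    refine lintegral_congr_ae ?_
    filter_upwards [hM] with q hq
    rw [pt_norm1 hq]
  · intro x v x' v' h1 h2 h3
    simp only; rw [h1, sph_inv hs h1 h2 h3]

namespace NF
variable {f : Phase → ℝ}

lemma tot (h : NF f) : ∫⁻ t in Ioi (0:ℝ), nL f t = ∫⁻ z, ENNReal.ofReal (f z) := by
  have := phase_rad h.meas h.sym (c := fun _ => 1) measurable_const
  simpa using this.symm

lemma mL_le (h : NF f) (r : ℝ) : mL f r ≤ ∫⁻ z, ENNReal.ofReal (f z) := by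
  rw [← h.tot]; exact lintegral_mono_set (fun x hx => hx.1)

lemma mL_fin (h : NF f) (r : ℝ) : mL f r < ⊤ := (h.mL_le r).trans_lt h.l1

lemma of_mm (h : NF f) (r : ℝ) : ENNReal.ofReal (mm f r) = mL f r := ENNReal.ofReal_toReal (h.mL_fin r).ne

lemma mm_nonneg (f : Phase → ℝ) (r : ℝ) : 0 ≤ mm f r := ENNReal.toReal_nonneg

lemma mm_mono (h : NF f) : Monotone (mm f) := by
  intro a b hab
  exact ENNReal.toReal_mono (h.mL_fin b).ne (lintegral_mono_set (Ioc_subset_Ioc_right hab))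

lemma mm_neg (f : Phase → ℝ) {r : ℝ} (hr : r ≤ 0) : mm f r = 0 := by
  simp [mm, mL, Ioc_eq_empty (not_lt.2 hr)]

lemma mm_bdd (h : NF f) : ∃ M : ℝ, 0 < M ∧ ∀ r, mm f r ≤ M := by
  refine ⟨(∫⁻ z, ENNReal.ofReal (f z)).toReal + 1, by positivity, fun r => ?_⟩
  have := ENNReal.toReal_mono h.l1.ne (h.mL_le r)
  unfold mm; linarith

lemma mm_cont (h : NF f) : Continuous (mm f) := by
  have hfin : ∫⁻ t in Ioi (0:ℝ), nL f t ≠ ⊤ := by rw [h.tot]; exact h.l1.ne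
  have hint : Integrable ((Ioi (0:ℝ)).indicator (fun t => (nL f t).toReal)) := by
    rw [integrable_indicator_iff measurableSet_Ioi]
    exact integrable_toReal_of_lintegral_ne_top (nL_meas h.meas).aemeasurable hfin
  have e : mm f = fun r => ∫ t in (0:ℝ)..(max r 0), (Ioi (0:ℝ)).indicator (fun t => (nL f t).toReal) t := by
    ext r
    rw [intervalIntegral.integral_of_le (le_max_right _ _)]
    have : ∫ t in Ioc 0 (max r 0), (Ioi (0:ℝ)).indicator (fun t => (nL f t).toReal) t = ∫ t in Ioc 0 (max r 0), (nL f t).toReal := by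
      refine setIntegral_congr_fun measurableSet_Ioc ?_
      intro t ht
      simp [indicator, ht.1]
    rw [this, integral_toReal]
    · unfold mm mL
      rcases le_or_gt r 0 with h0 | h0
      · rw [max_eq_right h0, Ioc_eq_empty (not_lt.2 h0)]; simp
      · rw [max_eq_left h0.le]
    · exact (nL_meas h.meas).aemeasurable
    · exact ae_lt_top (nL_meas h.meas) (ne_top_of_le_ne_top hfin (lintegral_mono_set (fun x hx => hx.1)))
  rw [e]
  exact (intervalIntegral.continuous_primitive (fun a b => hint.intervalIntegrable) 0).comp (by fun_prop)

end NF



namespace NF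
variable {f : Phase → ℝ}

lemma mL_eq (h : NF f) (r : ℝ) : mL f r = ∫⁻ z : Phase, (Iic r).indicator 1 ‖z.1‖ * ENNReal.ofReal (f z) := by
  rw [phase_rad h.meas h.sym (c := (Iic r).indicator 1) (measurable_one.indicator measurableSet_Iic), mL,
    ← lintegral_indicator measurableSet_Ioi, ← lintegral_indicator measurableSet_Ioc]
  congr 1; ext t
  simp only [indicator, mem_Ioi, mem_Iic, mem_Ioc, Pi.one_apply]
  split_ifs <;> simp_all

lemma mm_lin0 (h : NF f) : ∃ C : ℝ, 0 < C ∧ ∀ r, 0 < r → r ≤ 1 → mm f r ≤ C * r := by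
  obtain ⟨S, hS, hf⟩ := h.li
  set K := (∫⁻ z : Phase, ENNReal.ofReal (‖z.2‖^2) * ENNReal.ofReal (f z)).toReal with hK
  have hKe : ENNReal.ofReal K = ∫⁻ z : Phase, ENNReal.ofReal (‖z.2‖^2) * ENNReal.ofReal (f z) :=
    ENNReal.ofReal_toReal h.kin.ne
  have hK0 : 0 ≤ K := ENNReal.toReal_nonneg
  refine ⟨S * (π*4/3)^2 + K, by positivity, fun r hr hr1 => ?_⟩
  have hs : 0 < √r := Real.sqrt_pos.2 hr
  have hs2 : √r^2 = r := Real.sq_sqrt hr.le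
  have hs1 : √r ≤ 1 := Real.sqrt_le_one.2 hr1
  have key : mL f r ≤ ENNReal.ofReal ((S * (π*4/3)^2 + K) * r) := by
    rw [h.mL_eq]
    have hms : MeasurableSet (Metric.closedBall (0:E3) r ×ˢ Metric.closedBall (0:E3) (1/√r)) :=
      Metric.isClosed_closedBall.measurableSet.prod Metric.isClosed_closedBall.measurableSet
    calc _ ≤ ∫⁻ z : Phase, ((Metric.closedBall (0:E3) r ×ˢ Metric.closedBall (0:E3) (1/√r)).indicator (fun _ => ENNReal.ofReal S) z
            + ENNReal.ofReal r * (ENNReal.ofReal (‖z.2‖^2) * ENNReal.ofReal (f z))) := by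
          refine lintegral_mono_ae ?_
          filter_upwards [hf] with z hz
          by_cases h1 : ‖z.1‖ ≤ r
          · by_cases h2 : ‖z.2‖ ≤ 1/√r
            · refine le_add_right ?_
              have : z ∈ Metric.closedBall (0:E3) r ×ˢ Metric.closedBall (0:E3) (1/√r) := by
                simp [Set.mem_prod, h1]; simpa using h2
              rw [indicator_of_mem this, indicator_of_mem (show ‖z.1‖ ∈ Iic r from h1)]
              simp only [Pi.one_apply, one_mul]
              exact ENNReal.ofReal_le_ofReal hz
            · refine le_add_left ?_
              rw [indicator_of_mem (show ‖z.1‖ ∈ Iic r from h1), Pi.one_apply, ← mul_assoc, ← ENNReal.ofReal_mul hr.le]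
              gcongr
              rw [← ENNReal.ofReal_one]
              refine ENNReal.ofReal_le_ofReal ?_
              push Not at h2
              rw [div_lt_iff₀ hs] at h2
              have h3 : 1 ≤ (‖z.2‖ * √r)^2 := one_le_pow₀ h2.le
              rw [mul_pow, hs2] at h3; linarith
          · rw [indicator_of_notMem (show ‖z.1‖ ∉ Iic r from h1)]; simp
      _ = ENNReal.ofReal S * volume (Metric.closedBall (0:E3) r ×ˢ Metric.closedBall (0:E3) (1/√r)) + ENNReal.ofReal r * ENNReal.ofReal K := by
          rw [lintegral_add_left (measurable_const.indicator hms), lintegral_indicator hms, setLIntegral_const,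
            lintegral_const_mul' _ _ ENNReal.ofReal_ne_top, hKe]
      _ ≤ _ := by
          rw [Measure.volume_eq_prod, Measure.prod_prod, EuclideanSpace.volume_closedBall_fin_three, EuclideanSpace.volume_closedBall_fin_three,
            add_mul, ENNReal.ofReal_add (by positivity) (by positivity), mul_comm K r, ENNReal.ofReal_mul hr.le]
          gcongr
          rw [← ENNReal.ofReal_pow hr.le, ← ENNReal.ofReal_pow (by positivity), ← ENNReal.ofReal_mul (by positivity), ← ENNReal.ofReal_mul (by positivity), ← ENNReal.ofReal_mul (by positivity), ← ENNReal.ofReal_mul hS.le]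
          refine ENNReal.ofReal_le_ofReal ?_
          have : r^3 * (1/√r)^3 ≤ r := by
            have : r^3 * (1/√r)^3 = √r^3 := by
              rw [show r^3 = √r^6 by rw [← hs2]; ring_nf; rw [hs2]]; field_simp
            rw [this]; nlinarith
          have h5 : 0 ≤ S * (π*4/3)^2 := by positivity
          calc _ = S * (π*4/3)^2 * (r^3 * (1/√r)^3) := by ring
            _ ≤ _ := by gcongr
  have := ENNReal.toReal_mono ENNReal.ofReal_ne_top key
  rwa [ENNReal.toReal_ofReal (by positivity)] at this

lemma mm_lin (h : NF f) : ∃ C : ℝ, 0 < C ∧ ∀ r, 0 < r → mm f r ≤ C * r ∧ mm f r ≤ C := by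
  obtain ⟨C, hC, h1⟩ := h.mm_lin0
  obtain ⟨M, hM, h2⟩ := h.mm_bdd
  refine ⟨max C M, by positivity, fun r hr => ⟨?_, (h2 r).trans (le_max_right _ _)⟩⟩
  rcases le_or_gt r 1 with h3 | h3
  · exact (h1 r hr h3).trans (by gcongr; exact le_max_left _ _)
  · have := h2 r
    have h4 := le_max_right C M
    nlinarith

end NF

lemma fin_sq {k : ℝ → ℝ} {C : ℝ} (hC : 0 < C) (hk : ∀ r, 0 < r → |k r| ≤ C * r ∧ |k r| ≤ C) :
    ∫⁻ r in Ioi (0:ℝ), ENNReal.ofReal (k r^2 / (4*π*r^2)) < ⊤ := by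
  rw [← Ioc_union_Ioi_eq_Ioi (zero_le_one' ℝ)]
  refine (lintegral_union_le _ _ _).trans_lt ?_
  rw [ENNReal.add_lt_top]
  have hpi := Real.pi_gt_three
  have hmain : ∀ r, 0 < r → k r^2/(4*π*r^2) ≤ C^2 ∧ k r^2/(4*π*r^2) ≤ C^2 * (1/r^2) := by
    intro r hr
    obtain ⟨h1, h2⟩ := hk r hr
    have h3 : k r^2 ≤ (C*r)^2 := by rw [← sq_abs]; gcongr
    have h4 : k r^2 ≤ C^2 := by rw [← sq_abs]; gcongr
    have h5 : 0 < r^2 := by positivity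
    have h6 : r^2 ≤ 4*π*r^2 := by nlinarith
    constructor
    · rw [div_le_iff₀ (by positivity)]
      have : 0 < C^2 := by positivity
      nlinarith
    · rw [div_le_iff₀ (by positivity)]
      have : C^2 * (1/r^2) * (4*π*r^2) = C^2 * (4*π) := by field_simp
      rw [this]
      have : 0 < C^2 := by positivity
      nlinarith
  constructor
  · calc _ ≤ ∫⁻ r in Ioc (0:ℝ) 1, ENNReal.ofReal (C^2) := by
          refine setLIntegral_mono' measurableSet_Ioc fun r hr => ENNReal.ofReal_le_ofReal (hmain r hr.1).1
      _ < ⊤ := by simp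
  · calc _ ≤ ∫⁻ r in Ioi (1:ℝ), ENNReal.ofReal (C^2) * ENNReal.ofReal (1/r^2) := by
          refine setLIntegral_mono' measurableSet_Ioi fun r hr => ?_
          rw [← ENNReal.ofReal_mul (by positivity)]
          exact ENNReal.ofReal_le_ofReal (hmain r (zero_lt_one.trans hr)).2
      _ < ⊤ := by
          rw [lintegral_const_mul' _ _ ENNReal.ofReal_ne_top, V3 1 one_pos]
          exact ENNReal.mul_lt_top ENNReal.ofReal_lt_top ENNReal.ofReal_lt_top



lemma ker_int {r t : ℝ} (hr : 0 < r) (ht : 0 < t) :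
    ∫⁻ p in Ioo (-t) t, ENNReal.ofReal (1/(4*π*√(t^2 + r^2 - 2*r*p))) = ENNReal.ofReal (min t r / (2*π*r)) := by
  have hpos : ∀ p ∈ Ioo (-t) t, 0 < t^2 + r^2 - 2*r*p := by
    intro p hp
    have := hp.2
    nlinarith [sq_nonneg (t - r)]
  set g : ℝ → ℝ := fun p => -√(t^2 + r^2 - 2*r*p) / (4*π*r) with hg
  have hc : ContinuousOn g (Icc (-t) t) := by
    have : Continuous g := by rw [hg]; fun_prop
    exact this.continuousOn
  have hd : ∀ p ∈ Ioo (-t) t, HasDerivAt g (1/(4*π*√(t^2 + r^2 - 2*r*p))) p := by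
    intro p hp
    have h1 : HasDerivAt (fun p => t^2 + r^2 - 2*r*p) (-(2*r)) p := by
      have := ((hasDerivAt_id p).const_mul (2*r)).const_sub (t^2 + r^2)
      simpa using this
    have h2 := ((h1.sqrt (hpos p hp).ne').neg).div_const (4*π*r)
    have h3 : √(t^2 + r^2 - 2*r*p) ≠ 0 := (Real.sqrt_pos.2 (hpos p hp)).ne'
    refine h2.congr_deriv ?_
    have := Real.pi_pos.ne'
    field_simp
  have hnn : ∀ p ∈ Ioo (-t) t, 0 ≤ 1/(4*π*√(t^2 + r^2 - 2*r*p)) := fun p _ => by positivity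
  have hi := intervalIntegral.integrableOn_deriv_of_nonneg hc hd hnn
  have hle : -t ≤ t := by linarith
  have hI := intervalIntegral.integral_eq_sub_of_hasDerivAt_of_le hle hc hd (by
    rw [intervalIntegrable_iff_integrableOn_Ioc_of_le hle]; exact hi)
  rw [intervalIntegral.integral_of_le hle, integral_Ioc_eq_integral_Ioo] at hI
  rw [← ofReal_integral_eq_lintegral_ofReal (hi.mono_set Ioo_subset_Ioc_self)
    (ae_of_all _ (fun p => by positivity)), hI]
  congr 1
  simp only [hg]
  rw [show t^2 + r^2 - 2*r*t = (t-r)^2 by ring, show t^2 + r^2 - 2*r*(-t) = (t+r)^2 by ring, Real.sqrt_sq_eq_abs,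
    Real.sqrt_sq (by linarith)]
  have := Real.pi_pos.ne'
  rcases le_total t r with h | h
  · rw [min_eq_left h, abs_of_nonpos (by linarith)]; field_simp; ring
  · rw [min_eq_right h, abs_of_nonneg (by linarith)]; field_simp; ring

namespace NF
variable {f : Phase → ℝ}

lemma invE (h : NF f) : InvP (fun z => ENNReal.ofReal (f z)) := by
  intro x v x' v' h1 h2 h3
  simp only [sph_inv h.sym h1 h2 h3]

lemma rho_eq (h : NF f) (y : E3) : rhoF f y = (∫⁻ v, ENNReal.ofReal (f (‖y‖ • ez, v))).toReal := by
  have hm := h.meas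
  rw [rhoF, integral_eq_lintegral_of_nonneg_ae (ae_of_all _ fun v => h.nn _) (by fun_prop : Measurable fun v => f (y, v)).aestronglyMeasurable,
    rot_v (G := fun z => ENNReal.ofReal (f z)) (by fun_prop) h.invE]

lemma R_n (h : NF f) {t : ℝ} (ht : 0 < t) : nL f t = ENNReal.ofReal (4*π*t^2) * ∫⁻ v, ENNReal.ofReal (f (t • ez, v)) := by
  have hm := h.meas
  rw [vint (G := fun z => ENNReal.ofReal (f z)) (by fun_prop) h.invE ht, ← mul_assoc, ← ENNReal.ofReal_mul (by positivity), nL]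
  congr 2; field_simp

lemma R_fin (h : NF f) : ∀ᵐ t ∂LP, ∫⁻ v, ENNReal.ofReal (f (t • ez, v)) < ⊤ := by
  have h1 : ∀ᵐ t ∂LP, nL f t < ⊤ := ae_lt_top (nL_meas h.meas) (by rw [h.tot]; exact h.l1.ne)
  filter_upwards [h1, ae_restrict_mem measurableSet_Ioi] with t ht h0
  simp only [mem_Ioi] at h0
  rw [h.R_n h0] at ht
  by_contra hcon
  rw [not_lt_top_iff] at hcon
  rw [hcon, ENNReal.mul_top (by simp; positivity)] at ht
  exact lt_irrefl _ ht

lemma phi_lint (h : NF f) {x : E3} (hx : x ≠ 0) :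
    ∫⁻ y, ENNReal.ofReal (rhoF f y / (4*π*‖x - y‖)) = ∫⁻ t in Ioi (0:ℝ), ENNReal.ofReal (1/(4*π*max t ‖x‖)) * nL f t := by
  have hm := h.meas
  set r := ‖x‖ with hr'
  have hr : 0 < r := norm_pos_iff.2 hx
  set R : ℝ → ℝ≥0∞ := fun t => ∫⁻ v, ENNReal.ofReal (f (t • ez, v)) with hR
  have hRm : Measurable R := by
    refine Measurable.lintegral_prod_right' (f := fun q : ℝ × E3 => ENNReal.ofReal (f (q.1 • ez, q.2))) ?_
    have : Measurable (fun a : ℝ => a • ez) := by fun_prop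
    exact (hm.comp ((this.comp measurable_fst).prodMk measurable_snd)).ennreal_ofReal
  have h1 : ‖x‖ = ‖‖x‖ • ez‖ := by simp [norm_smul, ez_norm]
  have h2 : SS (x - ‖x‖ • ez) x = ‖x‖ • ez := Submodule.reflection_sub h1
  rw [← hr'] at h2
  set S := SS (x - r • ez)
  have hSS : ∀ y, S (S y) = y := fun y => Submodule.reflection_reflection _ y
  have hrm : Measurable (fun y => ENNReal.ofReal (rhoF f y / (4*π*‖x - y‖))) := by
    have : Measurable (rhoF f) := by
      have e : rhoF f = fun y => (R ‖y‖).toReal := by ext y; exact h.rho_eq y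
      rw [e]; fun_prop
    fun_prop
  have h3 := S.measurePreserving.lintegral_comp hrm
  rw [← h3]
  set H : ℝ → ℝ → ℝ≥0∞ := fun p t => ENNReal.ofReal (R t).toReal * ENNReal.ofReal (1/(4*π*√(t^2 + r^2 - 2*r*p))) with hH
  have e : ∀ y : E3, ENNReal.ofReal (rhoF f (S y) / (4*π*‖x - S y‖)) = H (y 0) ‖y‖ := by
    intro y
    have h4 : ‖x - S y‖ = √(‖y‖^2 + r^2 - 2*r*y 0) := by
      rw [← LinearIsometryEquiv.norm_map S, map_sub, hSS, h2]
      rw [← Real.sqrt_sq (norm_nonneg (r • ez - y)), norm_sub_sq_real, norm_smul, ez_norm, inner_smul_left, inner_ez]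
      congr 1
      simp [abs_of_pos hr]; ring
    rw [h4, h.rho_eq, LinearIsometryEquiv.norm_map, hH]
    simp only
    rw [← ENNReal.ofReal_mul ENNReal.toReal_nonneg]
    congr 1; rw [mul_one_div]
  simp only [e]
  have hHm : Measurable (Function.uncurry H) := by
    have a1 : Measurable (fun q : ℝ × ℝ => ENNReal.ofReal (R q.2).toReal) := by fun_prop
    have a2 : Measurable (fun q : ℝ × ℝ => ENNReal.ofReal (1/(4*π*√(q.2^2 + r^2 - 2*r*q.1)))) := by fun_prop
    exact a1.mul a2
  rw [axial_t H hHm, ← lintegral_const_mul' _ _ ENNReal.ofReal_ne_top]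
  refine lintegral_congr_ae ?_
  filter_upwards [h.R_fin, ae_restrict_mem measurableSet_Ioi] with t ht h0
  simp only [mem_Ioi] at h0
  simp only [hH]
  rw [lintegral_const_mul' _ _ ENNReal.ofReal_ne_top, ker_int hr h0, ENNReal.ofReal_toReal ht.ne, h.R_n h0]
  change _ = _ * (_ * R t)
  rw [mul_comm (R t), ← mul_assoc, ← mul_assoc, ← mul_assoc, ← ENNReal.ofReal_mul (by positivity),
    ← ENNReal.ofReal_mul (by positivity), ← ENNReal.ofReal_mul (by positivity)]
  congr 2
  have := Real.pi_pos.ne'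
  rcases le_total t r with h | h
  · rw [min_eq_left h, max_eq_right h]; field_simp
  · rw [min_eq_right h, max_eq_left h]; field_simp

lemma phi_lint2 (h : NF f) {r : ℝ} (hr : 0 < r) :
    ∫⁻ t in Ioi (0:ℝ), ENNReal.ofReal (1/(4*π*max t r)) * nL f t = ∫⁻ s in Ioi r, ENNReal.ofReal (mm f s/(4*π*s^2)) := by
  have e := tri_tonelli (fun s => if r < s then 1/(4*π*s^2) else 0) (fun t => 1/(4*π*max t r)) (by
      exact Measurable.ite measurableSet_Ioi (by fun_prop) measurable_const) (by
      intro t ht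
      have : ∫⁻ s in Ioi t, ENNReal.ofReal (if r < s then 1/(4*π*s^2) else 0) = ∫⁻ s in Ioi (max t r), ENNReal.ofReal (1/(4*π)) * ENNReal.ofReal (1/s^2) := by
        rw [← lintegral_indicator measurableSet_Ioi, ← lintegral_indicator measurableSet_Ioi]
        congr 1; ext s
        simp only [indicator, mem_Ioi, max_lt_iff]
        split_ifs with h1 h2 h3
        · rw [← ENNReal.ofReal_mul (by positivity)]; congr 1; field_simp
        all_goals simp_all
      rw [this, lintegral_const_mul' _ _ ENNReal.ofReal_ne_top, V3 _ (lt_max_of_lt_left ht), ← ENNReal.ofReal_mul (by positivity)]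
      congr 1; field_simp) (nL f) (nL_meas h.meas)
  rw [e, ← lintegral_indicator measurableSet_Ioi, ← lintegral_indicator measurableSet_Ioi]
  congr 1; ext s
  have e2 : ∫⁻ t in Ioc 0 s, nL f t = ENNReal.ofReal (mm f s) := (h.of_mm s).symm
  simp only [indicator, mem_Ioi]
  rw [e2]
  by_cases h1 : r < s
  · rw [if_pos h1, if_pos h1, if_pos (hr.trans h1), ← ENNReal.ofReal_mul (by positivity)]
    congr 1; ring
  · simp [h1]

lemma mint (h : NF f) {r : ℝ} (hr : 0 < r) : IntegrableOn (fun s => mm f s/(4*π*s^2)) (Ioi r) := by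
  obtain ⟨C, hC, hb⟩ := h.mm_lin
  have h1 : IntegrableOn (fun s : ℝ => C * (1/s^2)) (Ioi r) := by
    have := (integrableOn_Ioi_rpow_of_lt (by norm_num : (-2:ℝ) < -1) hr).const_mul C
    refine IntegrableOn.congr_fun this (fun s hs => ?_) measurableSet_Ioi
    rw [Real.rpow_neg (hr.trans hs).le]; norm_num
  refine h1.mono' ?_ ?_
  · have := h.mm_cont.measurable
    exact (by fun_prop : Measurable (fun s => mm f s/(4*π*s^2))).aestronglyMeasurable
  · filter_upwards [ae_restrict_mem measurableSet_Ioi] with s hs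
    have hs0 : 0 < s := hr.trans hs
    have := mm_nonneg f s
    rw [Real.norm_of_nonneg (by positivity), mul_one_div]
    have hpi := Real.pi_gt_three
    have h5 : 0 < s^2 := by positivity
    have := (hb s hs0).2
    gcongr
    nlinarith

lemma phi_eq (h : NF f) {x : E3} (hx : x ≠ 0) : phiF f x = - ∫ s in Ioi ‖x‖, mm f s/(4*π*s^2) := by
  have hr : 0 < ‖x‖ := norm_pos_iff.2 hx
  have hm := h.meas
  have hrho : ∀ y, 0 ≤ rhoF f y := fun y => integral_nonneg fun v => h.nn _
  have hrm : Measurable (rhoF f) := by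
    have : StronglyMeasurable (rhoF f) := StronglyMeasurable.integral_prod_right (f := fun x v => f (x, v)) hm.stronglyMeasurable
    exact this.measurable
  rw [phiF, integral_eq_lintegral_of_nonneg_ae (ae_of_all _ fun y => div_nonneg (hrho y) (by positivity)) (by fun_prop : Measurable fun y => rhoF f y / (4*π*‖x - y‖)).aestronglyMeasurable, h.phi_lint hx, h.phi_lint2 hr,
    ← ofReal_integral_eq_lintegral_ofReal (h.mint hr) (ae_of_all _ fun s => div_nonneg (mm_nonneg f s) (by positivity)), ENNReal.toReal_ofReal]
  exact integral_nonneg fun s => div_nonneg (mm_nonneg f s) (by positivity)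

def GG (f : Phase → ℝ) (r : ℝ) : ℝ := ∫ s in Ioi r, mm f s/(4*π*s^2)

lemma GG_der (h : NF f) {r : ℝ} (hr : 0 < r) : HasDerivAt (GG f) (-(mm f r/(4*π*r^2))) r := by
  have hr2 : 0 < r/2 := by linarith
  have e : GG f =ᶠ[𝓝 r] fun r' => GG f (r/2) - ∫ s in (r/2)..r', mm f s/(4*π*s^2) := by
    filter_upwards [Ioi_mem_nhds (show r/2 < r by linarith)] with r' hr'
    simp only [mem_Ioi] at hr'
    have := intervalIntegral.integral_interval_add_Ioi (h.mint hr2) (h.mint (hr2.trans hr'))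
    unfold GG; linarith
  have hcts : ContinuousOn (fun s => mm f s/(4*π*s^2)) (Ioi 0) := by
    refine h.mm_cont.continuousOn.div (by fun_prop) ?_
    intro s hs
    have : (0:ℝ) < s := hs
    positivity
  refine HasDerivAt.congr_of_eventuallyEq ?_ e
  have h1 := intervalIntegral.integral_hasDerivAt_right (f := fun s => mm f s/(4*π*s^2)) (a := r/2) (b := r)
    ((hcts.mono (fun s hs => by
      rw [uIcc_of_le (by linarith)] at hs; exact hr2.trans_le hs.1)).intervalIntegrable)
    (hcts.stronglyMeasurableAtFilter isOpen_Ioi r hr) (hcts.continuousAt (Ioi_mem_nhds hr))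
  exact h1.const_sub _

lemma grad_eq (h : NF f) {x : E3} (hx : x ≠ 0) : gradPhi f x = (mm f ‖x‖ / (4*π*‖x‖^2)) • (‖x‖⁻¹ • x) := by
  have hr : 0 < ‖x‖ := norm_pos_iff.2 hx
  have e : phiF f =ᶠ[𝓝 x] fun y => - GG f ‖y‖ := by
    filter_upwards [isOpen_ne.mem_nhds hx] with y hy
    exact h.phi_eq hy
  have hn : HasGradientAt (fun y : E3 => ‖y‖) (‖x‖⁻¹ • x) x := by
    have h1 : HasFDerivAt (fun y : E3 => ‖y‖^2) (2 • (innerSL ℝ x)) x := (hasStrictFDerivAt_norm_sq x).hasFDerivAt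
    have h2 := h1.sqrt (by positivity)
    simp only [Real.sqrt_sq (norm_nonneg _)] at h2
    rw [hasGradientAt_iff_hasFDerivAt]
    refine h2.congr_fderiv ?_
    ext v
    simp
    field_simp
  have h3 : HasGradientAt (fun y : E3 => - GG f ‖y‖) ((mm f ‖x‖ / (4*π*‖x‖^2)) • (‖x‖⁻¹ • x)) x := by
    rw [hasGradientAt_iff_hasFDerivAt] at hn ⊢
    have := ((h.GG_der hr).neg).comp_hasFDerivAt x hn
    rw [neg_neg] at this
    rw [map_smul]
    exact this
  unfold gradPhi
  rw [Filter.EventuallyEq.gradient_eq e]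
  exact h3.gradient

end NF



lemma ne_zero_ae : ∀ᵐ x : E3, x ≠ 0 := by simp [ae_iff]

lemma rad_sq {k : ℝ → ℝ} (hk : Measurable k) :
    ∫ x : E3, (k ‖x‖ / (4*π*‖x‖^2))^2 = (∫⁻ r in Ioi (0:ℝ), ENNReal.ofReal (k r^2 / (4*π*r^2))).toReal := by
  rw [integral_eq_lintegral_of_nonneg_ae (ae_of_all _ fun x => by positivity) (by
    exact (by fun_prop : Measurable fun x : E3 => (k ‖x‖ / (4*π*‖x‖^2))^2).aestronglyMeasurable)]
  rw [radial (fun t => ENNReal.ofReal ((k t / (4*π*t^2))^2)) (by fun_prop), ← lintegral_const_mul' _ _ ENNReal.ofReal_ne_top]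
  congr 1
  refine setLIntegral_congr_fun measurableSet_Ioi ?_
  intro t ht
  simp only [mem_Ioi] at ht
  simp only
  rw [← ENNReal.ofReal_mul (by positivity), ← ENNReal.ofReal_mul (by positivity)]
  congr 1; field_simp

lemma norm_unit {x : E3} (hx : x ≠ 0) (a : ℝ) : ‖a • (‖x‖⁻¹ • x)‖^2 = a^2 := by
  have : ‖x‖ ≠ 0 := norm_ne_zero_iff.2 hx
  rw [norm_smul, norm_smul, norm_inv, norm_norm, inv_mul_cancel₀ this, mul_one, Real.norm_eq_abs, sq_abs]

namespace NF
variable {f g : Phase → ℝ}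

lemma fieldSq_eq (h : NF f) : fieldSq f = (∫⁻ r in Ioi (0:ℝ), ENNReal.ofReal (mm f r^2 / (4*π*r^2))).toReal := by
  rw [← rad_sq h.mm_cont.measurable, fieldSq]
  refine integral_congr_ae ?_
  filter_upwards [ne_zero_ae] with x hx
  rw [h.grad_eq hx, norm_unit hx]

lemma fieldDist_eq (h : NF f) (hg : NF g) : fieldDist f g ^2 =
    (∫⁻ r in Ioi (0:ℝ), ENNReal.ofReal ((mm f r - mm g r)^2 / (4*π*r^2))).toReal := by
  rw [← rad_sq (k := fun r => mm f r - mm g r) (h.mm_cont.measurable.sub hg.mm_cont.measurable), fieldDist, Real.sq_sqrt (integral_nonneg fun x => by positivity)]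
  refine integral_congr_ae ?_
  filter_upwards [ne_zero_ae] with x hx
  rw [h.grad_eq hx, hg.grad_eq hx, ← sub_smul, norm_unit hx]
  ring

lemma sq_fin (h : NF f) : ∫⁻ r in Ioi (0:ℝ), ENNReal.ofReal (mm f r^2 / (4*π*r^2)) < ⊤ := by
  obtain ⟨C, hC, hb⟩ := h.mm_lin
  refine fin_sq hC fun r hr => ?_
  rw [abs_of_nonneg (mm_nonneg f r)]; exact hb r hr

lemma dist_fin (h : NF f) (hg : NF g) : ∫⁻ r in Ioi (0:ℝ), ENNReal.ofReal ((mm f r - mm g r)^2 / (4*π*r^2)) < ⊤ := by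
  obtain ⟨C, hC, hb⟩ := h.mm_lin
  obtain ⟨D, hD, hb'⟩ := hg.mm_lin
  refine fin_sq (k := fun r => mm f r - mm g r) (C := C + D) (by positivity) fun r hr => ?_
  have h1 := hb r hr
  have h2 := hb' r hr
  have h3 := mm_nonneg f r
  have h4 := mm_nonneg g r
  have h5 : 0 < C * r := by positivity
  have h6 : 0 < D * r := by positivity
  constructor <;> rw [abs_le] <;> constructor <;> nlinarith

lemma kin_eq (h : NF f) : kineticE f = (∫⁻ z : Phase, ENNReal.ofReal (‖z.2‖^2) * ENNReal.ofReal (f z)).toReal := by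
  have hm := h.meas
  rw [kineticE, integral_eq_lintegral_of_nonneg_ae (ae_of_all _ fun z => mul_nonneg (by positivity) (h.nn z))
    (by fun_prop : Measurable fun z : Phase => ‖z.2‖^2 * f z).aestronglyMeasurable]
  congr 2; ext z
  rw [ENNReal.ofReal_mul (by positivity)]

end NF



def pBf (f : Phase → ℝ) (w : ℝ × ℝ) (r : ℝ) : ℝ≥0∞ := ENNReal.ofReal (1/2) * ∫⁻ p, Zi f w (r, p)
def kBf (f : Phase → ℝ) (w : ℝ × ℝ) (r : ℝ) : ℝ≥0∞ := ENNReal.ofReal (1/2) * ∫⁻ p, ENNReal.ofReal (p^2) * Zi f w (r, p)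

lemma WW_pos : ∀ᵐ w ∂WW, 0 < w.1 ∧ 0 < w.2 := by
  have h1 : ∀ᵐ w ∂WW, 0 < w.1 := (Measure.quasiMeasurePreserving_fst (μ := LP) (ν := LP)).ae (ae_restrict_mem measurableSet_Ioi)
  have h2 : ∀ᵐ w ∂WW, 0 < w.2 := (Measure.quasiMeasurePreserving_snd (μ := LP) (ν := LP)).ae (ae_restrict_mem measurableSet_Ioi)
  filter_upwards [h1, h2] with w a b using ⟨a, b⟩

lemma M3_pos : ∀ᵐ q ∂M3, 0 < q.1 ∧ 0 < q.2.1 := by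
  have h1 : ∀ᵐ y ∂M2, 0 < y.1 := (Measure.quasiMeasurePreserving_fst (μ := LP) (ν := volume)).ae (ae_restrict_mem measurableSet_Ioi)
  have h2 : ∀ᵐ q ∂M3, 0 < q.2.1 := (Measure.quasiMeasurePreserving_snd (μ := LP) (ν := M2)).ae h1
  have h3 : ∀ᵐ q ∂M3, 0 < q.1 := (Measure.quasiMeasurePreserving_fst (μ := LP) (ν := M2)).ae (ae_restrict_mem measurableSet_Ioi)
  filter_upwards [h2, h3] with w a b using ⟨b, a⟩

lemma half_two' (a : ℝ≥0∞) : a = 2 * (ENNReal.ofReal (1/2) * a) := by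
  rw [← mul_assoc, show (2:ℝ≥0∞) = ENNReal.ofReal 2 by simp, ← ENNReal.ofReal_mul (by norm_num)]; norm_num


lemma Zi_meas3 {f : Phase → ℝ} (hf : Measurable f) : Measurable (fun q : ((ℝ × ℝ) × ℝ) × ℝ => Zi f q.1.1 (q.1.2, q.2)) := by
  have h1 : Measurable (fun q : ((ℝ × ℝ) × ℝ) × ℝ => ((q.1.1, (q.1.2, q.2)) : (ℝ × ℝ) × (ℝ × ℝ))) := by fun_prop
  exact (Zi_meas hf).comp h1

lemma pBf_meas2 {f : Phase → ℝ} (hf : Measurable f) : Measurable (fun q : (ℝ × ℝ) × ℝ => pBf f q.1 q.2) :=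
  (Measurable.lintegral_prod_right' (ν := volume) (Zi_meas3 hf)).const_mul _

lemma kBf_meas2 {f : Phase → ℝ} (hf : Measurable f) : Measurable (fun q : (ℝ × ℝ) × ℝ => kBf f q.1 q.2) := by
  have : Measurable (fun q : ((ℝ × ℝ) × ℝ) × ℝ => ENNReal.ofReal (q.2^2) * Zi f q.1.1 (q.1.2, q.2)) :=
    Measurable.mul (by fun_prop) (Zi_meas3 hf)
  exact (Measurable.lintegral_prod_right' (ν := volume) this).const_mul _

lemma pBf_meas {f : Phase → ℝ} (hf : Measurable f) (w : ℝ × ℝ) : Measurable (pBf f w) := (pBf_meas2 hf).comp (measurable_prodMk_left (x := w))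
lemma kBf_meas {f : Phase → ℝ} (hf : Measurable f) (w : ℝ × ℝ) : Measurable (kBf f w) := (kBf_meas2 hf).comp (measurable_prodMk_left (x := w))

lemma Zi_meas1 {f : Phase → ℝ} (hf : Measurable f) (w : ℝ × ℝ) (r : ℝ) : Measurable (fun p => Zi f w (r, p)) :=
  (Zi_meas3 hf).comp (measurable_prodMk_left (x := (w, r)))

/-- slice integral against a radial weight -/
lemma M2_slice {f : Phase → ℝ} (hf : Measurable f) (w : ℝ × ℝ) {c : ℝ → ℝ≥0∞} (hc : Measurable c) :
    ∫⁻ y, c y.1 * Zi f w y ∂M2 = 2 * ∫⁻ r in Ioi (0:ℝ), c r * pBf f w r := by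
  have hm : Measurable (fun y : ℝ × ℝ => c y.1 * Zi f w y) := (hc.comp measurable_fst).mul ((Zi_meas hf).comp (measurable_prodMk_left (x := w)))
  have hm2 : Measurable (fun r => c r * pBf f w r) := hc.mul (pBf_meas hf w)
  rw [lintegral_prod _ hm.aemeasurable, ← lintegral_const_mul _ hm2]
  congr 1; ext r
  change ∫⁻ p, c r * Zi f w (r, p) = _
  rw [lintegral_const_mul _ (Zi_meas1 hf w r), pBf, mul_left_comm, ← half_two']

lemma M2_slice_k {f : Phase → ℝ} (hf : Measurable f) (w : ℝ × ℝ) :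
    ∫⁻ y, ENNReal.ofReal (y.2^2) * Zi f w y ∂M2 = 2 * ∫⁻ r in Ioi (0:ℝ), kBf f w r := by
  have hm : Measurable (fun y : ℝ × ℝ => ENNReal.ofReal (y.2^2) * Zi f w y) := Measurable.mul (by fun_prop) ((Zi_meas hf).comp (measurable_prodMk_left (x := w)))
  rw [lintegral_prod _ hm.aemeasurable, ← lintegral_const_mul _ (kBf_meas hf w)]
  congr 1; ext r
  rw [kBf, ← half_two']

lemma bathtub {f : Phase → ℝ} (hf : Measurable f) (w : ℝ × ℝ) (r : ℝ) (q : ℝ) (hq : 0 ≤ q) :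
    ENNReal.ofReal (q^2) * pBf f w r ≤ kBf f w r + ENNReal.ofReal (2/3 * q^3) := by
  have h1 : ∀ p : ℝ, ENNReal.ofReal (q^2) * Zi f w (r, p) ≤ ENNReal.ofReal (p^2) * Zi f w (r, p) + (Ioc (-q) q).indicator (fun p => ENNReal.ofReal (q^2 - p^2)) p := by
    intro p
    unfold Zi
    split_ifs with h
    · simp only [mul_one]
      by_cases hp : p ∈ Ioc (-q) q
      · rw [indicator_of_mem hp, ← ENNReal.ofReal_add (by positivity) (by nlinarith [hp.1, hp.2])]
        exact ENNReal.ofReal_le_ofReal (by linarith)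
      · refine le_add_right (ENNReal.ofReal_le_ofReal ?_)
        by_contra hcon
        push Not at hcon
        have := abs_lt_of_sq_lt_sq hcon hq
        rw [abs_lt] at this
        exact hp ⟨this.1, this.2.le⟩
    · simp
  have h2 : ∫⁻ p in Ioc (-q) q, ENNReal.ofReal (q^2 - p^2) = ENNReal.ofReal (4/3*q^3) := by
    have hc : Continuous (fun p : ℝ => q^2 - p^2) := by fun_prop
    rw [← ofReal_integral_eq_lintegral_ofReal (hc.integrableOn_Ioc) (by
      filter_upwards [ae_restrict_mem measurableSet_Ioc] with p hp
      simp only [Pi.zero_apply]; nlinarith [hp.1, hp.2]), ← intervalIntegral.integral_of_le (by linarith)]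
    congr 1
    rw [intervalIntegral.integral_sub (by simp) ((continuous_pow 2).intervalIntegrable _ _)]
    simp; ring
  have h3 := lintegral_mono (μ := volume) h1
  have hmm : Measurable (fun p => ENNReal.ofReal (p^2) * Zi f w (r, p)) := Measurable.mul (by fun_prop) (Zi_meas1 hf w r)
  rw [lintegral_const_mul _ (Zi_meas1 hf w r), lintegral_add_left hmm, lintegral_indicator measurableSet_Ioc, h2] at h3
  unfold pBf kBf
  rw [mul_left_comm]
  calc _ ≤ ENNReal.ofReal (1/2) * _ := mul_le_mul_right h3 _
    _ = _ := by
      rw [mul_add, ← ENNReal.ofReal_mul (by norm_num)]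
      congr 2; ring

/-- radial moments -/
lemma n_layer {f : Phase → ℝ} (hf : Measurable f) {c : ℝ → ℝ≥0∞} (hc : Measurable c) :
    ∫⁻ t in Ioi (0:ℝ), c t * nL f t = ENNReal.ofReal (8*π^2) * ∫⁻ w, (∫⁻ r in Ioi (0:ℝ), c r * pBf f w r) ∂WW := by
  rw [← n_int hf hc, layer hf (c := fun q => c q.2.1) (hc.comp (by fun_prop))]
  simp only
  rw [lintegral_congr (fun w => M2_slice hf w hc), lintegral_const_mul' _ _ (by simp), ← mul_assoc]
  congr 1
  rw [show (2:ℝ≥0∞) = ENNReal.ofReal 2 by simp, ← ENNReal.ofReal_mul (by positivity)]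
  congr 1; ring

lemma kin_layer {f : Phase → ℝ} (hf : Measurable f) (hs : SphSym f) :
    ∫⁻ z : Phase, ENNReal.ofReal (‖z.2‖^2) * ENNReal.ofReal (f z) =
      ENNReal.ofReal (8*π^2) * ∫⁻ w, ((∫⁻ r in Ioi (0:ℝ), kBf f w r) + ENNReal.ofReal w.2 * ∫⁻ r in Ioi (0:ℝ), ENNReal.ofReal (1/r^2) * pBf f w r) ∂WW := by
  rw [phase_int (G := fun z => ENNReal.ofReal (‖z.2‖^2) * ENNReal.ofReal (f z)) (by fun_prop)]
  · have e1 : ∫⁻ q, ENNReal.ofReal (‖(ptq q).2‖^2) * ENNReal.ofReal (f (ptq q)) ∂M3 = ∫⁻ q, (ENNReal.ofReal (q.2.2^2) + ENNReal.ofReal q.1 * ENNReal.ofReal (1/q.2.1^2)) * ENNReal.ofReal (f (ptq q)) ∂M3 := by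
      refine lintegral_congr_ae ?_
      filter_upwards [M3_pos] with q hq
      rw [pt_norm2 _ _ hq.1.le, ENNReal.ofReal_add (by positivity) (div_nonneg hq.1.le (by positivity)), ← ENNReal.ofReal_mul hq.1.le]
      congr 3
      rw [mul_one_div]
    rw [e1, layer hf (c := fun q => ENNReal.ofReal (q.2.2^2) + ENNReal.ofReal q.1 * ENNReal.ofReal (1/q.2.1^2)) (by fun_prop)]
    have e2 : ∀ w : ℝ × ℝ, ∫⁻ y, (ENNReal.ofReal (y.2^2) + ENNReal.ofReal w.2 * ENNReal.ofReal (1/y.1^2)) * Zi f w y ∂M2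
        = 2 * ((∫⁻ r in Ioi (0:ℝ), kBf f w r) + ENNReal.ofReal w.2 * ∫⁻ r in Ioi (0:ℝ), ENNReal.ofReal (1/r^2) * pBf f w r) := by
      intro w
      simp only [add_mul, mul_assoc]
      have hz : Measurable (fun y => Zi f w y) := (Zi_meas hf).comp (measurable_prodMk_left (x := w))
      have hz2 : Measurable (fun y : ℝ × ℝ => ENNReal.ofReal (y.2^2) * Zi f w y) := Measurable.mul (by fun_prop) hz
      rw [lintegral_add_left hz2, M2_slice_k hf, lintegral_const_mul' _ _ ENNReal.ofReal_ne_top,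
        M2_slice hf w (c := fun r => ENNReal.ofReal (1/r^2)) (by fun_prop), mul_add, mul_left_comm]
    simp only
    rw [lintegral_congr e2, lintegral_const_mul' _ _ (by simp), ← mul_assoc]
    congr 1
    rw [show (2:ℝ≥0∞) = ENNReal.ofReal 2 by simp, ← ENNReal.ofReal_mul (by positivity)]
    congr 1; ring
  · intro x v x' v' h1 h2 h3
    simp only; rw [h2, sph_inv hs h1 h2 h3]




lemma F_anti {Q : Phase → ℝ} {F : ℝ → ℝ → ℝ} {e₀ : ℝ} (hQ : AssumptionA Q F e₀) {l : ℝ} (hl : 0 ≤ l) :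
    Continuous (fun e => F e l) ∧ Antitone (fun e => F e l) := by
  have hc : Continuous (fun e => F e l) := by
    have : Continuous (fun e : ℝ => ((e, l) : ℝ × ℝ)) := by fun_prop
    exact hQ.Fcont.comp_continuous this (fun e => hl)
  refine ⟨hc, fun e2 e1 h12 => ?_⟩
  by_contra hcon
  simp only [not_le] at hcon
  set S := {e | e ∈ Icc e2 e1 ∧ F e l ≤ F e2 l}
  have hSc : IsClosed S := isClosed_Icc.inter (isClosed_le hc continuous_const)
  have hne : S.Nonempty := ⟨e2, ⟨le_rfl, h12⟩, le_rfl⟩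
  have hb : BddAbove S := ⟨e1, fun x hx => hx.1.2⟩
  have ha := hSc.csSup_mem hne hb
  set a := sSup S
  have hlt : a < e1 := lt_of_le_of_ne ha.1.2 (fun h => by have := ha.2; rw [h] at this; linarith)
  have hgt : ∀ e ∈ Ioc a e1, F e2 l < F e l := by
    intro e he
    by_contra h
    have : e ≤ a := le_csSup hb ⟨⟨ha.1.1.trans he.1.le, he.2⟩, not_lt.mp h⟩
    linarith [he.1]
  have := strictAntiOn_of_deriv_neg (convex_Icc a e1) hc.continuousOn (fun e he => by
    rw [interior_Icc] at he
    exact hQ.FeNeg e l hl ((hQ.Fnonneg _ _ hl).trans_lt (hgt e ⟨he.1, he.2.le⟩))) ⟨le_rfl, hlt.le⟩ ⟨hlt.le, le_rfl⟩ hlt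
  simp only at this
  linarith [ha.2]

lemma F_level {Q : Phase → ℝ} {F : ℝ → ℝ → ℝ} {e₀ : ℝ} (hQ : AssumptionA Q F e₀) {l s : ℝ} (hl : 0 ≤ l) (hs : 0 < s) :
    (∀ e, ¬ s < F e l) ∨ ∃ e1 < 0, ∀ e, s < F e l ↔ e < e1 := by
  obtain ⟨hc, ha⟩ := F_anti hQ hl
  by_cases hne : ∃ e, s < F e l
  · right
    have hb : BddAbove {e | s < F e l} := ⟨e₀, fun e he => (hQ.Fsupp e l hl (hs.trans he)).le⟩
    refine ⟨sSup {e | s < F e l}, (csSup_le hne fun e he => (hQ.Fsupp e l hl (hs.trans he)).le).trans_lt hQ.e₀neg, fun e => ⟨fun h => ?_, fun h => ?_⟩⟩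
    · have ho : IsOpen {e | s < F e l} := isOpen_lt continuous_const hc
      have hev : ∀ᶠ x in 𝓝[>] e, s < F x l := mem_nhdsWithin_of_mem_nhds (ho.mem_nhds h)
      obtain ⟨e', h1, h2⟩ := (hev.and (self_mem_nhdsWithin (s := Ioi e))).exists
      exact lt_of_lt_of_le h2 (le_csSup hb h1)
    · obtain ⟨e', h1, h2⟩ := exists_lt_of_lt_csSup hne h
      exact lt_of_lt_of_le h1 (ha h2.le)
  · left; push Not at hne; simpa using hne

lemma Q_NF {Q : Phase → ℝ} {F : ℝ → ℝ → ℝ} {e₀ : ℝ} (hQ : AssumptionA Q F e₀) : NF Q :=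
  NF_cpt hQ.contQ hQ.nonneg hQ.cpt hQ.sph

lemma Q_bdd {Q : Phase → ℝ} {F : ℝ → ℝ → ℝ} {e₀ : ℝ} (hQ : AssumptionA Q F e₀) :
    ∃ R : ℝ, 0 < R ∧ ∀ z, Q z ≤ R ∧ (Q z ≠ 0 → ‖z.1‖ ≤ R ∧ ‖z.2‖ ≤ R) := by
  obtain ⟨C, hC⟩ := hQ.cpt.isCompact.isBounded.exists_norm_le
  obtain ⟨D, hD⟩ := hQ.cpt.exists_bound_of_continuous hQ.contQ
  refine ⟨max (max C D) 1, by positivity, fun z => ⟨((le_abs_self _).trans (hD z)).trans ((le_max_right _ _).trans (le_max_left _ _)), fun h => ?_⟩⟩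
  have := hC z (subset_closure h)
  exact ⟨((norm_fst_le z).trans this).trans ((le_max_left _ _).trans (le_max_left _ _)), ((norm_snd_le z).trans this).trans ((le_max_left _ _).trans (le_max_left _ _))⟩

lemma Q_mic {Q : Phase → ℝ} (h : NF Q) {r : ℝ} (hr : 0 < r) (p : ℝ) {l : ℝ} (hl : 0 ≤ l) :
    microE Q (pt r p l) = p^2/2 + l/(2*r^2) - NF.GG Q r := by
  have h1 : ‖(pt r p l).1‖ = r := pt_norm1 hr p l
  unfold microE
  rw [pt_norm2 r p hl, h.phi_eq (by rw [← norm_pos_iff, h1]; exact hr), h1, NF.GG]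
  field_simp; ring

/-- structure of the superlevel sets of `Q` -/
lemma Q_level {Q : Phase → ℝ} {F : ℝ → ℝ → ℝ} {e₀ : ℝ} (hQ : AssumptionA Q F e₀) {w : ℝ × ℝ} (hw : 0 < w.1 ∧ 0 < w.2) :
    (∀ r > 0, ∀ p, Zi Q w (r, p) = 0) ∨ ∃ e1 < 0, ∀ r > 0, ∀ p, Zi Q w (r, p) = if p^2/2 + w.2/(2*r^2) - NF.GG Q r < e1 then 1 else 0 := by
  have key : ∀ r > 0, ∀ p, Q (pt r p w.2) = F (p^2/2 + w.2/(2*r^2) - NF.GG Q r) w.2 := by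
    intro r hr p
    rw [hQ.eqF, Q_mic (Q_NF hQ) hr p hw.2.le, pt_ell hr p hw.2.le]
  rcases F_level hQ hw.2.le hw.1 with h | ⟨e1, he, h⟩
  · left; intro r hr p
    unfold Zi; simp only; rw [key r hr, if_neg (h _)]
  · right; refine ⟨e1, he, fun r hr p => ?_⟩
    unfold Zi; simp only; rw [key r hr, if_congr (h _) rfl rfl]

lemma sqrt3 (x : ℝ) : √x ^ 3 = x ^ (3/2:ℝ) := by
  rcases le_or_gt 0 x with h | h
  · rw [Real.sqrt_eq_rpow, ← Real.rpow_mul_natCast h]; norm_num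
  · rw [Real.sqrt_eq_zero_of_nonpos h.le, Real.rpow_def_of_neg h, show (3/2:ℝ)*π = π/2 + π by ring, Real.cos_add_pi, Real.cos_pi_div_two]; simp

lemma sqrt3_der (x : ℝ) : HasDerivAt (fun x => √x ^ 3) (3/2*√x) x := by
  have := Real.hasDerivAt_rpow_const (x := x) (p := 3/2) (Or.inr (by norm_num))
  rw [show (3/2:ℝ) - 1 = 1/2 by norm_num, ← Real.sqrt_eq_rpow] at this
  exact this.congr_of_eventuallyEq (Eventually.of_forall sqrt3)

/-- half-width of the superlevel set -/
def Pq (Q : Phase → ℝ) (w : ℝ × ℝ) (r : ℝ) : ℝ := if 0 < r then (pBf Q w r).toReal else 0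

lemma half_int {Z : ℝ → ℝ≥0∞} {P : ℝ} (hP : 0 ≤ P) (hZ : ∀ p, Z p = if |p| < P then 1 else 0) :
    ENNReal.ofReal (1/2) * ∫⁻ p, Z p = ENNReal.ofReal P ∧ ENNReal.ofReal (1/2) * ∫⁻ p, ENNReal.ofReal (p^2) * Z p = ENNReal.ofReal (P^3/3) := by
  have e1 : Z = (Ioo (-P) P).indicator 1 := by
    ext p; rw [hZ p, indicator_apply]; simp only [mem_Ioo, abs_lt, Pi.one_apply]
  constructor
  · rw [e1, lintegral_indicator_one measurableSet_Ioo, Real.volume_Ioo, ← ENNReal.ofReal_mul (by norm_num)]; congr 1; ring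
  · have e2 : (fun p => ENNReal.ofReal (p^2) * Z p) = (Ioo (-P) P).indicator (fun p => ENNReal.ofReal (p^2)) := by
      ext p; rw [e1]; by_cases h : p ∈ Ioo (-P) P <;> simp [h]
    rw [e2, lintegral_indicator measurableSet_Ioo, restrict_Ioo_eq_restrict_Ioc]
    rw [← ofReal_integral_eq_lintegral_ofReal ((continuous_pow 2).integrableOn_Ioc) (Eventually.of_forall fun p => by positivity), ← intervalIntegral.integral_of_le (by linarith), ← ENNReal.ofReal_mul (by norm_num)]
    congr 1; simp; ring

structure PS (Q : Phase → ℝ) (R : ℝ) (w : ℝ × ℝ) (e1 : ℝ) : Prop where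
  Z : ∀ r > 0, ∀ p, Zi Q w (r, p) = if |p| < Pq Q w r then 1 else 0
  p : ∀ r > 0, pBf Q w r = ENNReal.ofReal (Pq Q w r)
  k : ∀ r > 0, kBf Q w r = ENNReal.ofReal (Pq Q w r ^3/3)
  V : ∀ r, Pq Q w r ≠ 0 → 0 < r ∧ r ≤ R ∧ w.1 < R ∧ Pq Q w r ^2 + w.2/r^2 ≤ R^2
  f : (∀ r > 0, Pq Q w r = 0) ∨ (∀ r > 0, Pq Q w r = √(2*(e1 - (w.2/(2*r^2) - NF.GG Q r))))

lemma Q_PS {Q : Phase → ℝ} {F : ℝ → ℝ → ℝ} {e₀ : ℝ} (hQ : AssumptionA Q F e₀) {R : ℝ} (hR : 0 < R)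
    (hRQ : ∀ z, Q z ≤ R ∧ (Q z ≠ 0 → ‖z.1‖ ≤ R ∧ ‖z.2‖ ≤ R)) {w : ℝ × ℝ} (hw : 0 < w.1 ∧ 0 < w.2) :
    ∃ e1 < 0, PS Q R w e1 := by
  have main : ∃ e1 < 0, ∃ P : ℝ → ℝ, (∀ r, 0 ≤ P r) ∧ (∀ r > 0, ∀ p, Zi Q w (r, p) = if |p| < P r then 1 else 0) ∧ 
     ((∀ r > 0, P r = 0) ∨ (∀ r > 0, P r = √(2*(e1 - (w.2/(2*r^2) - NF.GG Q r))))) := by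
    rcases Q_level hQ hw with h | ⟨e1, he, h⟩
    · refine ⟨-1, by norm_num, fun _ => 0, fun _ => le_rfl, fun r hr p => ?_, Or.inl fun _ _ => rfl⟩
      rw [h r hr, if_neg (by simp)]
    · refine ⟨e1, he, _, fun r => Real.sqrt_nonneg _, fun r hr p => ?_, Or.inr fun r hr => rfl⟩
      rw [h r hr p]
      refine if_congr ?_ rfl rfl
      rw [Real.lt_sqrt (abs_nonneg p), sq_abs]
      constructor <;> intro h <;> linarith
  obtain ⟨e1, he, P, hP0, hZ, hf⟩ := main
  have hp : ∀ r > 0, Pq Q w r = P r := by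
    intro r hr
    rw [Pq, if_pos hr, pBf, (half_int (hP0 r) (hZ r hr)).1, ENNReal.toReal_ofReal (hP0 r)]
  refine ⟨e1, he, fun r hr p => by rw [hZ r hr, hp r hr], fun r hr => ?_, fun r hr => ?_, fun r hr => ?_, ?_⟩
  · rw [hp r hr]; exact (half_int (hP0 r) (hZ r hr)).1
  · rw [hp r hr]; exact (half_int (hP0 r) (hZ r hr)).2
  · have hr0 : 0 < r := by by_contra h; simp [Pq, h] at hr
    rw [hp r hr0] at hr ⊢
    have hPp : 0 < P r := lt_of_le_of_ne (hP0 r) hr.symm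
    have hz : ∀ p, |p| < P r → w.1 < Q (pt r p w.2) := by
      intro p hpp
      have := hZ r hr0 p
      rw [if_pos hpp] at this
      by_contra hcon
      simp [Zi, hcon] at this
    have h0 := hz 0 (by simpa using hPp)
    have hq := hRQ (pt r 0 w.2)
    have hq1 := (hq.2 (by linarith [hw.1])).1
    rw [pt_norm1 hr0] at hq1
    refine ⟨hr0, hq1, by linarith, ?_⟩
    have hb : ∀ p ∈ Ioo 0 (P r), p^2 + w.2/r^2 ≤ R^2 := by
      intro p hpp
      have h1 := (hRQ (pt r p w.2)).2 (by linarith [hz p (by rw [abs_of_pos hpp.1]; exact hpp.2), hw.1])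
      have h2 := pt_norm2 r p hw.2.le
      rw [← h2]; gcongr; exact h1.2
    have hcl : IsClosed {p : ℝ | p^2 + w.2/r^2 ≤ R^2} := isClosed_le (by fun_prop) continuous_const
    have := (closure_minimal (s := Ioo 0 (P r)) hb hcl)
    rw [closure_Ioo hPp.ne] at this
    exact this ⟨hPp.le, le_rfl⟩
  · rcases hf with h | h
    · left; intro r hr; rw [hp r hr, h r hr]
    · right; intro r hr; rw [hp r hr, h r hr]

lemma Pq_nonneg (Q : Phase → ℝ) (w : ℝ × ℝ) (r : ℝ) : 0 ≤ Pq Q w r := by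
  unfold Pq; split_ifs <;> simp

lemma PS.sup {Q : Phase → ℝ} {R e1 : ℝ} {w : ℝ × ℝ} (h : PS Q R w e1) (hR : 0 < R) (hw : 0 < w.2) :
    ∀ r ∉ Icc (√w.2/R) (max R (√w.2/R)), Pq Q w r = 0 := by
  intro r hr
  by_contra hcon
  obtain ⟨h1, h2, h3, h4⟩ := h.V r hcon
  refine hr ⟨?_, h2.trans (le_max_left _ _)⟩
  rw [div_le_iff₀ hR]
  refine Real.sqrt_le_iff.mpr ⟨by positivity, ?_⟩
  have : w.2/r^2 ≤ R^2 := by nlinarith [sq_nonneg (Pq Q w r)]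
  rw [div_le_iff₀ (by positivity)] at this
  linarith [mul_pow r R 2]

lemma PS.cont {Q : Phase → ℝ} {R e1 : ℝ} {w : ℝ × ℝ} (h : PS Q R w e1) (hR : 0 < R) (hw : 0 < w.2) (hQ : NF Q) :
    Continuous (Pq Q w) := by
  have ha : 0 < √w.2/R := by positivity
  rw [continuous_iff_continuousAt]
  intro r
  rcases lt_or_ge r (√w.2/R) with h1 | h1
  · have : Pq Q w =ᶠ[𝓝 r] fun _ => 0 := by
      filter_upwards [Iio_mem_nhds h1] with y hy
      exact h.sup hR hw y (fun hc => absurd hc.1 (not_le.mpr hy))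
    exact continuousAt_const.congr this.symm
  · have hr : 0 < r := ha.trans_le h1
    rcases h.f with h2 | h2
    · have : Pq Q w =ᶠ[𝓝 r] fun _ => 0 := by
        filter_upwards [Ioi_mem_nhds hr] with y hy using h2 y hy
      exact continuousAt_const.congr this.symm
    · have : Pq Q w =ᶠ[𝓝 r] fun r => √(2*(e1 - (w.2/(2*r^2) - NF.GG Q r))) := by
        filter_upwards [Ioi_mem_nhds hr] with y hy using h2 y hy
      refine ContinuousAt.congr ?_ this.symm
      have hg := (hQ.GG_der hr).continuousAt
      have : ContinuousAt (fun r : ℝ => w.2/(2*r^2)) r := ContinuousAt.div (by fun_prop) (by fun_prop) (by positivity)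
      exact Real.continuous_sqrt.continuousAt.comp (by fun_prop)

lemma PS.der {Q : Phase → ℝ} {R e1 : ℝ} {w : ℝ × ℝ} (h : PS Q R w e1) (hQ : NF Q) {r : ℝ} (hr : 0 < r) :
    HasDerivAt (fun r => r^2 * Pq Q w r ^3) (Pq Q w r * (2*r*Pq Q w r^2 - 3*(mm Q r/(4*π) - w.2/r))) r := by
  rcases h.f with h2 | h2
  · have : (fun r => r^2 * Pq Q w r ^3) =ᶠ[𝓝 r] fun _ => 0 := by
      filter_upwards [Ioi_mem_nhds hr] with y hy
      rw [h2 y hy]; simp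
    rw [h2 r hr, zero_mul]
    exact (hasDerivAt_const r (0:ℝ)).congr_of_eventuallyEq this
  · have : (fun r => r^2 * Pq Q w r ^3) =ᶠ[𝓝 r] fun r => r^2 * √(2*(e1 - (w.2/(2*r^2) - NF.GG Q r)))^3 := by
      filter_upwards [Ioi_mem_nhds hr] with y hy
      rw [h2 y hy]
    refine HasDerivAt.congr_of_eventuallyEq ?_ this
    have d1 : HasDerivAt (fun r : ℝ => w.2/(2*r^2)) (-(w.2/r^3)) r := by
      have := (hasDerivAt_const r w.2).div (((hasDerivAt_pow 2 r).const_mul 2)) (by positivity)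
      refine this.congr_deriv ?_
      push_cast; field_simp; ring
    have d2 := ((d1.sub (hQ.GG_der hr)).const_sub e1).const_mul 2
    have d3 := (hasDerivAt_pow 2 r).mul ((sqrt3_der _).comp r d2)
    refine d3.congr_deriv ?_
    rw [h2 r hr]
    simp only [Function.comp_apply, Pi.sub_apply]
    set S := √(2*(e1 - (w.2/(2*r^2) - NF.GG Q r)))
    push_cast; field_simp; ring

lemma mkOM {Q f : Phase → ℝ} {R e1 : ℝ} {w : ℝ × ℝ} (h : PS Q R w e1) (hR : 0 < R) (hw : 0 < w.2) (hQ : NF Q) (hf : Measurable f)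
    (hm : ∫⁻ r in Ioi (0:ℝ), pBf f w r = ∫⁻ r in Ioi (0:ℝ), pBf Q w r)
    (h2 : ∫⁻ r in Ioi (0:ℝ), ENNReal.ofReal (1/r^2) * pBf f w r < ⊤) :
    OM (Pq Q w) (mm Q) w.2 (√w.2/R) (max R (√w.2/R)) (pBf f w) (kBf f w) where
  Pc := h.cont hR hw hQ
  P0 := Pq_nonneg Q w
  ha0 := by positivity
  hb0 := le_max_right _ _
  Ps := h.sup hR hw
  hl := hw
  mmono := hQ.mm_mono
  mc := hQ.mm_cont
  m0 := NF.mm_nonneg Q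
  hN := fun r hr => h.der hQ hr
  pBm := pBf_meas hf w
  hmass := by rw [hm]; exact setLIntegral_congr_fun measurableSet_Ioi (fun r hr => h.p r hr)
  pB2 := h2
  hk := fun r _ q hq => bathtub hf w r q hq



structure Cx (Q f : Phase → ℝ) (R : ℝ) : Prop where
  hQ : NF Q
  hf : NF f
  hR : 0 < R
  ps : ∀ w : ℝ × ℝ, 0 < w.1 ∧ 0 < w.2 → ∃ e1 < 0, PS Q R w e1
  mass : ∀ᵐ w ∂WW, ∫⁻ r in Ioi (0:ℝ), pBf f w r = ∫⁻ r in Ioi (0:ℝ), pBf Q w r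
  om : ∀ᵐ w ∂WW, OM (Pq Q w) (mm Q) w.2 (√w.2/R) (max R (√w.2/R)) (pBf f w) (kBf f w)

lemma mass_meas {f : Phase → ℝ} (hf : Measurable f) : Measurable (fun w => ∫⁻ r in Ioi (0:ℝ), pBf f w r) :=
  Measurable.lintegral_prod_right' (ν := LP) (pBf_meas2 hf)

lemma EqMeas.mass {Q f : Phase → ℝ} (hQ : Measurable Q) (hf : Measurable f) (h : EqMeas Q f) :
    ∀ᵐ w ∂WW, ∫⁻ r in Ioi (0:ℝ), pBf f w r = ∫⁻ r in Ioi (0:ℝ), pBf Q w r := by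
  refine (Measure.ae_prod_iff_ae_ae (measurableSet_eq_fun (mass_meas hf) (mass_meas hQ))).mpr ?_
  filter_upwards [ae_restrict_mem measurableSet_Ioi] with s hs
  filter_upwards [h.2.2 s hs, ae_restrict_mem measurableSet_Ioi] with l hl hl0
  rw [mu_eq hf s hl0, mu_eq hQ s hl0] at hl
  have e : ∀ {g : Phase → ℝ}, Measurable g → ∫⁻ y, Zi g (s,l) y ∂M2 = 2 * ∫⁻ r in Ioi (0:ℝ), pBf g (s,l) r := by
    intro g hg
    have := M2_slice hg (s,l) (c := fun _ => 1) measurable_const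
    simpa using this
  rw [e hf, e hQ] at hl
  have hpi : (0:ℝ) < 4*π^2 := by positivity
  rw [ENNReal.mul_right_inj (by simp) ENNReal.ofReal_ne_top, ENNReal.mul_right_inj (by simp) (by simp)] at hl
  exact hl

lemma mkCx {Q f : Phase → ℝ} {F : ℝ → ℝ → ℝ} {e₀ : ℝ} (hQ : AssumptionA Q F e₀) {R : ℝ} (hR : 0 < R)
    (hRQ : ∀ z, Q z ≤ R ∧ (Q z ≠ 0 → ‖z.1‖ ≤ R ∧ ‖z.2‖ ≤ R)) (hf : NF f) (h : EqMeas Q f) : Cx Q f R := by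
  have hm := h.mass (Q_NF hQ).meas hf.meas
  refine ⟨Q_NF hQ, hf, hR, fun w hw => Q_PS hQ hR hRQ hw, hm, ?_⟩
  have hk := hf.kin
  rw [kin_layer hf.meas hf.sym] at hk
  have hpi : (0:ℝ) < 8*π^2 := by positivity
  have hk2 : ∫⁻ w, ((∫⁻ r in Ioi (0:ℝ), kBf f w r) + ENNReal.ofReal w.2 * ∫⁻ r in Ioi (0:ℝ), ENNReal.ofReal (1/r^2) * pBf f w r) ∂WW ≠ ⊤ := by
    intro hc
    rw [hc, ENNReal.mul_top (by simp)] at hk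
    exact lt_irrefl _ hk
  have hmk : Measurable (fun w => (∫⁻ r in Ioi (0:ℝ), kBf f w r) + ENNReal.ofReal w.2 * ∫⁻ r in Ioi (0:ℝ), ENNReal.ofReal (1/r^2) * pBf f w r) := by
    refine Measurable.add (Measurable.lintegral_prod_right' (ν := LP) (kBf_meas2 hf.meas)) (Measurable.mul (by fun_prop) ?_)
    have : Measurable (fun q : (ℝ × ℝ) × ℝ => ENNReal.ofReal (1/q.2^2) * pBf f q.1 q.2) := Measurable.mul (by fun_prop) (pBf_meas2 hf.meas)
    exact Measurable.lintegral_prod_right' (ν := LP) this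
  filter_upwards [WW_pos, hm, ae_lt_top hmk hk2] with w hw h1 h2
  obtain ⟨e1, _, hps⟩ := Q_PS hQ hR hRQ hw
  refine mkOM hps hR hw.2 (Q_NF hQ) hf.meas h1 ?_
  have h3 := (le_add_left le_rfl).trans_lt h2
  by_contra hc
  rw [not_lt_top_iff.mp hc, ENNReal.mul_top (by simpa using hw.2)] at h3
  exact lt_irrefl _ h3

lemma Pq_meas2 {Q : Phase → ℝ} (hQ : Measurable Q) : Measurable (fun q : (ℝ × ℝ) × ℝ => Pq Q q.1 q.2) := by
  refine Measurable.ite (measurableSet_lt measurable_const measurable_snd) ?_ measurable_const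
  exact (pBf_meas2 hQ).ennreal_toReal

lemma AB_measl {f : Phase → ℝ} (hf : Measurable f) : Measurable (fun q : (ℝ × ℝ) × ℝ => ∫⁻ t in Ioc 0 q.2, pBf f q.1 t) := by
  have : Measurable (fun q : ((ℝ × ℝ) × ℝ) × ℝ => ({q : ((ℝ × ℝ) × ℝ) × ℝ | 0 < q.2 ∧ q.2 ≤ q.1.2}).indicator (fun q => pBf f q.1.1 q.2) q) := by
    refine Measurable.indicator ?_ ?_
    · exact (pBf_meas2 hf).comp (by fun_prop : Measurable (fun q : ((ℝ × ℝ) × ℝ) × ℝ => (q.1.1, q.2)))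
    · have m1 : Measurable (fun q : ((ℝ × ℝ) × ℝ) × ℝ => q.1.2) := by fun_prop
      exact (measurableSet_lt measurable_const measurable_snd).inter (measurableSet_le measurable_snd m1)
  have h2 := Measurable.lintegral_prod_right' (ν := volume) this
  convert h2 using 2 with q
  rw [← lintegral_indicator measurableSet_Ioc]
  rfl

lemma AB_meas2 {f : Phase → ℝ} (hf : Measurable f) : Measurable (fun q : (ℝ × ℝ) × ℝ => AB (pBf f q.1) q.2) :=
  (AB_measl hf).ennreal_toReal

/-- mass and half-widths -/
lemma mass_layer {f : Phase → ℝ} (h : NF f) (r : ℝ) :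
    ENNReal.ofReal (mm f r) = ENNReal.ofReal (8*π^2) * ∫⁻ w, (∫⁻ t in Ioc 0 r, pBf f w t) ∂WW := by
  have hc : Measurable ((Iic r).indicator (1 : ℝ → ℝ≥0∞)) := measurable_one.indicator measurableSet_Iic
  have e : ∀ g : ℝ → ℝ≥0∞, ∫⁻ t in Ioi (0:ℝ), (Iic r).indicator (1 : ℝ → ℝ≥0∞) t * g t = ∫⁻ t in Ioc 0 r, g t := by
    intro g
    have : ∀ t, (Iic r).indicator (1 : ℝ → ℝ≥0∞) t * g t = (Iic r).indicator g t := by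
      intro t; by_cases ht : t ∈ Iic r <;> simp [indicator, ht]
    rw [lintegral_congr this, lintegral_indicator measurableSet_Iic, Measure.restrict_restrict measurableSet_Iic, Iic_inter_Ioi]
  have := n_layer h.meas hc
  rw [e] at this
  rw [h.of_mm, mL, this]
  simp only [e]

lemma Cx.AS {Q f : Phase → ℝ} {R : ℝ} (h : Cx Q f R) {w : ℝ × ℝ} (hw : 0 < w.1 ∧ 0 < w.2) (hom : OM (Pq Q w) (mm Q) w.2 (√w.2/R) (max R (√w.2/R)) (pBf f w) (kBf f w))
    {x : ℝ} (hx : 0 ≤ x) : ENNReal.ofReal (AS (Pq Q w) x) = ∫⁻ t in Ioc 0 x, pBf Q w t := by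
  obtain ⟨e1, _, hps⟩ := h.ps w hw
  rw [hom.AS_eq_l _ hx]
  exact setLIntegral_congr_fun measurableSet_Ioc (fun r hr => (hps.p r hr.1).symm)

/-- moments of `Q` in terms of `Pq` -/
lemma Cx.n_P {Q f : Phase → ℝ} {R : ℝ} (h : Cx Q f R) {c : ℝ → ℝ≥0∞} (hc : Measurable c) :
    ENNReal.ofReal (8*π^2) * ∫⁻ w, (∫⁻ r in Ioi (0:ℝ), c r * ENNReal.ofReal (Pq Q w r)) ∂WW = ∫⁻ t in Ioi (0:ℝ), c t * nL Q t := by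
  rw [n_layer h.hQ.meas hc]
  congr 1
  refine lintegral_congr_ae ?_
  filter_upwards [WW_pos] with w hw
  obtain ⟨e1, _, hps⟩ := h.ps w hw
  exact setLIntegral_congr_fun measurableSet_Ioi (fun r hr => by rw [hps.p r hr])



def JJ (Q f : Phase → ℝ) : Set (((ℝ × ℝ) × ℝ) × ℝ) :=
  {q | 0 < q.2 ∧ ((q.1.2 < q.2 ∧ AB (pBf Q q.1.1) q.2 < AB (pBf f q.1.1) q.1.2) ∨ (q.2 < q.1.2 ∧ AB (pBf f q.1.1) q.1.2 ≤ AB (pBf Q q.1.1) q.2))}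

lemma JJ_meas {Q f : Phase → ℝ} (hQ : Measurable Q) (hf : Measurable f) : MeasurableSet (JJ Q f) := by
  have m1 : Measurable (fun q : ((ℝ × ℝ) × ℝ) × ℝ => AB (pBf Q q.1.1) q.2) :=
    (AB_meas2 hQ).comp (by fun_prop : Measurable (fun q : ((ℝ × ℝ) × ℝ) × ℝ => (q.1.1, q.2)))
  have m2 : Measurable (fun q : ((ℝ × ℝ) × ℝ) × ℝ => AB (pBf f q.1.1) q.1.2) := (AB_meas2 hf).comp measurable_fst
  have m3 : Measurable (fun q : ((ℝ × ℝ) × ℝ) × ℝ => q.1.2) := by fun_prop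
  exact (measurableSet_lt measurable_const measurable_snd).inter
    (((measurableSet_lt m3 measurable_snd).inter (measurableSet_lt m1 m2)).union ((measurableSet_lt measurable_snd m3).inter (measurableSet_le m2 m1)))

def ccM (Q f : Phase → ℝ) (q : (ℝ × ℝ) × ℝ) : ℝ≥0∞ :=
  ∫⁻ y, (JJ Q f).indicator (fun q => ENNReal.ofReal (|KK (Pq Q q.1.1) (mm Q) q.1.1.2 q.2 q.1.2| * Pq Q q.1.1 q.2)) (q, y)

lemma ccM_meas {Q f : Phase → ℝ} (hQ : NF Q) (hf : Measurable f) : Measurable (ccM Q f) := by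
  refine Measurable.lintegral_prod_right' (ν := volume) (Measurable.indicator ?_ (JJ_meas hQ.meas hf))
  have m1 : Measurable (fun q : ((ℝ × ℝ) × ℝ) × ℝ => Pq Q q.1.1 q.2) :=
    (Pq_meas2 hQ.meas).comp (by fun_prop : Measurable (fun q : ((ℝ × ℝ) × ℝ) × ℝ => (q.1.1, q.2)))
  have m2 : Measurable (mm Q) := hQ.mm_mono.measurable
  have m3 : Measurable (fun q : ((ℝ × ℝ) × ℝ) × ℝ => KK (Pq Q q.1.1) (mm Q) q.1.1.2 q.2 q.1.2) := by
    unfold KK; fun_prop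
  have m4 : Measurable (fun q : ((ℝ × ℝ) × ℝ) × ℝ => |KK (Pq Q q.1.1) (mm Q) q.1.1.2 q.2 q.1.2|) := measurable_norm.comp m3
  exact (m4.mul m1).ennreal_ofReal

section
variable {Q f : Phase → ℝ} {R : ℝ}

abbrev OMw (Q f : Phase → ℝ) (R : ℝ) (w : ℝ × ℝ) : Prop := OM (Pq Q w) (mm Q) w.2 (√w.2/R) (max R (√w.2/R)) (pBf f w) (kBf f w)

lemma Cx.AS_AB (h : Cx Q f R) {w : ℝ × ℝ} (hw : 0 < w.1 ∧ 0 < w.2) (hom : OMw Q f R w) {x : ℝ} (hx : 0 ≤ x) :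
    _root_.AS (Pq Q w) x = AB (pBf Q w) x := by
  rw [AB, ← h.AS hw hom hx, ENNReal.toReal_ofReal (hom.AS_nonneg x hx)]

lemma Cx.cc_eq (h : Cx Q f R) {w : ℝ × ℝ} (hw : 0 < w.1 ∧ 0 < w.2) (hom : OMw Q f R w) (r : ℝ) :
    cc (Pq Q w) (mm Q) w.2 (pBf f w) r = ccM Q f (w, r) := by
  have hJ : MeasurableSet {y | ((w, r), y) ∈ JJ Q f} := (JJ_meas h.hQ.meas h.hf.meas).preimage (measurable_prodMk_left (x := (w, r)))
  have e : (II (Pq Q w) (pBf f w) r : Set ℝ) =ᵐ[volume] ({y | ((w, r), y) ∈ JJ Q f} : Set ℝ) := by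
    have h0 : ∀ᵐ y : ℝ ∂volume, y ≠ 0 := by simp [ae_iff]
    filter_upwards [h0] with y hy
    refine propext ?_
    change (0 ≤ y ∧ _) ↔ (0 < y ∧ _)
    constructor
    · rintro ⟨h1, h2⟩
      rw [h.AS_AB hw hom h1] at h2
      exact ⟨lt_of_le_of_ne h1 hy.symm, h2⟩
    · rintro ⟨h1, h2⟩
      rw [h.AS_AB hw hom h1.le]
      exact ⟨h1.le, h2⟩
  rw [cc, setLIntegral_congr e, ← lintegral_indicator hJ]
  rfl

lemma swap_mass {f : Phase → ℝ} (h : NF f) {c : ℝ → ℝ≥0∞} (hc : Measurable c) :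
    ENNReal.ofReal (8*π^2) * ∫⁻ w, (∫⁻ r in Ioi (0:ℝ), c r * ∫⁻ t in Ioc 0 r, pBf f w t) ∂WW = ∫⁻ r in Ioi (0:ℝ), c r * ENNReal.ofReal (mm f r) := by
  have hm : Measurable (fun q : (ℝ × ℝ) × ℝ => c q.2 * ∫⁻ t in Ioc 0 q.2, pBf f q.1 t) := (hc.comp measurable_snd).mul (AB_measl h.meas)
  rw [lintegral_lintegral_swap (f := fun w r => c r * ∫⁻ t in Ioc 0 r, pBf f w t) hm.aemeasurable, ← lintegral_const_mul' _ _ ENNReal.ofReal_ne_top]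
  refine lintegral_congr fun r => ?_
  have hm2 : Measurable (fun w : ℝ × ℝ => ∫⁻ t in Ioc 0 r, pBf f w t) := (AB_measl h.meas).comp (measurable_prodMk_right (y := r))
  rw [lintegral_const_mul _ hm2, mass_layer h, mul_left_comm]

/-- integrated inequality -/
lemma Cx.main (h : Cx Q f R) :
    (∫⁻ z : Phase, ENNReal.ofReal (‖z.2‖^2) * ENNReal.ofReal (Q z))
      + (∫⁻ r in Ioi (0:ℝ), ENNReal.ofReal (mm Q r/(2*π)*(1/r^2)) * ENNReal.ofReal (mm f r))
      + ENNReal.ofReal (8*π^2) * ∫⁻ r in Ioi (0:ℝ), ENNReal.ofReal (1/r^2) * ∫⁻ w, ccM Q f (w, r) ∂WW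
    ≤ (∫⁻ z : Phase, ENNReal.ofReal (‖z.2‖^2) * ENNReal.ofReal (f z))
      + ∫⁻ r in Ioi (0:ℝ), ENNReal.ofReal (mm Q r/(2*π)*(1/r^2)) * ENNReal.ofReal (mm Q r) := by
  have mQ : Measurable (mm Q) := h.hQ.mm_mono.measurable
  have hc : Measurable (fun r => ENNReal.ofReal (mm Q r/(2*π)*(1/r^2))) := by fun_prop
  rw [← swap_mass h.hf hc, ← swap_mass h.hQ hc, kin_layer h.hQ.meas h.hQ.sym, kin_layer h.hf.meas h.hf.sym]
  have hs : ∫⁻ r in Ioi (0:ℝ), ENNReal.ofReal (1/r^2) * ∫⁻ w, ccM Q f (w, r) ∂WW = ∫⁻ w, (∫⁻ r in Ioi (0:ℝ), ENNReal.ofReal (1/r^2) * ccM Q f (w, r)) ∂WW := by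
    have hm : Measurable (fun q : (ℝ × ℝ) × ℝ => ENNReal.ofReal (1/q.2^2) * ccM Q f q) := Measurable.mul (by fun_prop) (ccM_meas h.hQ h.hf.meas)
    rw [lintegral_lintegral_swap (f := fun w r => ENNReal.ofReal (1/r^2) * ccM Q f (w, r)) hm.aemeasurable]
    refine lintegral_congr fun r => ?_
    rw [lintegral_const_mul' _ _ ENNReal.ofReal_ne_top]
  rw [hs, ← mul_add, ← mul_add, ← mul_add]
  refine mul_le_mul_right ?_ _
  have hm1 : Measurable (fun w => ∫⁻ r in Ioi (0:ℝ), ENNReal.ofReal (mm Q r/(2*π)*(1/r^2)) * ∫⁻ t in Ioc 0 r, pBf Q w t) := by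
    have hm : Measurable (fun q : (ℝ × ℝ) × ℝ => ENNReal.ofReal (mm Q q.2/(2*π)*(1/q.2^2)) * ∫⁻ t in Ioc 0 q.2, pBf Q q.1 t) := (hc.comp measurable_snd).mul (AB_measl h.hQ.meas)
    exact Measurable.lintegral_prod_right' (ν := LP) hm
  rw [← lintegral_add_right _ hm1]
  refine (add_le_add_left (le_lintegral_add _ _) _).trans ((le_lintegral_add _ _).trans (lintegral_mono_ae ?_))
  filter_upwards [WW_pos, h.om] with w hw hom
  have t1 := hom.T1
  obtain ⟨e1, _, hps⟩ := h.ps w hw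
  have a1 : ∫⁻ r in Ioi (0:ℝ), kBf Q w r = ∫⁻ r in Ioi (0:ℝ), ENNReal.ofReal (Pq Q w r^3/3) := setLIntegral_congr_fun measurableSet_Ioi (fun r hr => hps.k r hr)
  have a2 : ∫⁻ r in Ioi (0:ℝ), ENNReal.ofReal (1/r^2) * pBf Q w r = ∫⁻ r in Ioi (0:ℝ), ENNReal.ofReal (1/r^2) * ENNReal.ofReal (Pq Q w r) := setLIntegral_congr_fun measurableSet_Ioi (fun r hr => by rw [hps.p r hr])
  have a3 : ∫⁻ r in Ioi (0:ℝ), ENNReal.ofReal (mm Q r/(2*π)*(1/r^2)) * (∫⁻ t in Ioc 0 r, pBf f w t) = ∫⁻ r in Ioi (0:ℝ), ENNReal.ofReal (mm Q r/(2*π)*(1/r^2)) * ENNReal.ofReal (AB (pBf f w) r) := by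
    refine lintegral_congr fun r => ?_
    rw [hom.AB_l]
  have a4 : ∫⁻ r in Ioi (0:ℝ), ENNReal.ofReal (mm Q r/(2*π)*(1/r^2)) * (∫⁻ t in Ioc 0 r, pBf Q w t) = ∫⁻ r in Ioi (0:ℝ), ENNReal.ofReal (mm Q r/(2*π)*(1/r^2)) * ENNReal.ofReal (_root_.AS (Pq Q w) r) := setLIntegral_congr_fun measurableSet_Ioi (fun r hr => by rw [h.AS hw hom (le_of_lt hr)])
  have a5 : ∫⁻ r in Ioi (0:ℝ), ENNReal.ofReal (1/r^2) * ccM Q f (w, r) = ∫⁻ r in Ioi (0:ℝ), ENNReal.ofReal (1/r^2) * cc (Pq Q w) (mm Q) w.2 (pBf f w) r := by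
    refine lintegral_congr fun r => ?_
    rw [h.cc_eq hw hom]
  rw [a1, a2, a3, a4, a5]
  exact t1

end



section
variable {Q f : Phase → ℝ} {R : ℝ}

lemma Cx.cmp (h : Cx Q f R) {r : ℝ} (hr : 0 < r) {κ : ℝ × ℝ → ℝ → ℝ} (hκ : Measurable (fun q : (ℝ × ℝ) × ℝ => κ q.1 q.2)) {k B : ℝ} (hk : 0 ≤ k) (hB : 0 ≤ B)
    (hBo : ENNReal.ofReal (8*π^2) * ∫⁻ w, (∫⁻ y in Ioi r, ENNReal.ofReal (k - κ w y) * ENNReal.ofReal (Pq Q w y)) ∂WW ≤ ENNReal.ofReal B)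
    (hBi : ENNReal.ofReal (8*π^2) * ∫⁻ w, (∫⁻ y in Ioo 0 r, ENNReal.ofReal (k - κ w y) * ENNReal.ofReal (Pq Q w y)) ∂WW ≤ ENNReal.ofReal B) :
    ENNReal.ofReal (k * |mm f r - mm Q r| - B) ≤ ENNReal.ofReal (8*π^2) * ∫⁻ w, (∫⁻ y in II (Pq Q w) (pBf f w) r, ENNReal.ofReal (κ w y) * ENNReal.ofReal (Pq Q w y)) ∂WW := by
  have hT : ∀ S : Set ℝ, Measurable (fun w => ∫⁻ y in S, ENNReal.ofReal (k - κ w y) * ENNReal.ofReal (Pq Q w y)) := by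
    intro S
    have : Measurable (fun q : (ℝ × ℝ) × ℝ => ENNReal.ofReal (k - κ q.1 q.2) * ENNReal.ofReal (Pq Q q.1 q.2)) :=
      (hκ.const_sub k).ennreal_ofReal.mul (Pq_meas2 h.hQ.meas).ennreal_ofReal
    exact Measurable.lintegral_prod_right' (ν := volume.restrict S) this
  have hM : ∀ {g : Phase → ℝ}, NF g → Measurable (fun w : ℝ × ℝ => ENNReal.ofReal k * ∫⁻ t in Ioc 0 r, pBf g w t) := fun hg =>
    ((AB_measl hg.meas).comp (measurable_prodMk_right (y := r))).const_mul _
  have hI : ∀ {g : Phase → ℝ}, NF g → ENNReal.ofReal (8*π^2) * ∫⁻ w, (ENNReal.ofReal k * ∫⁻ t in Ioc 0 r, pBf g w t) ∂WW = ENNReal.ofReal (k * mm g r) := by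
    intro g hg
    rw [lintegral_const_mul' _ _ ENNReal.ofReal_ne_top, mul_left_comm, ← mass_layer hg, ← ENNReal.ofReal_mul hk]
  have hκw : ∀ w, Measurable (κ w) := fun w => hκ.comp (measurable_prodMk_left (x := w))
  have gen : ∀ (f1 f2 : Phase → ℝ) (S : Set ℝ), NF f1 → NF f2 → ENNReal.ofReal (8*π^2) * ∫⁻ w, (∫⁻ y in S, ENNReal.ofReal (k - κ w y) * ENNReal.ofReal (Pq Q w y)) ∂WW ≤ ENNReal.ofReal B →
      (∀ᵐ w ∂WW, ENNReal.ofReal k * ∫⁻ t in Ioc 0 r, pBf f1 w t ≤ ENNReal.ofReal k * (∫⁻ t in Ioc 0 r, pBf f2 w t) + ((∫⁻ y in II (Pq Q w) (pBf f w) r, ENNReal.ofReal (κ w y) * ENNReal.ofReal (Pq Q w y)) + ∫⁻ y in S, ENNReal.ofReal (k - κ w y) * ENNReal.ofReal (Pq Q w y))) →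
      ENNReal.ofReal (k * (mm f1 r - mm f2 r) - B) ≤ ENNReal.ofReal (8*π^2) * ∫⁻ w, (∫⁻ y in II (Pq Q w) (pBf f w) r, ENNReal.ofReal (κ w y) * ENNReal.ofReal (Pq Q w y)) ∂WW := by
    intro f1 f2 S h1 h2 hS hw
    have := lintegral_mono_ae hw
    rw [lintegral_add_left (hM h2), lintegral_add_right _ (hT S)] at this
    have := mul_le_mul_right this (ENNReal.ofReal (8*π^2))
    rw [mul_add, mul_add, hI h1, hI h2] at this
    have h3 := this.trans (add_le_add_right (add_le_add_right hS _) _)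
    have h20 := NF.mm_nonneg f2 r
    rw [show k * (mm f1 r - mm f2 r) - B = k * mm f1 r - k * mm f2 r - B by ring, ENNReal.ofReal_sub _ hB, ENNReal.ofReal_sub _ (by positivity)]
    rw [tsub_le_iff_right, tsub_le_iff_left]
    exact h3
  rcases le_total (mm Q r) (mm f r) with hg | hg
  · rw [abs_of_nonneg (by linarith)]
    refine gen f Q (Ioi r) h.hf h.hQ hBo ?_
    filter_upwards [WW_pos, h.om] with w hw hom
    have := hom.cmp_out r hr (κ w) (hκw w) k
    rw [hom.AB_l, h.AS hw hom hr.le] at this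
    exact this.trans (add_le_add_right (add_le_add_left (lintegral_mono_set inter_subset_left) _) _)
  · rw [abs_of_nonpos (by linarith), neg_sub]
    refine gen Q f (Ioo 0 r) h.hQ h.hf hBi ?_
    filter_upwards [WW_pos, h.om] with w hw hom
    have := hom.cmp_in r hr (κ w) (hκw w) k
    rw [hom.AB_l, h.AS hw hom hr.le] at this
    exact this.trans (add_le_add_right (add_le_add_left (lintegral_mono_set inter_subset_left) _) _)

/-- layer-cake bound -/
lemma lc_bound (μ : Measure ℝ) [SFinite μ] {κ : ℝ → ℝ} (hκ : Measurable κ) (h0 : ∀ y, 0 ≤ κ y) {c : ℝ} (hc : 0 ≤ c)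
    (hb : ∀ τ > 0, μ {y | κ y < τ} ≤ ENNReal.ofReal (c * τ)) {k : ℝ} (hk : 0 ≤ k) :
    ∫⁻ y, ENNReal.ofReal (k - κ y) ∂μ ≤ ENNReal.ofReal (c * k^2/2) := by
  have e : ∀ y, ENNReal.ofReal (k - κ y) = ∫⁻ τ in Ioc 0 k, {q : ℝ × ℝ | κ q.1 < q.2}.indicator 1 (y, τ) := by
    intro y
    have : (fun τ => {q : ℝ × ℝ | κ q.1 < q.2}.indicator (1 : ℝ × ℝ → ℝ≥0∞) (y, τ)) = (Ioi (κ y)).indicator 1 := by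
      ext τ; simp [indicator]
    rw [this, lintegral_indicator_one measurableSet_Ioi, Measure.restrict_apply measurableSet_Ioi, inter_comm, Ioc_inter_Ioi, max_eq_right (h0 y), Real.volume_Ioc]
  have hm : MeasurableSet {q : ℝ × ℝ | κ q.1 < q.2} := measurableSet_lt (hκ.comp measurable_fst) measurable_snd
  have hmi : Measurable ({q : ℝ × ℝ | κ q.1 < q.2}.indicator (1 : ℝ × ℝ → ℝ≥0∞)) := measurable_one.indicator hm
  rw [lintegral_congr e, lintegral_lintegral_swap (f := fun y τ => {q : ℝ × ℝ | κ q.1 < q.2}.indicator (1 : ℝ × ℝ → ℝ≥0∞) (y, τ)) hmi.aemeasurable]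
  have e2 : ∀ τ ∈ Ioc 0 k, ∫⁻ y, {q : ℝ × ℝ | κ q.1 < q.2}.indicator (1 : ℝ × ℝ → ℝ≥0∞) (y, τ) ∂μ ≤ ENNReal.ofReal (c * τ) := by
    intro τ hτ
    have : (fun y => {q : ℝ × ℝ | κ q.1 < q.2}.indicator (1 : ℝ × ℝ → ℝ≥0∞) (y, τ)) = {y | κ y < τ}.indicator 1 := by
      ext y; simp [indicator]
    rw [this, lintegral_indicator_one (measurableSet_lt hκ measurable_const)]
    exact hb τ hτ.1
  refine (setLIntegral_mono (by fun_prop) e2).trans ?_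
  have hcc : Continuous (fun τ : ℝ => c * τ) := by fun_prop
  rw [← ofReal_integral_eq_lintegral_ofReal hcc.integrableOn_Ioc (by
      filter_upwards [ae_restrict_mem measurableSet_Ioc] with p hp
      exact mul_nonneg hc hp.1.le), ← intervalIntegral.integral_of_le hk]
  rw [intervalIntegral.integral_const_mul, integral_id]
  apply le_of_eq; congr 1; ring

lemma NF.cov (h : NF Q) {a b : ℝ} (ha : 0 ≤ a) (hab : a ≤ b) : ∫⁻ t in Ioc a b, nL Q t = ENNReal.ofReal (mm Q b - mm Q a) := by
  have h1 : mL Q b = mL Q a + ∫⁻ t in Ioc a b, nL Q t := by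
    rw [mL, mL, ← lintegral_union measurableSet_Ioc (Ioc_disjoint_Ioc_of_le le_rfl), Ioc_union_Ioc_eq_Ioc ha hab]
  rw [ENNReal.ofReal_sub _ (NF.mm_nonneg Q a), h.of_mm, h.of_mm, h1, ENNReal.add_sub_cancel_left]
  exact (h.mL_fin a).ne

lemma K1_meas_bound (h : NF Q) {r τ : ℝ} (hr : 0 < r) (hτ : 0 < τ) {S : Set ℝ} (hS : S = Ioi r ∨ S = Ioo 0 r) (hSm : MeasurableSet S) :
    ((volume.restrict S).withDensity (nL Q)) {y | |mm Q y - mm Q r|/(2*π) < τ} ≤ ENNReal.ofReal (2*π*τ) := by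
  classical
  have hmc := h.mm_cont
  have hms : MeasurableSet {y | |mm Q y - mm Q r|/(2*π) < τ} := (isOpen_lt (by fun_prop) continuous_const).measurableSet
  rw [withDensity_apply _ hms, Measure.restrict_restrict hms]
  set A := {y | |mm Q y - mm Q r|/(2*π) < τ} with hA
  have hAo : IsOpen A := isOpen_lt (by fun_prop) continuous_const
  have hpi : (0:ℝ) < 2*π := by positivity
  have hAi : ∀ y ∈ A, |mm Q y - mm Q r| < 2*π*τ := fun y hy => by
    have : _ < τ := hy
    rw [div_lt_iff₀ hpi] at this; linarith
  have hSo : IsOpen S := by rcases hS with rfl | rfl; exacts [isOpen_Ioi, isOpen_Ioo]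
  let q : ℚ → Set ℝ := fun x => if (x:ℝ) ∈ A ∩ S then uIoc (x:ℝ) r else ∅
  have hsub : A ∩ S ⊆ ⋃ x, q x := by
    intro y hy
    rcases hS with rfl | rfl
    · have hev : ∀ᶠ x in 𝓝[>] y, x ∈ A ∩ Ioi r := mem_nhdsWithin_of_mem_nhds ((hAo.inter hSo).mem_nhds hy)
      obtain ⟨b, hb, hb2⟩ := (mem_nhdsGT_iff_exists_Ioo_subset).mp hev
      obtain ⟨x, hx1, hx2⟩ := exists_rat_btwn (mem_Ioi.mp hb)
      have hx : (x:ℝ) ∈ A ∩ Ioi r := hb2 ⟨hx1, hx2⟩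
      refine mem_iUnion.mpr ⟨x, ?_⟩
      simp only [q]; rw [if_pos hx, uIoc_of_ge (le_of_lt hx.2)]; exact ⟨hy.2, hx1.le⟩
    · have hev : ∀ᶠ x in 𝓝[<] y, x ∈ A ∩ Ioo 0 r := mem_nhdsWithin_of_mem_nhds ((hAo.inter hSo).mem_nhds hy)
      obtain ⟨b, hb, hb2⟩ := (mem_nhdsLT_iff_exists_Ioo_subset).mp hev
      obtain ⟨x, hx1, hx2⟩ := exists_rat_btwn (mem_Iio.mp hb)
      have hx : (x:ℝ) ∈ A ∩ Ioo 0 r := hb2 ⟨hx1, hx2⟩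
      refine mem_iUnion.mpr ⟨x, ?_⟩
      simp only [q]; rw [if_pos hx, uIoc_of_le (le_of_lt hx.2.2)]; exact ⟨hx2, hy.2.2.le⟩
  refine (lintegral_mono_set hsub).trans ?_
  have hd : Directed (· ⊆ ·) q := by
    intro a b
    by_cases ha : (a:ℝ) ∈ A ∩ S
    · by_cases hb : (b:ℝ) ∈ A ∩ S
      · rcases hS with rfl | rfl
        · have ha' : r ≤ a := le_of_lt (mem_Ioi.mp ha.2)
          have hb' : r ≤ b := le_of_lt (mem_Ioi.mp hb.2)
          rcases le_total a b with hab | hab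
          · refine ⟨b, ?_, subset_rfl⟩
            simp only [q]; rw [if_pos ha, if_pos hb, uIoc_of_ge ha', uIoc_of_ge hb']
            exact Ioc_subset_Ioc_right (by exact_mod_cast hab)
          · refine ⟨a, subset_rfl, ?_⟩
            simp only [q]; rw [if_pos ha, if_pos hb, uIoc_of_ge ha', uIoc_of_ge hb']
            exact Ioc_subset_Ioc_right (by exact_mod_cast hab)
        · rcases le_total a b with hab | hab
          · refine ⟨a, subset_rfl, ?_⟩
            simp only [q]; rw [if_pos ha, if_pos hb, uIoc_of_le (le_of_lt ha.2.2), uIoc_of_le (le_of_lt hb.2.2)]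
            exact Ioc_subset_Ioc_left (by exact_mod_cast hab)
          · refine ⟨b, ?_, subset_rfl⟩
            simp only [q]; rw [if_pos ha, if_pos hb, uIoc_of_le (le_of_lt ha.2.2), uIoc_of_le (le_of_lt hb.2.2)]
            exact Ioc_subset_Ioc_left (by exact_mod_cast hab)
      · refine ⟨a, subset_rfl, ?_⟩
        simp only [q]; rw [if_neg hb]; exact empty_subset _
    · refine ⟨b, ?_, subset_rfl⟩
      simp only [q]; rw [if_neg ha]; exact empty_subset _
  have hqm : ∀ x, MeasurableSet (q x) := by
    intro x; simp only [q]; split_ifs; exacts [measurableSet_uIoc, MeasurableSet.empty]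
  rw [← withDensity_apply _ (MeasurableSet.iUnion hqm), hd.measure_iUnion]
  refine iSup_le fun x => ?_
  rw [withDensity_apply _ (hqm x)]
  simp only [q]
  split_ifs with hx
  · have hA2 := hAi _ hx.1
    rcases hS with rfl | rfl
    · rw [uIoc_of_ge (le_of_lt hx.2), h.cov hr.le (le_of_lt hx.2)]
      exact ENNReal.ofReal_le_ofReal (by linarith [le_abs_self (mm Q x - mm Q r)])
    · rw [uIoc_of_le (le_of_lt hx.2.2), h.cov hx.2.1.le (le_of_lt hx.2.2)]
      exact ENNReal.ofReal_le_ofReal (by linarith [neg_abs_le (mm Q x - mm Q r)])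
  · simp

lemma Cx.K1_bound (h : Cx Q f R) {r k : ℝ} (hr : 0 < r) (hk : 0 ≤ k) {S : Set ℝ} (hS : S = Ioi r ∨ S = Ioo 0 r) :
    ENNReal.ofReal (8*π^2) * ∫⁻ w, (∫⁻ y in S, ENNReal.ofReal (k - |mm Q y - mm Q r|/(2*π)) * ENNReal.ofReal (Pq Q w y)) ∂WW ≤ ENNReal.ofReal (π*k^2) := by
  have hSm : MeasurableSet S := by rcases hS with rfl | rfl; exacts [measurableSet_Ioi, measurableSet_Ioo]
  have hS0 : S ⊆ Ioi 0 := by rcases hS with rfl | rfl; exacts [fun y hy => hr.trans hy, fun y hy => hy.1]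
  have mQ : Measurable (mm Q) := h.hQ.mm_mono.measurable
  have hκ : Measurable (fun y => |mm Q y - mm Q r|/(2*π)) := (measurable_norm.comp (mQ.sub_const _)).div_const _
  have hc : Measurable (fun y => ENNReal.ofReal (k - |mm Q y - mm Q r|/(2*π))) := (hκ.const_sub k).ennreal_ofReal
  have e : ∀ g : ℝ → ℝ≥0∞, ∫⁻ y in S, ENNReal.ofReal (k - |mm Q y - mm Q r|/(2*π)) * g y = ∫⁻ y in Ioi (0:ℝ), S.indicator (fun y => ENNReal.ofReal (k - |mm Q y - mm Q r|/(2*π))) y * g y := by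
    intro g
    have : ∀ y, S.indicator (fun y => ENNReal.ofReal (k - |mm Q y - mm Q r|/(2*π))) y * g y = S.indicator (fun y => ENNReal.ofReal (k - |mm Q y - mm Q r|/(2*π)) * g y) y := by
      intro y; by_cases hy : y ∈ S <;> simp [indicator, hy]
    rw [lintegral_congr this, lintegral_indicator hSm, Measure.restrict_restrict hSm, inter_eq_left.mpr hS0]
  simp only [e]
  rw [h.n_P (hc.indicator hSm), ← e]
  have := lc_bound ((volume.restrict S).withDensity (nL Q)) hκ (fun y => by positivity) (c := 2*π) (by positivity) (fun τ hτ => K1_meas_bound h.hQ hr hτ hS hSm) hk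
  rw [lintegral_withDensity_eq_lintegral_mul _ (nL_meas h.hQ.meas) hc] at this
  calc _ = _ := lintegral_congr fun y => by rw [Pi.mul_apply, mul_comm]
    _ ≤ _ := this
    _ = _ := by congr 1; ring
end



def zz (r y : ℝ) : ℝ := if r < y then y - r else min y (r - y)

lemma cb_out {t : ℝ} (ht : 1 ≤ t) : 1 - 1/t^3 ≤ 3*(t-1) := by
  have h0 : 0 < t := by linarith
  rw [sub_le_iff_le_add, ← sub_le_iff_le_add', le_div_iff₀ (by positivity)]
  nlinarith [sq_nonneg (t-1), mul_nonneg (sub_nonneg.2 ht) (sq_nonneg (t-1)), pow_pos h0 2, pow_pos h0 3, mul_nonneg (sub_nonneg.2 ht) (pow_pos h0 3).le, mul_nonneg (sub_nonneg.2 ht) (sub_nonneg.2 ht)]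

lemma cb_in {t : ℝ} (h0 : 0 ≤ t) (ht : t ≤ 1) : 1 - t^3 ≤ 3*(1-t) := by
  nlinarith [mul_nonneg (sub_nonneg.2 ht) (mul_nonneg h0 (sub_nonneg.2 ht)), mul_nonneg (sub_nonneg.2 ht) (sub_nonneg.2 ht)]

lemma KK_lb {P m : ℝ → ℝ} {l a0 b0 : ℝ} {pB kB : ℝ → ℝ≥0∞} (h : OM P m l a0 b0 pB kB) {y r : ℝ} (hr : 0 < r) (hy : 0 < y) :
    |m y - m r|/(2*π) + 2/9*(P y^2 + l/y^2)*zz r y ≤ |KK P m l y r| := by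
  have hl := h.hl
  have h1 : 0 < r^(1/3:ℝ) := Real.rpow_pos_of_pos hr _
  have h2 : 0 < y^(1/3:ℝ) := Real.rpow_pos_of_pos hy _
  have c1 : (r^(1/3:ℝ))^3 = r := by rw [← Real.rpow_mul_natCast hr.le]; norm_num
  have c2 : (y^(1/3:ℝ))^3 = y := by rw [← Real.rpow_mul_natCast hy.le]; norm_num
  have c3 : (y^(1/3:ℝ)/r^(1/3:ℝ))^3 = y/r := by rw [div_pow, c1, c2]
  have hK : KK P m l y r = 4/3*P y^2*y*(y^(1/3:ℝ)/r^(1/3:ℝ) - 1) + 2*l*(1/r - 1/y) + (m y - m r)/(2*π) := rfl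
  have hP := sq_nonneg (P y)
  unfold zz
  split_ifs with hlt
  · rw [abs_of_nonneg (h.KK_pos hr hlt), hK, abs_of_nonneg (by linarith [h.mmono hlt.le])]
    set t := y^(1/3:ℝ)/r^(1/3:ℝ)
    have ht : 1 ≤ t := by rw [le_div_iff₀ h1, one_mul]; exact cb_mono hr.le hlt.le
    have k1 := cb_out ht
    rw [c3, one_div_div] at k1
    have k2 : y - r ≤ 3*(y*(t-1)) := by
      have := mul_le_mul_of_nonneg_left k1 hy.le
      rw [mul_sub, mul_div_cancel₀ _ hy.ne'] at this; linarith
    have k3 : l/y^2*(y-r) ≤ l*(1/r-1/y) := by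
      rw [div_mul_eq_mul_div, div_le_iff₀ (by positivity)]
      have : l*(1/r-1/y)*y^2 = l*(y-r)*(y/r) := by field_simp
      rw [this]
      have : 1 ≤ y/r := by rw [le_div_iff₀ hr]; linarith
      nlinarith [mul_nonneg hl.le (sub_nonneg.2 hlt.le)]
    have k4 : 0 ≤ l/y^2*(y-r) := mul_nonneg (by positivity) (by linarith)
    have k5 := mul_le_mul_of_nonneg_left k2 hP
    have k6 : 0 ≤ P y^2*(y-r) := mul_nonneg hP (by linarith)
    nlinarith
  · rcases (not_lt.mp hlt).eq_or_lt with he | hlt2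
    · subst he
      have : min y (y-y) = 0 := by simp [hy.le]
      rw [this]; simp
    · rw [abs_of_nonpos (h.KK_neg hy hlt2), hK, abs_of_nonpos (by linarith [h.mmono hlt2.le])]
      set t := y^(1/3:ℝ)/r^(1/3:ℝ)
      have ht : t ≤ 1 := by rw [div_le_iff₀ h1, one_mul]; exact cb_mono hy.le hlt2.le
      have ht0 : 0 ≤ t := by positivity
      have k1 := cb_in ht0 ht
      rw [c3] at k1
      have kz : min y (r-y) ≤ 2*(y*(1-y/r)) := by
        have : y*(1-y/r) = y*(r-y)/r := by field_simp
        rw [this, mul_div_assoc', le_div_iff₀ hr]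
        rcases le_total y (r-y) with hc | hc
        · rw [min_eq_left hc]; nlinarith
        · rw [min_eq_right hc]; nlinarith
      have k2 : min y (r-y) ≤ 6*(y*(1-t)) := by nlinarith
      have k3 : l/y^2*min y (r-y) ≤ 2*(l*(1/y-1/r)) := by
        have e : l*(1/y-1/r) = l/y^2*(y*(1-y/r)) := by field_simp
        rw [e]
        have := mul_le_mul_of_nonneg_left kz (by positivity : 0 ≤ l/y^2)
        linarith
      have k5 := mul_le_mul_of_nonneg_left k2 hP
      have k6 : 0 ≤ l*(1/y-1/r) := mul_nonneg hl.le (by rw [sub_nonneg]; exact one_div_le_one_div_of_le hy hlt2.le)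
      rw [neg_div]
      nlinarith

lemma Lz_int {R k : ℝ} (hR : 0 < R) (hk : 0 < k) :
    ∫⁻ z in Ioi (0:ℝ), ENNReal.ofReal (min (R^2) (9*k/(2*z)) * √(min (R^2) (9*k/(2*z)))) ≤ ENNReal.ofReal ((R^3+20)*k) := by
  rw [← Ioc_union_Ioi_eq_Ioi hk.le]
  refine (lintegral_union_le _ _ _).trans ?_
  rw [add_mul, ENNReal.ofReal_add (by positivity) (by positivity)]
  refine add_le_add ?_ ?_
  · calc _ ≤ ∫⁻ z in Ioc 0 k, ENNReal.ofReal (R^3) := by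
          refine lintegral_mono fun z => ENNReal.ofReal_le_ofReal ?_
          calc _ ≤ R^2 * √(R^2) := by gcongr <;> exact min_le_left _ _
            _ = R^3 := by rw [Real.sqrt_sq hR.le]; ring
      _ = _ := by rw [setLIntegral_const, Real.volume_Ioc, ← ENNReal.ofReal_mul (by positivity)]; simp
  · calc _ ≤ ∫⁻ z in Ioi k, ENNReal.ofReal (9*k/2*√(9*k/2)) * ENNReal.ofReal (z^(-(3/2):ℝ)) := by
          refine setLIntegral_mono (by fun_prop) fun z hz => ?_
          have hz0 : 0 < z := hk.trans hz
          rw [← ENNReal.ofReal_mul (by positivity)]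
          refine ENNReal.ofReal_le_ofReal ?_
          calc _ ≤ 9*k/(2*z) * √(9*k/(2*z)) := by gcongr <;> exact min_le_right _ _
            _ = _ := by
              rw [show 9*k/(2*z) = 9*k/2/z by field_simp, Real.sqrt_div' _ hz0.le, show (-(3/2):ℝ) = -1 + -(1/2) by norm_num, Real.rpow_add hz0, Real.rpow_neg hz0.le (1/2), ← Real.sqrt_eq_rpow, Real.rpow_neg_one]
              field_simp
      _ = ENNReal.ofReal (9*k/2*√(9*k/2)) * ENNReal.ofReal (2*k^(-(1/2):ℝ)) := by
          rw [lintegral_const_mul _ (by fun_prop)]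
          congr 1
          rw [lint_rpow _ _ (by norm_num) hk]
          congr 1; norm_num; ring
      _ ≤ _ := by
          rw [← ENNReal.ofReal_mul (by positivity)]
          refine ENNReal.ofReal_le_ofReal ?_
          rw [Real.rpow_neg hk.le, ← Real.sqrt_eq_rpow, show 9*k/2 = (9/2)*k by ring, Real.sqrt_mul (by norm_num)]
          have h1 : √(9/2:ℝ) ≤ 20/9 := by rw [Real.sqrt_le_left (by norm_num)]; norm_num
          have h2 : 0 < √k := Real.sqrt_pos.2 hk
          have : 9/2*k*(√(9/2)*√k)*(2*(√k)⁻¹) = 9*√(9/2)*k := by field_simp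
          rw [this]
          nlinarith

section
variable {Q f : Phase → ℝ} {R : ℝ}

lemma Cx.vol (h : Cx Q f R) {y z k : ℝ} (hy : 0 < y) (hz : 0 < z) (hk : 0 < k) :
    ∫⁻ w, ENNReal.ofReal (k - 2/9*(Pq Q w y^2 + w.2/y^2)*z) * ENNReal.ofReal (Pq Q w y) ∂WW
      ≤ ENNReal.ofReal (k*R^3) * ENNReal.ofReal (min (R^2) (9*k/(2*z)) * √(min (R^2) (9*k/(2*z)))) := by
  have hR := h.hR
  set L := min (R^2) (9*k/(2*z)) with hL
  have hL0 : 0 < L := lt_min (by positivity) (by positivity)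
  have hpt : ∀ᵐ w ∂WW, ENNReal.ofReal (k - 2/9*(Pq Q w y^2 + w.2/y^2)*z) * ENNReal.ofReal (Pq Q w y) ≤ (Ioc 0 R ×ˢ Ioc 0 (L*R^2)).indicator (fun _ => ENNReal.ofReal (k*√L)) w := by
    filter_upwards [WW_pos] with w hw
    obtain ⟨e1, _, hps⟩ := h.ps w hw
    by_cases hP : Pq Q w y = 0
    · rw [hP]; simp
    by_cases hV : k - 2/9*(Pq Q w y^2 + w.2/y^2)*z ≤ 0
    · rw [ENNReal.ofReal_of_nonpos hV]; simp
    push Not at hV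
    obtain ⟨_, h2, h3, h4⟩ := hps.V y hP
    have hl : 0 < w.2/y^2 := div_pos hw.2 (by positivity)
    have hVL : Pq Q w y^2 + w.2/y^2 ≤ L := by
      refine le_min h4 ?_
      rw [le_div_iff₀ (by positivity)]; nlinarith
    have hPL : Pq Q w y ≤ √L := Real.le_sqrt_of_sq_le (by linarith)
    have hwl : w.2 ≤ L*R^2 := by
      have : w.2/y^2 ≤ L := by nlinarith [sq_nonneg (Pq Q w y)]
      rw [div_le_iff₀ (by positivity)] at this
      refine this.trans ?_
      gcongr
    have hmem : w ∈ Ioc (0:ℝ) R ×ˢ Ioc (0:ℝ) (L*R^2) := ⟨⟨hw.1, h3.le⟩, ⟨hw.2, hwl⟩⟩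
    rw [indicator_of_mem hmem, ← ENNReal.ofReal_mul hV.le]
    refine ENNReal.ofReal_le_ofReal ?_
    have : 0 ≤ 2/9*(Pq Q w y^2 + w.2/y^2)*z := by positivity
    exact mul_le_mul (by linarith) hPL (Pq_nonneg _ _ _) hk.le
  refine (lintegral_mono_ae hpt).trans ?_
  rw [lintegral_indicator_const (measurableSet_Ioc.prod measurableSet_Ioc), Measure.prod_prod, Measure.restrict_apply measurableSet_Ioc, Measure.restrict_apply measurableSet_Ioc,
    inter_eq_left.mpr Ioc_subset_Ioi_self, inter_eq_left.mpr Ioc_subset_Ioi_self, Real.volume_Ioc, Real.volume_Ioc, ← ENNReal.ofReal_mul (by linarith), ← ENNReal.ofReal_mul (by positivity), ← ENNReal.ofReal_mul (by positivity)]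
  refine ENNReal.ofReal_le_ofReal (le_of_eq ?_)
  ring

def Cc (R : ℝ) : ℝ := 24*π^2*(R^3*(R^3+20))

lemma zz_meas (r : ℝ) : Measurable (zz r) := by
  unfold zz
  exact Measurable.ite measurableSet_Ioi (by fun_prop) (by fun_prop)

lemma K2_meas (hQ : Measurable Q) (r : ℝ) : Measurable (fun q : (ℝ × ℝ) × ℝ => 2/9*(Pq Q q.1 q.2^2 + q.1.2/q.2^2)*zz r q.2) := by
  have m1 := Pq_meas2 hQ
  have m2 : Measurable (fun q : (ℝ × ℝ) × ℝ => zz r q.2) := (zz_meas r).comp measurable_snd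
  fun_prop

lemma Cx.K2_bound (h : Cx Q f R) {r k : ℝ} (hr : 0 < r) (hk : 0 < k) :
    ENNReal.ofReal (8*π^2) * ∫⁻ w, (∫⁻ y in Ioi (0:ℝ), ENNReal.ofReal (k - 2/9*(Pq Q w y^2 + w.2/y^2)*zz r y) * ENNReal.ofReal (Pq Q w y)) ∂WW ≤ ENNReal.ofReal (Cc R*k^2) := by
  have hR := h.hR
  have hm : Measurable (fun q : (ℝ × ℝ) × ℝ => ENNReal.ofReal (k - 2/9*(Pq Q q.1 q.2^2 + q.1.2/q.2^2)*zz r q.2) * ENNReal.ofReal (Pq Q q.1 q.2)) :=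
    ((K2_meas h.hQ.meas r).const_sub k).ennreal_ofReal.mul (Pq_meas2 h.hQ.meas).ennreal_ofReal
  rw [lintegral_lintegral_swap (f := fun w y => ENNReal.ofReal (k - 2/9*(Pq Q w y^2 + w.2/y^2)*zz r y) * ENNReal.ofReal (Pq Q w y)) hm.aemeasurable]
  let H : ℝ → ℝ≥0∞ := (Ioi 0).indicator (fun z => ENNReal.ofReal (k*R^3) * ENNReal.ofReal (min (R^2) (9*k/(2*z)) * √(min (R^2) (9*k/(2*z)))))
  have hH : Measurable H := Measurable.indicator (by fun_prop) measurableSet_Ioi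
  have hHi : ∫⁻ z, H z ≤ ENNReal.ofReal (k*R^3) * ENNReal.ofReal ((R^3+20)*k) := by
    simp only [H]
    rw [lintegral_indicator measurableSet_Ioi, lintegral_const_mul _ (by fun_prop)]
    exact mul_le_mul_right (Lz_int hR hk) _
  have hv : ∀ y z, 0 < y → 0 < z → ∫⁻ w, ENNReal.ofReal (k - 2/9*(Pq Q w y^2 + w.2/y^2)*z) * ENNReal.ofReal (Pq Q w y) ∂WW ≤ H z := by
    intro y z hy hz
    simp only [H]
    rw [indicator_of_mem (mem_Ioi.mpr hz)]
    exact h.vol hy hz hk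
  have hne : ∀ᵐ y : ℝ ∂volume, y ≠ r := by simp [ae_iff]
  have hb : ∀ᵐ y ∂LP, ∫⁻ w, ENNReal.ofReal (k - 2/9*(Pq Q w y^2 + w.2/y^2)*zz r y) * ENNReal.ofReal (Pq Q w y) ∂WW ≤ H y + (H (y - r) + H (r - y)) := by
    filter_upwards [ae_restrict_mem measurableSet_Ioi, ae_restrict_of_ae hne] with y hy hyr
    have hy0 : 0 < y := hy
    unfold zz
    split_ifs with hlt
    · exact (hv y (y - r) hy0 (by linarith)).trans (le_add_left le_self_add)
    · have hlt2 : y < r := lt_of_le_of_ne (not_lt.mp hlt) hyr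
      rcases le_total y (r-y) with hc | hc
      · rw [min_eq_left hc]
        exact (hv y y hy0 hy0).trans le_self_add
      · rw [min_eq_right hc]
        exact (hv y (r-y) hy0 (by linarith)).trans (le_add_left (le_add_left le_rfl))
  have hI : ∫⁻ y in Ioi (0:ℝ), (∫⁻ w, ENNReal.ofReal (k - 2/9*(Pq Q w y^2 + w.2/y^2)*zz r y) * ENNReal.ofReal (Pq Q w y) ∂WW) ≤ 3 * ∫⁻ z, H z := by
    refine (lintegral_mono_ae hb).trans ((setLIntegral_le_lintegral _ _).trans ?_)
    have hH2 : Measurable (fun y : ℝ => H (y - r)) := hH.comp (by fun_prop)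
    rw [lintegral_add_left hH, lintegral_add_left hH2, lintegral_sub_right_eq_self H r, lintegral_sub_left_eq_self H r]
    apply le_of_eq; ring
  refine (mul_le_mul_right (hI.trans (mul_le_mul_right hHi _)) _).trans (le_of_eq ?_)
  rw [show (3:ℝ≥0∞) = ENNReal.ofReal 3 by simp, ← ENNReal.ofReal_mul (by positivity), ← ENNReal.ofReal_mul (by positivity), ← ENNReal.ofReal_mul (by positivity)]
  congr 1; unfold Cc; ring

lemma Cx.per_r (h : Cx Q f R) {r : ℝ} (hr : 0 < r) :
    ENNReal.ofReal ((mm f r - mm Q r)^2/(4*π) + (mm f r - mm Q r)^2/(4*Cc R)) ≤ ENNReal.ofReal (8*π^2) * ∫⁻ w, ccM Q f (w, r) ∂WW := by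
  have hR := h.hR
  have hC : 0 < Cc R := by unfold Cc; positivity
  rcases eq_or_ne (mm f r - mm Q r) 0 with hg | hg
  · rw [hg]; simp
  have hga : 0 < |mm f r - mm Q r| := abs_pos.mpr hg
  have mQ : Measurable (mm Q) := h.hQ.mm_mono.measurable
  have hκ1 : Measurable (fun q : (ℝ × ℝ) × ℝ => |mm Q q.2 - mm Q r|/(2*π)) := (measurable_norm.comp ((mQ.comp measurable_snd).sub_const _)).div_const _
  have b1 := h.cmp hr (κ := fun _ y => |mm Q y - mm Q r|/(2*π)) hκ1 (k := |mm f r - mm Q r|/(2*π)) (by positivity) (B := π*(|mm f r - mm Q r|/(2*π))^2) (by positivity)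
    (h.K1_bound hr (by positivity) (Or.inl rfl)) (h.K1_bound hr (by positivity) (Or.inr rfl))
  have hk2 : 0 < |mm f r - mm Q r|/(2*Cc R) := by positivity
  have B2 := h.K2_bound hr hk2
  have b2 := h.cmp hr (κ := fun w y => 2/9*(Pq Q w y^2 + w.2/y^2)*zz r y) (K2_meas h.hQ.meas r) hk2.le (B := Cc R*(|mm f r - mm Q r|/(2*Cc R))^2) (by positivity)
    (le_trans (mul_le_mul_right (lintegral_mono fun w => lintegral_mono_set (Ioi_subset_Ioi hr.le)) _) B2) (le_trans (mul_le_mul_right (lintegral_mono fun w => lintegral_mono_set Ioo_subset_Ioi_self) _) B2)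
  have e1 : |mm f r - mm Q r|/(2*π)*|mm f r - mm Q r| - π*(|mm f r - mm Q r|/(2*π))^2 = (mm f r - mm Q r)^2/(4*π) := by
    rw [← sq_abs (mm f r - mm Q r)]; field_simp; ring
  have e2 : |mm f r - mm Q r|/(2*Cc R)*|mm f r - mm Q r| - Cc R*(|mm f r - mm Q r|/(2*Cc R))^2 = (mm f r - mm Q r)^2/(4*Cc R) := by
    rw [← sq_abs (mm f r - mm Q r)]; field_simp; ring
  rw [e1] at b1
  rw [e2] at b2
  rw [ENNReal.ofReal_add (by positivity) (by positivity)]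
  refine (add_le_add b1 b2).trans ?_
  rw [← mul_add]
  refine mul_le_mul_right ((le_lintegral_add _ _).trans (lintegral_mono_ae ?_)) _
  filter_upwards [WW_pos, h.om] with w hw hom
  rw [← h.cc_eq hw hom, cc]
  refine (le_lintegral_add _ _).trans ?_
  have h0 : ∀ᵐ y : ℝ ∂volume, y ≠ 0 := by simp [ae_iff]
  have hII : ∀ᵐ y ∂(volume.restrict (II (Pq Q w) (pBf f w) r)), 0 ≤ y := by
    refine ae_restrict_of_ae_restrict_of_subset (t := Ici 0) (fun y hy => hy.1) ?_
    exact ae_restrict_mem measurableSet_Ici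
  refine lintegral_mono_ae ?_
  filter_upwards [hII, ae_restrict_of_ae h0] with y hy hy0
  have hyp : 0 < y := lt_of_le_of_ne hy hy0.symm
  have hz : 0 ≤ 2/9*(Pq Q w y^2 + w.2/y^2)*zz r y := by
    refine mul_nonneg (mul_nonneg (by norm_num) (add_nonneg (sq_nonneg _) (div_nonneg hw.2.le (sq_nonneg _)))) ?_
    unfold zz; split_ifs with hc
    · linarith
    · exact le_min hyp.le (by linarith)
  rw [← add_mul, ← ENNReal.ofReal_add (by positivity) hz, ENNReal.ofReal_mul (abs_nonneg _)]
  exact mul_le_mul_left (ENNReal.ofReal_le_ofReal (KK_lb hom hr hyp)) _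
end



section
variable {Q f : Phase → ℝ} {R : ℝ}

lemma Cx.ham (h : Cx Q f R) : Ham f - Ham Q ≥ π/(2*Cc R) * (fieldDist f Q)^2 := by
  have hR := h.hR
  have hC : 0 < Cc R := by unfold Cc; positivity
  have mQ : Measurable (mm Q) := h.hQ.mm_mono.measurable
  have mf : Measurable (mm f) := h.hf.mm_mono.measurable
  have hX := h.hQ.sq_fin
  have hY := h.hf.sq_fin
  have hD := h.hf.dist_fin h.hQ
  have hkQ := h.hQ.kin
  have hkf := h.hf.kin
  have hmain := h.main
  rw [Ham, Ham, h.hf.fieldSq_eq, h.hQ.fieldSq_eq, h.hf.kin_eq, h.hQ.kin_eq, h.hf.fieldDist_eq h.hQ]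
  have e1 : ∫⁻ r in Ioi (0:ℝ), ENNReal.ofReal (mm Q r/(2*π)*(1/r^2)) * ENNReal.ofReal (mm Q r) = 2 * ∫⁻ r in Ioi (0:ℝ), ENNReal.ofReal (mm Q r^2 / (4*π*r^2)) := by
    rw [← lintegral_const_mul _ (by fun_prop)]
    refine setLIntegral_congr_fun measurableSet_Ioi fun r (hr : 0 < r) => ?_
    have := NF.mm_nonneg Q r
    change _ * _ = 2 * _
    rw [← ENNReal.ofReal_mul (by positivity), show (2:ℝ≥0∞) = ENNReal.ofReal 2 by simp, ← ENNReal.ofReal_mul (by positivity)]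
    congr 1; field_simp; ring
  have e2 : (∫⁻ r in Ioi (0:ℝ), ENNReal.ofReal (mm f r^2 / (4*π*r^2))) + (∫⁻ r in Ioi (0:ℝ), ENNReal.ofReal (mm Q r^2 / (4*π*r^2))) = (∫⁻ r in Ioi (0:ℝ), ENNReal.ofReal ((mm f r - mm Q r)^2 / (4*π*r^2))) + ∫⁻ r in Ioi (0:ℝ), ENNReal.ofReal (mm Q r/(2*π)*(1/r^2)) * ENNReal.ofReal (mm f r) := by
    rw [← lintegral_add_left (by fun_prop), ← lintegral_add_left (by fun_prop)]
    refine setLIntegral_congr_fun measurableSet_Ioi fun r (hr : 0 < r) => ?_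
    have h1 := NF.mm_nonneg Q r
    have h2 := NF.mm_nonneg f r
    change _ + _ = _ + _ * _
    rw [← ENNReal.ofReal_mul (by positivity), ← ENNReal.ofReal_add (by positivity) (by positivity), ← ENNReal.ofReal_add (by positivity) (by positivity)]
    congr 1; field_simp; ring
  have e3 : ENNReal.ofReal (1 + π/Cc R) * ∫⁻ r in Ioi (0:ℝ), ENNReal.ofReal ((mm f r - mm Q r)^2 / (4*π*r^2)) ≤ ENNReal.ofReal (8*π^2) * ∫⁻ r in Ioi (0:ℝ), ENNReal.ofReal (1/r^2) * ∫⁻ w, ccM Q f (w, r) ∂WW := by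
    rw [← lintegral_const_mul' _ _ ENNReal.ofReal_ne_top, ← lintegral_const_mul' _ _ ENNReal.ofReal_ne_top]
    refine setLIntegral_mono' measurableSet_Ioi fun r (hr : 0 < r) => ?_
    have := mul_le_mul_right (h.per_r hr) (ENNReal.ofReal (1/r^2))
    refine le_trans (le_of_eq ?_) (this.trans (le_of_eq (by ring)))
    rw [← ENNReal.ofReal_mul (by positivity), ← ENNReal.ofReal_mul (by positivity)]
    congr 1; field_simp
  rw [e1] at hmain
  generalize (∫⁻ r in Ioi (0:ℝ), ENNReal.ofReal (mm Q r^2 / (4*π*r^2))) = X at *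
  generalize (∫⁻ r in Ioi (0:ℝ), ENNReal.ofReal (mm f r^2 / (4*π*r^2))) = Y at *
  generalize (∫⁻ r in Ioi (0:ℝ), ENNReal.ofReal ((mm f r - mm Q r)^2 / (4*π*r^2))) = D at *
  generalize (∫⁻ r in Ioi (0:ℝ), ENNReal.ofReal (mm Q r/(2*π)*(1/r^2)) * ENNReal.ofReal (mm f r)) = Z at *
  generalize (∫⁻ z : Phase, ENNReal.ofReal (‖z.2‖^2) * ENNReal.ofReal (f z)) = kf at *
  generalize (∫⁻ z : Phase, ENNReal.ofReal (‖z.2‖^2) * ENNReal.ofReal (Q z)) = kQ at *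
  have hZ : Z < ⊤ := by
    refine lt_of_le_of_lt (le_add_left le_rfl : Z ≤ D + Z) ?_
    rw [← e2]; exact ENNReal.add_lt_top.2 ⟨hY, hX⟩
  have hm := (add_le_add_right e3 (kQ + Z)).trans hmain
  lift X to ℝ≥0 using hX.ne
  lift Y to ℝ≥0 using hY.ne
  lift D to ℝ≥0 using hD.ne
  lift Z to ℝ≥0 using hZ.ne
  lift kf to ℝ≥0 using hkf.ne
  lift kQ to ℝ≥0 using hkQ.ne
  rw [ENNReal.ofReal] at hm
  have hm' : (kQ:ℝ) + Z + (1+π/Cc R)*D ≤ kf + 2*X := by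
    have : kQ + Z + (1+π/Cc R).toNNReal*D ≤ kf + 2*X := by exact_mod_cast hm
    have := NNReal.coe_le_coe.2 this
    push_cast at this
    rwa [Real.coe_toNNReal _ (by positivity)] at this
  have e2' : (Y:ℝ) + X = D + Z := by exact_mod_cast e2
  simp only [ENNReal.coe_toReal]
  have : π/(2*Cc R) * (D:ℝ) = π/Cc R*D/2 := by field_simp
  rw [this]
  linarith

end



lemma slice_abs {Y : Type*} [MeasurableSpace Y] {μ : Measure Y} {z zQ a g d : Y → ℝ≥0∞} {E : ℝ≥0∞}
    (hz : Measurable z) (hzQ : Measurable zQ) (ha : Measurable a) (hg : Measurable g) (hE : E ≠ ⊤)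
    (hpt : ∀ᵐ y ∂μ, z y * (a y + E) + zQ y * g y = zQ y * (a y + E) + z y * g y + d y)
    (hm : ∫⁻ y, z y ∂μ = ∫⁻ y, zQ y ∂μ) (hf : ∫⁻ y, zQ y ∂μ ≠ ⊤) :
    ∫⁻ y, a y * z y ∂μ + ∫⁻ y, g y * zQ y ∂μ = ∫⁻ y, a y * zQ y ∂μ + ∫⁻ y, g y * z y ∂μ + ∫⁻ y, d y ∂μ := by
  have h1 := lintegral_congr_ae hpt
  have m1 : Measurable (fun y => a y * z y) := ha.mul hz
  have m2 : Measurable (fun y => a y * zQ y) := ha.mul hzQ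
  have m3 : Measurable (fun y => g y * zQ y) := hg.mul hzQ
  have m4 : Measurable (fun y => g y * z y) := hg.mul hz
  have m5 : Measurable (fun y => E * z y) := hz.const_mul _
  have m6 : Measurable (fun y => E * zQ y) := hzQ.const_mul _
  have m7 : Measurable (fun y => a y * zQ y + E * zQ y + g y * z y) := (m2.add m6).add m4
  have l : ∫⁻ y, z y * (a y + E) + zQ y * g y ∂μ = ∫⁻ y, a y * z y ∂μ + E * ∫⁻ y, z y ∂μ + ∫⁻ y, g y * zQ y ∂μ := by
    rw [← lintegral_const_mul _ hz, ← lintegral_add_left m1, ← lintegral_add_right _ m3]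
    refine lintegral_congr fun y => ?_
    ring
  have r : ∫⁻ y, zQ y * (a y + E) + z y * g y + d y ∂μ = ∫⁻ y, a y * zQ y ∂μ + E * ∫⁻ y, zQ y ∂μ + ∫⁻ y, g y * z y ∂μ + ∫⁻ y, d y ∂μ := by
    rw [← lintegral_const_mul _ hzQ, ← lintegral_add_left m2, ← lintegral_add_right _ m4, ← lintegral_add_left m7]
    refine lintegral_congr fun y => ?_
    ring
  rw [l, r, hm] at h1
  have hfin : E * ∫⁻ y, zQ y ∂μ ≠ ⊤ := ENNReal.mul_ne_top hE hf
  refine (ENNReal.add_left_inj hfin).1 ?_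
  calc _ = ∫⁻ y, a y * z y ∂μ + E * ∫⁻ y, zQ y ∂μ + ∫⁻ y, g y * zQ y ∂μ := by ring
    _ = _ := by rw [h1]; ring

/-- measurable version of the potential -/
def gR (Q : Phase → ℝ) (r : ℝ) : ℝ := (∫⁻ s in Ioi r, ENNReal.ofReal (mm Q s/(4*π*s^2))).toReal

lemma gR_meas (Q : Phase → ℝ) : Measurable (gR Q) := by
  have : Antitone (fun r => ∫⁻ s in Ioi r, ENNReal.ofReal (mm Q s/(4*π*s^2))) := fun a b hab => lintegral_mono_set (Ioi_subset_Ioi hab)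
  exact this.measurable.ennreal_toReal

lemma gR_of {Q : Phase → ℝ} (h : NF Q) {r : ℝ} (hr : 0 < r) : ENNReal.ofReal (gR Q r) = ∫⁻ s in Ioi r, ENNReal.ofReal (mm Q s/(4*π*s^2)) := by
  refine ENNReal.ofReal_toReal ?_
  rw [← ofReal_integral_eq_lintegral_ofReal (h.mint hr) (ae_of_all _ fun s => div_nonneg (NF.mm_nonneg Q s) (by positivity))]
  exact ENNReal.ofReal_ne_top

lemma gR_eq {Q : Phase → ℝ} (h : NF Q) {r : ℝ} (hr : 0 < r) : gR Q r = NF.GG Q r := by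
  rw [gR, ← ofReal_integral_eq_lintegral_ofReal (h.mint hr) (ae_of_all _ fun s => div_nonneg (NF.mm_nonneg Q s) (by positivity)), ENNReal.toReal_ofReal]
  · rfl
  · exact integral_nonneg fun s => div_nonneg (NF.mm_nonneg Q s) (by positivity)

def cA (q : ℝ × ℝ × ℝ) : ℝ≥0∞ := ENNReal.ofReal (q.2.2^2) + ENNReal.ofReal q.1 * ENNReal.ofReal (1/q.2.1^2)
lemma cA_meas : Measurable cA := by unfold cA; fun_prop
def KF (f : Phase → ℝ) (w : ℝ × ℝ) : ℝ≥0∞ := ∫⁻ y, cA (w.2, y) * Zi f w y ∂M2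
def cG (Q : Phase → ℝ) (r : ℝ) : ℝ≥0∞ := 2 * ENNReal.ofReal (gR Q r)
lemma cG_meas (Q : Phase → ℝ) : Measurable (cG Q) := (gR_meas Q).ennreal_ofReal.const_mul _
def VF (Q f : Phase → ℝ) (w : ℝ × ℝ) : ℝ≥0∞ := ∫⁻ y, cG Q y.1 * Zi f w y ∂M2

lemma KF_meas {f : Phase → ℝ} (hf : Measurable f) : Measurable (KF f) := by
  have : Measurable (fun q : (ℝ × ℝ) × (ℝ × ℝ) => cA (q.1.2, q.2) * Zi f q.1 q.2) := (cA_meas.comp (by fun_prop)).mul (Zi_meas hf)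
  exact Measurable.lintegral_prod_right' (ν := M2) this

lemma VF_meas (Q : Phase → ℝ) {f : Phase → ℝ} (hf : Measurable f) : Measurable (VF Q f) := by
  have : Measurable (fun q : (ℝ × ℝ) × (ℝ × ℝ) => cG Q q.2.1 * Zi f q.1 q.2) := ((cG_meas Q).comp (by fun_prop)).mul (Zi_meas hf)
  exact Measurable.lintegral_prod_right' (ν := M2) this

lemma KF_tot {f : Phase → ℝ} (hf : Measurable f) (hs : SphSym f) :
    ∫⁻ z : Phase, ENNReal.ofReal (‖z.2‖^2) * ENNReal.ofReal (f z) = ENNReal.ofReal (4*π^2) * ∫⁻ w, KF f w ∂WW := by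
  rw [phase_int (G := fun z => ENNReal.ofReal (‖z.2‖^2) * ENNReal.ofReal (f z)) (by fun_prop)]
  · have e1 : ∫⁻ q, ENNReal.ofReal (‖(ptq q).2‖^2) * ENNReal.ofReal (f (ptq q)) ∂M3 = ∫⁻ q, cA q * ENNReal.ofReal (f (ptq q)) ∂M3 := by
      refine lintegral_congr_ae ?_
      filter_upwards [M3_pos] with q hq
      rw [pt_norm2 _ _ hq.1.le, ENNReal.ofReal_add (by positivity) (div_nonneg hq.1.le (by positivity)), cA, ← ENNReal.ofReal_mul hq.1.le]
      congr 3
      rw [mul_one_div]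
    rw [e1, layer hf cA_meas]
    rfl
  · intro x v x' v' h1 h2 h3
    simp only; rw [h2, sph_inv hs h1 h2 h3]

lemma VF_tot (Q : Phase → ℝ) {f : Phase → ℝ} (hf : Measurable f) :
    ∫⁻ t in Ioi (0:ℝ), cG Q t * nL f t = ENNReal.ofReal (4*π^2) * ∫⁻ w, VF Q f w ∂WW := by
  rw [← n_int hf (cG_meas Q), layer hf (c := fun q => cG Q q.2.1) ((cG_meas Q).comp (by fun_prop))]
  rfl

lemma VF_val {Q f : Phase → ℝ} (hQ : NF Q) (hf : NF f) (hm : mm f = mm Q) :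
    ∫⁻ t in Ioi (0:ℝ), cG Q t * nL f t = 2 * ∫⁻ r in Ioi (0:ℝ), ENNReal.ofReal (mm Q r^2/(4*π*r^2)) := by
  have mQ : Measurable (mm Q) := hQ.mm_mono.measurable
  have := tri_tonelli (fun s => mm Q s/(4*π*s^2)) (gR Q) (by fun_prop) (fun t ht => (gR_of hQ ht).symm) (nL f) (nL_meas hf.meas)
  simp only [cG, mul_assoc]
  rw [lintegral_const_mul' _ _ (by simp), this]
  congr 1
  refine setLIntegral_congr_fun measurableSet_Ioi fun r (hr : 0 < r) => ?_
  have e := hf.of_mm r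
  rw [hm] at e
  have h0 := NF.mm_nonneg Q r
  change _ * mL f r = _
  rw [← e, ← ENNReal.ofReal_mul (by positivity)]
  congr 1; ring

section
variable {Q f : Phase → ℝ} {R : ℝ}

lemma Zi_meas0 {f : Phase → ℝ} (hf : Measurable f) (w : ℝ × ℝ) : Measurable (fun y => Zi f w y) := (Zi_meas hf).comp (measurable_prodMk_left (x := w))

lemma Zi_01 (f : Phase → ℝ) (w y : ℝ × ℝ) : Zi f w y = 0 ∨ Zi f w y = 1 := by
  unfold Zi; split_ifs <;> simp

lemma M2_pos : ∀ᵐ y ∂M2, 0 < y.1 := (Measure.quasiMeasurePreserving_fst (μ := LP) (ν := volume)).ae (ae_restrict_mem measurableSet_Ioi)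

lemma Cx.mass_fin (h : Cx Q f R) {w : ℝ × ℝ} (hw : 0 < w.1 ∧ 0 < w.2) : ∫⁻ y, Zi Q w y ∂M2 ≠ ⊤ := by
  have e := M2_slice h.hQ.meas w (c := fun _ => 1) measurable_const
  simp only [one_mul] at e
  rw [e]
  refine ENNReal.mul_ne_top (by simp) (ne_of_lt ?_)
  obtain ⟨e1, _, hps⟩ := h.ps w hw
  have hR := h.hR
  calc ∫⁻ r in Ioi (0:ℝ), pBf Q w r ≤ ∫⁻ r in Ioi (0:ℝ), (Iic R).indicator (fun _ => ENNReal.ofReal R) r := by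
        refine setLIntegral_mono' measurableSet_Ioi fun r (hr : 0 < r) => ?_
        rw [hps.p r hr]
        by_cases hP : Pq Q w r = 0
        · rw [hP]; simp
        obtain ⟨_, h2, h3, h4⟩ := hps.V r hP
        rw [indicator_of_mem (show r ∈ Iic R from h2)]
        refine ENNReal.ofReal_le_ofReal (abs_le_of_sq_le_sq' ?_ hR.le).2
        have : 0 < w.2/r^2 := div_pos hw.2 (by positivity)
        linarith
    _ < ⊤ := by
        rw [lintegral_indicator measurableSet_Iic, setLIntegral_const, Measure.restrict_apply measurableSet_Iic]
        refine ENNReal.mul_lt_top ENNReal.ofReal_lt_top ?_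
        rw [inter_comm, Ioi_inter_Iic]
        simp

lemma null_p (c : ℝ → ℝ) (hc : Measurable c) : ∀ᵐ y ∂M2, y.2^2 + c y.1 ≠ 0 := by
  have hm : MeasurableSet {y : ℝ × ℝ | y.2^2 + c y.1 ≠ 0} := by
    have : Measurable (fun y : ℝ × ℝ => y.2^2 + c y.1) := by fun_prop
    exact (this (measurableSet_singleton 0)).compl
  refine (Measure.ae_prod_iff_ae_ae hm).mpr (ae_of_all _ fun r => ?_)
  have hfin : ({p : ℝ | p^2 + c r = 0}).Finite := by
    refine (Set.toFinite {√(-c r), -√(-c r)}).subset fun p hp => ?_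
    have hp : p^2 + c r = 0 := hp
    have : p^2 = √(-c r)^2 := by rw [Real.sq_sqrt (by nlinarith [sq_nonneg p])]; linarith
    rcases sq_eq_sq_iff_eq_or_eq_neg.1 this with h | h <;> simp [h]
  have := hfin.measure_zero (volume : Measure ℝ)
  rw [ae_iff]
  simpa using this

lemma Cx.slice (h : Cx Q f R) {w : ℝ × ℝ} (hw : 0 < w.1 ∧ 0 < w.2)
    (hm : ∫⁻ y, Zi f w y ∂M2 = ∫⁻ y, Zi Q w y ∂M2) :
    KF Q w + VF Q f w ≤ KF f w + VF Q Q w ∧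
      (KF Q w + VF Q f w = KF f w + VF Q Q w → KF Q w + VF Q f w ≠ ⊤ → ∀ᵐ y ∂M2, Zi f w y = Zi Q w y) := by
  obtain ⟨e1, he1, hps⟩ := h.ps w hw
  have mz := Zi_meas0 h.hf.meas w
  have mzQ := Zi_meas0 h.hQ.meas w
  rcases hps.f with h0 | h0
  · have hQ0 : ∀ᵐ y ∂M2, Zi Q w y = 0 := by
      filter_upwards [M2_pos] with y hy
      have := hps.Z y.1 hy y.2
      rw [h0 _ hy, if_neg (by simp)] at this
      exact this
    have hf0 : ∀ᵐ y ∂M2, Zi f w y = 0 := by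
      rw [lintegral_congr_ae hQ0, lintegral_zero, lintegral_eq_zero_iff mz] at hm
      exact hm
    have hEq : ∀ᵐ y ∂M2, Zi f w y = Zi Q w y := by
      filter_upwards [hQ0, hf0] with y a b using by rw [a, b]
    have eK : KF f w = KF Q w := lintegral_congr_ae (by filter_upwards [hEq] with y hy; rw [hy])
    have eV : VF Q f w = VF Q Q w := lintegral_congr_ae (by filter_upwards [hEq] with y hy; rw [hy])
    rw [eK, eV]
    exact ⟨le_rfl, fun _ _ => hEq⟩
  · set d : ℝ × ℝ → ℝ≥0∞ := fun y => if Zi f w y = Zi Q w y then 0 else ENNReal.ofReal |y.2^2 + (w.2/y.1^2 - 2*gR Q y.1 - 2*e1)| with hd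
    have md : Measurable d := by
      have := gR_meas Q
      refine Measurable.ite (measurableSet_eq_fun mz mzQ) measurable_const ?_
      refine Measurable.ennreal_ofReal ?_
      exact Measurable.abs (by fun_prop : Measurable fun y : ℝ × ℝ => y.2^2 + (w.2/y.1^2 - 2*gR Q y.1 - 2*e1))
    have hpt : ∀ᵐ y ∂M2, Zi f w y * (cA (w.2, y) + ENNReal.ofReal (-2*e1)) + Zi Q w y * cG Q y.1 = Zi Q w y * (cA (w.2, y) + ENNReal.ofReal (-2*e1)) + Zi f w y * cG Q y.1 + d y := by
      filter_upwards [M2_pos] with y hy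
      by_cases hzz : Zi f w y = Zi Q w y
      · simp only [hd, if_pos hzz, hzz, add_zero]
      have hdy : d y = ENNReal.ofReal |y.2^2 + (w.2/y.1^2 - 2*gR Q y.1 - 2*e1)| := if_neg hzz
      rw [hdy]
      have hZ := hps.Z y.1 hy y.2
      rw [h0 _ hy] at hZ
      have hg0 : 0 ≤ gR Q y.1 := ENNReal.toReal_nonneg
      have hiff : |y.2| < √(2*(e1 - (w.2/(2*y.1^2) - NF.GG Q y.1))) ↔ y.2^2 + (w.2/y.1^2 - 2*gR Q y.1 - 2*e1) < 0 := by
        rw [Real.lt_sqrt (abs_nonneg _), sq_abs, gR_eq h.hQ hy, show w.2/(2*y.1^2) = w.2/y.1^2/2 by field_simp]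
        constructor <;> intro h <;> linarith
      rw [if_congr hiff rfl rfl] at hZ
      have hl : 0 < w.2/y.1^2 := div_pos hw.2 (by positivity)
      have eA : cA (w.2, y) + ENNReal.ofReal (-2*e1) = ENNReal.ofReal (y.2^2 + w.2/y.1^2 - 2*e1) := by
        rw [cA, ← ENNReal.ofReal_mul hw.2.le, ← ENNReal.ofReal_add (by positivity) (by have := hw.2; positivity), ← ENNReal.ofReal_add (by have := hw.2; positivity) (by linarith)]
        congr 1; simp only [mul_one_div]; ring
      have eG : cG Q y.1 = ENNReal.ofReal (2*gR Q y.1) := by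
        rw [cG, ENNReal.ofReal_mul (by norm_num)]; simp
      rw [eA, eG]
      have hp2 := sq_nonneg y.2
      rcases Zi_01 f w y with a | a <;> rcases Zi_01 Q w y with b | b
      · exact absurd (a.trans b.symm) hzz
      · have hneg : y.2^2 + (w.2/y.1^2 - 2*gR Q y.1 - 2*e1) < 0 := by
          by_contra hc
          rw [if_neg hc] at hZ
          have : Zi Q w y = 0 := hZ
          rw [b] at this; exact one_ne_zero this
        rw [a, b, abs_of_neg hneg]
        simp only [zero_mul, one_mul, zero_add, add_zero]
        rw [← ENNReal.ofReal_add (by linarith) (by linarith)]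
        congr 1; ring
      · have hpos : 0 ≤ y.2^2 + (w.2/y.1^2 - 2*gR Q y.1 - 2*e1) := by
          by_contra hc
          rw [if_pos (not_le.1 hc)] at hZ
          have : Zi Q w y = 1 := hZ
          rw [b] at this; exact zero_ne_one this
        rw [a, b, abs_of_nonneg hpos]
        simp only [zero_mul, one_mul, zero_add, add_zero]
        rw [← ENNReal.ofReal_add (by linarith) (by linarith)]
        congr 1; ring
      · exact absurd (a.trans b.symm) hzz
    have mA : Measurable (fun y : ℝ × ℝ => cA (w.2, y)) := cA_meas.comp (measurable_prodMk_left (x := w.2))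
    have mG : Measurable (fun y : ℝ × ℝ => cG Q y.1) := (cG_meas Q).comp measurable_fst
    have key := slice_abs mz mzQ mA mG ENNReal.ofReal_ne_top hpt hm (h.mass_fin hw)
    change KF f w + VF Q Q w = KF Q w + VF Q f w + ∫⁻ y, d y ∂M2 at key
    refine ⟨by rw [key]; exact le_self_add, fun h1 h2 => ?_⟩
    rw [← h1] at key
    have hd0 : ∫⁻ y, d y ∂M2 = 0 := by
      have : KF Q w + VF Q f w + 0 = KF Q w + VF Q f w + ∫⁻ y, d y ∂M2 := by rw [add_zero]; exact key
      exact ((ENNReal.add_right_inj h2).1 this).symm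
    rw [lintegral_eq_zero_iff md] at hd0
    have := gR_meas Q
    filter_upwards [hd0, null_p (fun r => w.2/r^2 - 2*gR Q r - 2*e1) (by fun_prop)] with y h3 h4
    by_contra hzz
    have h3 : d y = 0 := h3
    rw [hd] at h3
    simp only [if_neg hzz, ENNReal.ofReal_eq_zero] at h3
    exact h4 (abs_nonpos_iff.1 h3)

lemma Cx.rigid (h : Cx Q f R) (hH : Ham f = Ham Q) : f =ᵐ[volume] Q := by
  have hR := h.hR
  have hC : 0 < Cc R := by unfold Cc; positivity
  have mQ : Measurable (mm Q) := h.hQ.mm_mono.measurable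
  have mf : Measurable (mm f) := h.hf.mm_mono.measurable
  have hham := h.ham
  have hd0 : fieldDist f Q ^2 = 0 := by
    rw [hH, sub_self] at hham
    have hc : 0 < π/(2*Cc R) := by positivity
    nlinarith [sq_nonneg (fieldDist f Q)]
  have hmm : mm f = mm Q := by
    rw [h.hf.fieldDist_eq h.hQ, ENNReal.toReal_eq_zero_iff] at hd0
    have hd1 := hd0.resolve_right (h.hf.dist_fin h.hQ).ne
    rw [lintegral_eq_zero_iff (by fun_prop)] at hd1
    have : mm f =ᵐ[volume] mm Q := by
      have h2 : ∀ᵐ r ∂volume, r ∈ Ioi (0:ℝ) → ENNReal.ofReal ((mm f r - mm Q r)^2 / (4*π*r^2)) = 0 := (ae_restrict_iff' measurableSet_Ioi).1 hd1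
      filter_upwards [h2] with r hr
      rcases le_or_gt r 0 with h0 | h0
      · rw [NF.mm_neg f h0, NF.mm_neg Q h0]
      · have := ENNReal.ofReal_eq_zero.1 (hr h0)
        have h5 : (mm f r - mm Q r)^2 / (4*π*r^2) = 0 := le_antisymm this (by positivity)
        rw [div_eq_zero_iff] at h5
        have h6 := h5.resolve_right (by positivity)
        exact sub_eq_zero.1 (pow_eq_zero_iff (by norm_num) |>.1 h6)
    exact (Continuous.ae_eq_iff_eq volume h.hf.mm_cont h.hQ.mm_cont).1 this
  have hfs : fieldSq f = fieldSq Q := by rw [h.hf.fieldSq_eq, h.hQ.fieldSq_eq, hmm]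
  have hk : kineticE f = kineticE Q := by unfold Ham at hH; linarith
  rw [h.hf.kin_eq, h.hQ.kin_eq, ENNReal.toReal_eq_toReal_iff' h.hf.kin.ne h.hQ.kin.ne, KF_tot h.hf.meas h.hf.sym, KF_tot h.hQ.meas h.hQ.sym] at hk
  have hpi : (0:ℝ) < 4*π^2 := by positivity
  have hp0 : ENNReal.ofReal (4*π^2) ≠ 0 := by simpa using hpi
  have hK : ∫⁻ w, KF f w ∂WW = ∫⁻ w, KF Q w ∂WW := (ENNReal.mul_right_inj hp0 ENNReal.ofReal_ne_top).1 hk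
  have hV : ∫⁻ w, VF Q f w ∂WW = ∫⁻ w, VF Q Q w ∂WW := by
    refine (ENNReal.mul_right_inj hp0 ENNReal.ofReal_ne_top).1 ?_
    rw [← VF_tot Q h.hf.meas, ← VF_tot Q h.hQ.meas, VF_val h.hQ h.hf hmm, VF_val h.hQ h.hQ rfl]
  have hKfin : ∫⁻ w, KF Q w ∂WW ≠ ⊤ := by
    intro hc
    have := h.hQ.kin
    rw [KF_tot h.hQ.meas h.hQ.sym, hc, ENNReal.mul_top hp0] at this
    exact lt_irrefl _ this
  have hVfin : ∫⁻ w, VF Q f w ∂WW ≠ ⊤ := by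
    intro hc
    have e := VF_tot Q h.hf.meas
    rw [VF_val h.hQ h.hf hmm, hc, ENNReal.mul_top hp0] at e
    exact ENNReal.mul_ne_top (by simp) h.hQ.sq_fin.ne e
  have hmass : ∀ᵐ w ∂WW, ∫⁻ y, Zi f w y ∂M2 = ∫⁻ y, Zi Q w y ∂M2 := by
    filter_upwards [h.mass] with w hw
    have e := M2_slice h.hQ.meas w (c := fun _ => 1) measurable_const
    have e' := M2_slice h.hf.meas w (c := fun _ => 1) measurable_const
    simp only [one_mul] at e e'
    rw [e, e', hw]
  have tot : ∫⁻ w, KF Q w + VF Q f w ∂WW = ∫⁻ w, KF Q w ∂WW + ∫⁻ w, VF Q f w ∂WW := lintegral_add_left (KF_meas h.hQ.meas) _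
  have tot2 : ∫⁻ w, KF f w + VF Q Q w ∂WW = ∫⁻ w, KF f w ∂WW + ∫⁻ w, VF Q Q w ∂WW := lintegral_add_left (KF_meas h.hf.meas) _
  have hfin : ∫⁻ w, KF Q w + VF Q f w ∂WW ≠ ⊤ := by rw [tot]; exact ENNReal.add_ne_top.2 ⟨hKfin, hVfin⟩
  have hae := ae_eq_of_ae_le_of_lintegral_le (f := fun w => KF Q w + VF Q f w) (g := fun w => KF f w + VF Q Q w) (μ := WW) (by
      filter_upwards [hmass, WW_pos] with w hw hw0 using (h.slice hw0 hw).1) hfin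
      ((KF_meas h.hf.meas).add (VF_meas Q h.hQ.meas)).aemeasurable (by rw [tot, tot2, hK, hV])
  have hZ : ∀ᵐ w ∂WW, ∀ᵐ y ∂M2, Zi f w y = Zi Q w y := by
    filter_upwards [hmass, WW_pos, hae, ae_lt_top ((KF_meas h.hQ.meas).add (VF_meas Q h.hf.meas)) hfin] with w hw hw0 h1 h2
    exact (h.slice hw0 hw).2 h1 h2.ne
  have hM3 : (fun q => ENNReal.ofReal (f (ptq q))) =ᵐ[M3] fun q => ENNReal.ofReal (Q (ptq q)) := by
    refine ae_eq_of_forall_setLIntegral_eq_of_sigmaFinite (h.hf.meas.comp ptq_meas).ennreal_ofReal (h.hQ.meas.comp ptq_meas).ennreal_ofReal fun s hs _ => ?_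
    have hc : Measurable (s.indicator (1 : ℝ × ℝ × ℝ → ℝ≥0∞)) := measurable_one.indicator hs
    have e : ∀ g : ℝ × ℝ × ℝ → ℝ≥0∞, ∫⁻ q in s, g q ∂M3 = ∫⁻ q, s.indicator (1 : ℝ × ℝ × ℝ → ℝ≥0∞) q * g q ∂M3 := by
      intro g
      rw [← lintegral_indicator hs]
      refine lintegral_congr fun q => ?_
      by_cases hq : q ∈ s <;> simp [indicator, hq]
    rw [e, e, layer h.hf.meas hc, layer h.hQ.meas hc]
    refine lintegral_congr_ae ?_
    filter_upwards [hZ] with w hw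
    refine lintegral_congr_ae ?_
    filter_upwards [hw] with y hy
    rw [hy]
  have mG : Measurable (fun z => if f z = Q z then (0:ℝ≥0∞) else 1) :=
    Measurable.ite (measurableSet_eq_fun h.hf.meas h.hQ.meas) measurable_const measurable_const
  have hfinal : ∫⁻ z, (if f z = Q z then (0:ℝ≥0∞) else 1) = 0 := by
    rw [phase_int mG]
    · have : ∫⁻ q, (if f (ptq q) = Q (ptq q) then (0:ℝ≥0∞) else 1) ∂M3 = ∫⁻ _q, 0 ∂M3 := by
        refine lintegral_congr_ae ?_
        filter_upwards [hM3] with q hq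
        rw [ENNReal.ofReal_eq_ofReal_iff (h.hf.nn _) (h.hQ.nn _)] at hq
        rw [if_pos hq]
      rw [this]; simp
    · intro x v x' v' h1 h2 h3
      simp only
      rw [sph_inv h.hf.sym h1 h2 h3, sph_inv h.hQ.sym h1 h2 h3]
  rw [lintegral_eq_zero_iff mG] at hfinal
  filter_upwards [hfinal] with z hz
  by_contra hne
  simp [hne] at hz

end



/-- Theorem 1: local variational characterization of `Q`. -/
theorem stmt0 (Q : Phase → ℝ) (F : ℝ → ℝ → ℝ) (e₀ : ℝ) (hQ : AssumptionA Q F e₀) :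
    ∃ C₀ : ℝ, 0 < C₀ ∧ ∀ R : ℝ, 0 < R → ∃ δ₀ : ℝ, 0 < δ₀ ∧
      ∀ f : Phase → ℝ, memErad f → EqMeas Q f →
        eNormE (fun z => f z - Q z) ≤ ENNReal.ofReal R →
        fieldDist f Q ≤ δ₀ →
        (Ham f - Ham Q ≥ C₀ * (fieldDist f Q) ^ 2 ∧
          (Ham f = Ham Q → f =ᵐ[volume] Q)) := by
  obtain ⟨R, hR, hRQ⟩ := Q_bdd hQ
  have hC : 0 < Cc R := by unfold Cc; positivity
  refine ⟨π/(2*Cc R), by positivity, fun _ _ => ⟨1, one_pos, fun f hf he _ _ => ?_⟩⟩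
  have h := mkCx hQ hR hRQ (memErad_NF hf) he
  exact ⟨h.ham, h.rigid⟩
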